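/- Let n ≥ 1. There are constants c₁, c₂ > 0 depending only on n such that for every compact set E ⊂ ℝ^{n+1}, c₁ S₁(E) ≤ γ_{Θ,+}(E) ≤ c₂ S₁(E), where S₁(E) = sup{μ(E) : μ ∈ Σ(E) with ‖∇_x W * μ‖_∞ ≤ 1} and Σ(E) is the family of positive Borel measures supported on E with μ(B_p(x̄,r)) ≤ r^{n+1} for all x̄ ∈ ℝ^{n+1} and r > 0. -/

import Mathlib

open MeasureTheory Real Set

noncomputable section

/-- The spatial factor `ℝⁿ`. -/
abbrev Spc (n : ℕ) := EuclideanSpace ℝ (Fin n)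

/-- The parabolic space `ℝ^{n+1} = ℝⁿ × ℝ`, points `x̄ = (x, t)`. -/
abbrev Pt (n : ℕ) := Spc n × ℝ

/-- The parabolic norm `|x̄|_p = max (|x|, |t|^{1/2})`. -/
def pnorm {n : ℕ} (p : Pt n) : ℝ := max ‖p.1‖ (Real.sqrt |p.2|)

/-- The parabolic ball of center `c` and radius `r`. -/
def pball {n : ℕ} (c : Pt n) (r : ℝ) : Set (Pt n) := {p | pnorm (p - c) < r}

/-- The heat kernel `W`. -/
def heatW {n : ℕ} (p : Pt n) : ℝ :=
  if 0 < p.2 then (4 * π * p.2) ^ (-(n : ℝ) / 2) * Real.exp (-‖p.1‖ ^ 2 / (4 * p.2)) else 0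

/-- The spatial gradient `∇ₓ W` of the heat kernel. -/
def gradW {n : ℕ} (p : Pt n) : Spc n :=
  if 0 < p.2 then
    (-(1 / (2 * p.2)) * (4 * π * p.2) ^ (-(n : ℝ) / 2) * Real.exp (-‖p.1‖ ^ 2 / (4 * p.2))) • p.1
  else 0

/-- Half time derivative `∂_t^{1/2} f (x,t) = ∫ (f(x,s) - f(x,t))/|s-t|^{3/2} ds`. -/
def halfT {n : ℕ} (f : Pt n → ℝ) (p : Pt n) : ℝ :=
  ∫ s : ℝ, (f (p.1, s) - f p) / |s - p.2| ^ (3 / 2 : ℝ)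

/-- A parabolic cube: product of `n` intervals of length `len` and a time interval
of length `len ^ 2`. -/
structure PCube (n : ℕ) where
  corner : Fin n → ℝ
  time : ℝ
  len : ℝ
  len_pos : 0 < len

/-- The set of points of a parabolic cube. -/
def PCube.toSet {n : ℕ} (Q : PCube n) : Set (Pt n) :=
  {p | (∀ i, p.1 i ∈ Set.Icc (Q.corner i) (Q.corner i + Q.len)) ∧
    p.2 ∈ Set.Icc Q.time (Q.time + Q.len ^ 2)}

/-- The dilation `λQ` of a parabolic cube: same center, side lengths `λ·len` and
`λ²·len²`. -/
def PCube.dilate {n : ℕ} (Q : PCube n) (lam : ℝ) (h : 0 < lam) : PCube n :=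
  ⟨fun i => Q.corner i + Q.len / 2 - lam * Q.len / 2,
    Q.time + Q.len ^ 2 / 2 - lam ^ 2 * Q.len ^ 2 / 2,
    lam * Q.len, mul_pos h Q.len_pos⟩

/-- Second directional derivative in the `i`-th spatial direction. -/
def dir2 {n : ℕ} (φ : Pt n → ℝ) (p : Pt n) (i : Fin n) : ℝ :=
  deriv (fun h : ℝ =>
    deriv (fun h' : ℝ => φ (p.1 + h' • (EuclideanSpace.single i 1 : Spc n), p.2)) h) 0

/-- Spatial Laplacian `Δₓ φ`. -/
def lapx {n : ℕ} (φ : Pt n → ℝ) (p : Pt n) : ℝ := ∑ i : Fin n, dir2 φ p i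

/-- A `C²` function `φ` is admissible for a parabolic cube `Q` if it is supported on `Q`,
`‖∇ₓ φ‖_∞ ≤ 1/ℓ(Q)` and `‖Δₓ φ‖_∞ + ‖∂_t φ‖_∞ ≤ 1/ℓ(Q)²`. -/
def Admissible {n : ℕ} (φ : Pt n → ℝ) (Q : PCube n) : Prop :=
  ContDiff ℝ 2 φ ∧ tsupport φ ⊆ Q.toSet ∧
  (∀ p : Pt n, ‖fderiv ℝ (fun y : Spc n => φ (y, p.2)) p.1‖ ≤ 1 / Q.len) ∧
  (∀ p : Pt n, |lapx φ p| + |deriv (fun s : ℝ => φ (p.1, s)) p.2| ≤ 1 / Q.len ^ 2)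

/-- The parabolic BMO norm of `f` is at most `C`. -/
def ParabBMOLe {n : ℕ} (f : Pt n → ℝ) (C : ℝ) : Prop :=
  ∀ Q : PCube n, ⨍ p in Q.toSet, |f p - ⨍ q in Q.toSet, f q| ≤ C

/-- `‖F‖_{Lip_{1/2,t}} ≤ C` : half-Lipschitz in time. -/
def LipHalfLe {n : ℕ} (F : Pt n → ℝ) (C : ℝ) : Prop :=
  ∀ (x : Spc n) (t u : ℝ), |F (x, t) - F (x, u)| ≤ C * Real.sqrt |t - u|

/-- Integral of a scalar function against a finite signed measure. -/
def sInt {n : ℕ} (ν : SignedMeasure (Pt n)) (f : Pt n → ℝ) : ℝ :=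
  ∫ y, f y ∂ν.toJordanDecomposition.posPart - ∫ y, f y ∂ν.toJordanDecomposition.negPart

/-- Integral of a vector-valued function against a finite signed measure. -/
def vInt {n : ℕ} (ν : SignedMeasure (Pt n)) (f : Pt n → Spc n) : Spc n :=
  ∫ y, f y ∂ν.toJordanDecomposition.posPart - ∫ y, f y ∂ν.toJordanDecomposition.negPart

/-- `W * ν`. -/
def convW {n : ℕ} (ν : SignedMeasure (Pt n)) (p : Pt n) : ℝ :=
  sInt ν (fun y => heatW (p - y))

/-- `∇ₓ W * ν`. -/
def convGradW {n : ℕ} (ν : SignedMeasure (Pt n)) (p : Pt n) : Spc n :=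
  vInt ν (fun y => gradW (p - y))

/-- `W * (φ ν)`, where `φν` is the measure with density `φ` w.r.t. `ν`. -/
def convWd {n : ℕ} (ν : SignedMeasure (Pt n)) (φ : Pt n → ℝ) (p : Pt n) : ℝ :=
  sInt ν (fun y => φ y * heatW (p - y))

/-- `∇ₓ W * (φ ν)`. -/
def convGradWd {n : ℕ} (ν : SignedMeasure (Pt n)) (φ : Pt n → ℝ) (p : Pt n) : Spc n :=
  vInt ν (fun y => φ y • gradW (p - y))

/-- `W * μ` for a positive measure `μ`. -/
def mconvW {n : ℕ} (μ : Measure (Pt n)) (p : Pt n) : ℝ := ∫ y, heatW (p - y) ∂μ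

/-- `∇ₓ W * μ` for a positive measure `μ`. -/
def mconvGradW {n : ℕ} (μ : Measure (Pt n)) (p : Pt n) : Spc n := ∫ y, gradW (p - y) ∂μ

/-- Upper parabolic growth of degree `n+1` with constant `1`. -/
def PGrowth {n : ℕ} (μ : Measure (Pt n)) : Prop :=
  ∀ (c : Pt n) (r : ℝ), 0 < r → μ (pball c r) ≤ ENNReal.ofReal (r ^ (n + 1))
/-- The capacity `γ_{Θ,+}(E)`. -/
def gammaThetaPlus (n : ℕ) (E : Set (Pt n)) : ℝ :=
  sSup {r : ℝ | ∃ μ : Measure (Pt n), μ Eᶜ = 0 ∧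
    (∀ p, ‖mconvGradW μ p‖ ≤ 1) ∧ ParabBMOLe (halfT (mconvW μ)) 1 ∧ r = (μ E).toReal}

/-- `S₁(E) = sup {μ(E) : μ ∈ Σ(E), ‖∇ₓ W * μ‖_∞ ≤ 1}`. -/
def S1cap (n : ℕ) (E : Set (Pt n)) : ℝ :=
  sSup {r : ℝ | ∃ μ : Measure (Pt n), μ Eᶜ = 0 ∧ PGrowth μ ∧
    (∀ p, ‖mconvGradW μ p‖ ≤ 1) ∧ r = (μ E).toReal}

/-- Comparison Gaussian. -/
def gG {n : ℕ} (x : Spc n) (t : ℝ) : ℝ := ((√t)⁻¹) ^ n * Real.exp (-‖x‖ ^ 2 / (8 * t))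

/-- Time derivative of the heat kernel. -/
def dtW {n : ℕ} (p : Pt n) : ℝ := heatW p * (-(n : ℝ) / (2 * p.2) + ‖p.1‖ ^ 2 / (4 * p.2 ^ 2))

lemma gG_nonneg {n : ℕ} (x : Spc n) (t : ℝ) : 0 ≤ gG x t := by
  unfold gG; positivity

lemma heatW_nonneg {n : ℕ} (p : Pt n) : 0 ≤ heatW p := by
  unfold heatW; split_ifs <;> positivity

lemma heatW_of_nonpos {n : ℕ} {p : Pt n} (h : p.2 ≤ 0) : heatW p = 0 := by
  unfold heatW; rw [if_neg (by linarith)]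

lemma pref_le (n : ℕ) {t : ℝ} (ht : 0 < t) : (4 * π * t) ^ (-(n : ℝ) / 2) ≤ ((√t)⁻¹) ^ n := by
  have h1 : t ≤ 4 * π * t := by nlinarith [Real.pi_gt_three]
  have h2 : (4 * π * t) ^ (-(n : ℝ) / 2) = ((√(4 * π * t))⁻¹) ^ n := by
    rw [Real.sqrt_eq_rpow, ← Real.rpow_neg (by positivity), ← Real.rpow_natCast,
      ← Real.rpow_mul (by positivity)]
    congr 1; ring
  rw [h2]
  gcongr

lemma heatW_le_exp {n : ℕ} (x : Spc n) {t : ℝ} (ht : 0 < t) :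
    heatW (x, t) ≤ ((√t)⁻¹) ^ n * (Real.exp (-‖x‖ ^ 2 / (8 * t)) * Real.exp (-‖x‖ ^ 2 / (8 * t))) := by
  unfold heatW
  simp only [ht, if_true]
  rw [← Real.exp_add]
  have : -‖x‖ ^ 2 / (8 * t) + -‖x‖ ^ 2 / (8 * t) = -‖x‖ ^ 2 / (4 * t) := by field_simp; ring
  rw [this]
  gcongr
  exact pref_le n ht

lemma exp_neg_le_one_aux {n : ℕ} (x : Spc n) {t : ℝ} (ht : 0 < t) :
    Real.exp (-‖x‖ ^ 2 / (8 * t)) ≤ 1 := by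
  rw [Real.exp_le_one_iff, neg_div]
  have : 0 ≤ ‖x‖ ^ 2 / (8 * t) := by positivity
  linarith

lemma heatW_le_gG {n : ℕ} (x : Spc n) {t : ℝ} (ht : 0 < t) : heatW (x, t) ≤ gG x t := by
  refine (heatW_le_exp x ht).trans ?_
  unfold gG
  have := exp_neg_le_one_aux x ht
  have h0 := Real.exp_pos (-‖x‖ ^ 2 / (8 * t))
  gcongr
  nlinarith

lemma mul_exp_neg_le (u : ℝ) : u * Real.exp (-u) ≤ 1 := by
  have h := Real.add_one_le_exp u
  have : Real.exp u * Real.exp (-u) = 1 := by rw [← Real.exp_add]; simp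
  nlinarith [Real.exp_pos (-u)]

lemma abs_dtW_le {n : ℕ} (x : Spc n) {t : ℝ} (ht : 0 < t) :
    |dtW (x, t)| ≤ ((n : ℝ) / 2 + 2) * (gG x t / t) := by
  unfold dtW
  simp only
  rw [abs_mul, abs_of_nonneg (heatW_nonneg _)]
  have h1 : |(-(n : ℝ) / (2 * t) + ‖x‖ ^ 2 / (4 * t ^ 2))| ≤ ((n : ℝ) / 2 + 2 * (‖x‖ ^ 2 / (8 * t))) / t := by
    refine (abs_add_le _ _).trans (le_of_eq ?_)
    rw [abs_div, abs_neg, abs_of_nonneg (by positivity), abs_of_pos (by positivity),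
      abs_of_nonneg (by positivity)]
    field_simp; ring
  set u := ‖x‖ ^ 2 / (8 * t) with hu
  have hu0 : 0 ≤ u := by positivity
  have hW := heatW_le_exp x ht
  unfold gG
  rw [neg_div (8 * t) (‖x‖ ^ 2), ← hu] at hW ⊢
  set e := Real.exp (-u)
  have he : 0 < e := Real.exp_pos _
  have he1 : e ≤ 1 := by simpa [e] using hu0
  have hue : u * e ≤ 1 := mul_exp_neg_le u
  set P := ((√t)⁻¹) ^ n
  have hP : 0 ≤ P := by positivity
  calc heatW (x, t) * |(-(n : ℝ) / (2 * t) + ‖x‖ ^ 2 / (4 * t ^ 2))|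
      ≤ (P * (e * e)) * (((n : ℝ) / 2 + 2 * u) / t) := by gcongr
    _ = P * e / t * ((n : ℝ) / 2 * e + 2 * (u * e)) := by ring
    _ ≤ P * e / t * ((n : ℝ) / 2 * 1 + 2 * 1) := by gcongr
    _ = _ := by ring

lemma norm_gradW_le {n : ℕ} (x : Spc n) {t : ℝ} (ht : 0 < t) :
    ‖gradW (x, t)‖ ≤ (√t)⁻¹ * gG x t := by
  have hg : ‖gradW (x, t)‖ = heatW (x, t) * (‖x‖ / (2 * t)) := by
    unfold gradW heatW
    simp only [ht, if_true]
    rw [norm_smul, Real.norm_eq_abs, abs_mul, abs_mul, abs_neg, abs_of_nonneg (by positivity),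
      abs_of_nonneg (by positivity), abs_of_nonneg (by positivity)]
    ring
  rw [hg]
  have hW := heatW_le_exp x ht
  unfold gG
  set u := ‖x‖ ^ 2 / (8 * t) with hu
  have hu0 : 0 ≤ u := by positivity
  rw [neg_div, ← hu] at hW ⊢
  set e := Real.exp (-u)
  have he : 0 < e := Real.exp_pos _
  have hs : 0 < √t := Real.sqrt_pos.2 ht
  have hst : √t * √t = t := Real.mul_self_sqrt ht.le
  have h2 : ‖x‖ / (2 * t) ≤ (√t)⁻¹ * (1 + u) := by
    set s := √t
    rw [hu, ← hst]
    rw [div_le_iff₀ (by positivity)]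
    field_simp
    nlinarith [sq_nonneg (‖x‖ - 2 * s), norm_nonneg x]
  have h3 : (1 + u) * e ≤ 1 := by
    have h := Real.add_one_le_exp u
    have : Real.exp u * e = 1 := by simp only [e]; rw [← Real.exp_add]; simp
    nlinarith
  set P := ((√t)⁻¹) ^ n
  have hP : 0 ≤ P := by positivity
  calc heatW (x, t) * (‖x‖ / (2 * t))
      ≤ (P * (e * e)) * ((√t)⁻¹ * (1 + u)) := by gcongr
    _ = (√t)⁻¹ * (P * e) * ((1 + u) * e) := by ring
    _ ≤ (√t)⁻¹ * (P * e) * 1 := by gcongr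
    _ = _ := by ring

lemma poly_exp_bound (m : ℕ) (v : ℝ) :
    (max v 1) ^ m * Real.exp (-v ^ 2 / 8) ≤ 8 ^ m * m.factorial * Real.exp 1 := by
  have h1 : (max v 1) ^ m ≤ (8 * (1 + v ^ 2 / 8)) ^ m := by
    gcongr
    rw [max_le_iff]
    constructor <;> nlinarith [sq_nonneg (v - 1)]
  have h2 := Real.pow_div_factorial_le_exp (x := 1 + v ^ 2 / 8) (by positivity) m
  rw [div_le_iff₀ (by positivity)] at h2
  have h3 : Real.exp (1 + v ^ 2 / 8) * Real.exp (-v ^ 2 / 8) = Real.exp 1 := by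
    rw [← Real.exp_add]; congr 1; ring
  calc (max v 1) ^ m * Real.exp (-v ^ 2 / 8)
      ≤ (8 * (1 + v ^ 2 / 8)) ^ m * Real.exp (-v ^ 2 / 8) := by gcongr
    _ = 8 ^ m * (1 + v ^ 2 / 8) ^ m * Real.exp (-v ^ 2 / 8) := by rw [mul_pow]
    _ ≤ 8 ^ m * (Real.exp (1 + v ^ 2 / 8) * m.factorial) * Real.exp (-v ^ 2 / 8) := by gcongr
    _ = 8 ^ m * m.factorial * (Real.exp (1 + v ^ 2 / 8) * Real.exp (-v ^ 2 / 8)) := by ring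
    _ = _ := by rw [h3]

/-- constant -/
def cM (m : ℕ) : ℝ := 8 ^ m * m.factorial * Real.exp 1

lemma cM_pos (m : ℕ) : 0 < cM m := by unfold cM; positivity

/-- `|x̄|^{n+2j} G ≤ C t^j`. -/
lemma gG_pnorm {n : ℕ} (x : Spc n) {t : ℝ} (ht : 0 < t) (j : ℕ) :
    pnorm (x, t) ^ (n + 2 * j) * gG x t ≤ cM (n + 2 * j) * t ^ j := by
  have hs : 0 < √t := Real.sqrt_pos.2 ht
  have hst : √t * √t = t := Real.mul_self_sqrt ht.le
  have h := poly_exp_bound (n + 2 * j) (‖x‖ / √t)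
  have hp : pnorm (x, t) = √t * max (‖x‖ / √t) 1 := by
    unfold pnorm
    rw [mul_max_of_nonneg _ _ hs.le, mul_div_cancel₀ _ hs.ne', mul_one]
    simp [abs_of_pos ht]
  have he : -‖x‖ ^ 2 / (8 * t) = -(‖x‖ / √t) ^ 2 / 8 := by
    rw [div_pow, sq (√t), hst]; field_simp
  unfold gG
  rw [hp, he, mul_pow]
  have h4 : √t ^ (n + 2 * j) * ((√t)⁻¹) ^ n = t ^ j := by
    rw [pow_add, mul_right_comm, ← mul_pow, mul_inv_cancel₀ hs.ne', one_pow, one_mul, pow_mul, sq, hst]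
  calc √t ^ (n + 2 * j) * max (‖x‖ / √t) 1 ^ (n + 2 * j) * (((√t)⁻¹) ^ n * Real.exp (-(‖x‖ / √t) ^ 2 / 8))
      = (√t ^ (n + 2 * j) * ((√t)⁻¹) ^ n) * (max (‖x‖ / √t) 1 ^ (n + 2 * j) * Real.exp (-(‖x‖ / √t) ^ 2 / 8)) := by ring
    _ ≤ t ^ j * cM (n + 2 * j) := by rw [h4]; gcongr; exact h
    _ = _ := by ring

lemma pnorm_nonneg {n : ℕ} (p : Pt n) : 0 ≤ pnorm p := by
  unfold pnorm; exact (norm_nonneg _).trans (le_max_left _ _)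

lemma heatW_pnorm {n : ℕ} (p : Pt n) (j : ℕ) :
    pnorm p ^ (n + 2 * j) * heatW p ≤ cM (n + 2 * j) * |p.2| ^ j := by
  by_cases h : 0 < p.2
  · have h1 := gG_pnorm p.1 h j
    rw [abs_of_pos h]
    refine le_trans ?_ h1
    have := heatW_le_gG p.1 h
    have := pnorm_nonneg p
    gcongr
  · rw [heatW_of_nonpos (by linarith)]
    have := cM_pos (n + 2 * j)
    simp only [mul_zero]; positivity

lemma dtW_of_nonpos {n : ℕ} {p : Pt n} (h : p.2 ≤ 0) : dtW p = 0 := by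
  unfold dtW; rw [heatW_of_nonpos h, zero_mul]

lemma dtW_pnorm {n : ℕ} (p : Pt n) :
    pnorm p ^ (n + 2) * |dtW p| ≤ ((n : ℝ) / 2 + 2) * cM (n + 2) := by
  have hc := cM_pos (n + 2)
  by_cases h : 0 < p.2
  · have h1 := gG_pnorm p.1 h 1
    have h2 := abs_dtW_le p.1 h
    have h3 := pnorm_nonneg p
    simp only [mul_one, pow_one] at h1
    calc pnorm p ^ (n + 2) * |dtW p| ≤ pnorm p ^ (n + 2) * (((n : ℝ) / 2 + 2) * (gG p.1 p.2 / p.2)) := by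
          gcongr
      _ = ((n : ℝ) / 2 + 2) * ((pnorm p ^ (n + 2) * gG p.1 p.2) / p.2) := by ring
      _ ≤ ((n : ℝ) / 2 + 2) * cM (n + 2) := by
          gcongr
          rw [div_le_iff₀ h]; exact h1
  · rw [dtW_of_nonpos (by linarith), abs_zero, mul_zero]; positivity

lemma norm_le_pnorm {n : ℕ} (p : Pt n) : ‖p.1‖ ≤ pnorm p := le_max_left _ _
lemma sqrt_le_pnorm {n : ℕ} (p : Pt n) : √|p.2| ≤ pnorm p := le_max_right _ _

lemma heatW_hasDerivAt {n : ℕ} (x : Spc n) (t : ℝ) (h : x ≠ 0 ∨ t ≠ 0) :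
    HasDerivAt (fun s => heatW (x, s)) (dtW (x, t)) t := by
  rcases lt_trichotomy t 0 with ht | ht | ht
  · rw [dtW_of_nonpos (by simpa using ht.le)]
    refine (hasDerivAt_const t (0 : ℝ)).congr_of_eventuallyEq ?_
    filter_upwards [eventually_lt_nhds ht] with s hs
    exact heatW_of_nonpos (by simpa using hs.le)
  · subst ht
    have hx : x ≠ 0 := by simpa using h
    have hx' : 0 < ‖x‖ := norm_pos_iff.2 hx
    rw [dtW_of_nonpos (by simp)]
    rw [hasDerivAt_iff_isLittleO_nhds_zero]
    simp only [zero_add, smul_zero, sub_zero]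
    have h0 : heatW (x, (0 : ℝ)) = 0 := heatW_of_nonpos (by simp)
    simp only [h0, sub_zero]
    have : (fun s : ℝ => heatW (x, s)) =O[nhds 0] fun s => s ^ 2 := by
      refine Asymptotics.IsBigO.of_bound (cM (n + 2 * 2) / ‖x‖ ^ (n + 2 * 2)) ?_
      filter_upwards with s
      rw [Real.norm_of_nonneg (heatW_nonneg _), norm_pow, Real.norm_eq_abs, div_mul_eq_mul_div,
        le_div_iff₀ (by positivity), mul_comm]
      refine le_trans ?_ (heatW_pnorm (x, s) 2)
      have := heatW_nonneg (x, s)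
      gcongr
      exact norm_le_pnorm (x, s)
    refine this.trans_isLittleO ?_
    have := Asymptotics.isLittleO_pow_pow (𝕜 := ℝ) (m := 1) (n := 2) (by norm_num)
    simpa using this
  · have e : (fun s => heatW (x, s)) =ᶠ[nhds t]
        fun s => (4 * π * s) ^ (-(n : ℝ) / 2) * Real.exp (-‖x‖ ^ 2 / (4 * s)) := by
      filter_upwards [eventually_gt_nhds ht] with s hs
      unfold heatW; simp only [hs, if_true]
    refine HasDerivAt.congr_of_eventuallyEq ?_ e
    have h1 : HasDerivAt (fun s : ℝ => 4 * π * s) (4 * π) t := by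
      simpa using (hasDerivAt_id t).const_mul (4 * π)
    have h2 := h1.rpow_const (p := -(n : ℝ) / 2) (Or.inl (by positivity))
    have h3 : HasDerivAt (fun s : ℝ => -‖x‖ ^ 2 / (4 * s)) (‖x‖ ^ 2 / (4 * t ^ 2)) t := by
      have h4 : HasDerivAt (fun s : ℝ => 4 * s) 4 t := by
        simpa using (hasDerivAt_id t).const_mul (4 : ℝ)
      have := (hasDerivAt_const t (-‖x‖ ^ 2)).div h4 (by positivity)
      refine this.congr_deriv ?_
      field_simp; ring
    have h5 := h2.mul h3.exp
    refine h5.congr_deriv ?_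
    unfold dtW heatW
    simp only [ht, if_true]
    rw [Real.rpow_sub_one (by positivity)]
    field_simp

lemma heatW_measurable {n : ℕ} : Measurable (heatW : Pt n → ℝ) := by
  unfold heatW
  refine Measurable.ite (measurableSet_lt measurable_const measurable_snd) ?_ measurable_const
  fun_prop

lemma gradW_measurable {n : ℕ} : Measurable (gradW : Pt n → Spc n) := by
  unfold gradW
  refine Measurable.ite (measurableSet_lt measurable_const measurable_snd) ?_ measurable_const
  fun_prop

lemma dtW_measurable {n : ℕ} : Measurable (dtW : Pt n → ℝ) := by
  unfold dtW
  have := heatW_measurable (n := n)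
  fun_prop

lemma gauss_integrable {n : ℕ} {b : ℝ} (hb : 0 < b) :
    Integrable (fun x : Spc n => Real.exp (-b * ‖x‖ ^ 2)) := by
  have := GaussianFourier.integrable_cexp_neg_mul_sq_norm_add (V := Spc n) (b := b) (by simpa using hb) 0 0
  have h := this.norm
  refine h.congr ?_
  filter_upwards with x
  simp [Complex.norm_exp]
  left
  norm_cast

lemma lint_gauss {n : ℕ} {A t : ℝ} (hA : 0 < A) (ht : 0 < t) :
    ∫⁻ x : Spc n, ENNReal.ofReal (((√t)⁻¹) ^ n * Real.exp (-‖x‖ ^ 2 / (A * t))) =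
      ENNReal.ofReal (√(π * A) ^ n) := by
  have hb : 0 < (A * t)⁻¹ := by positivity
  have h1 := GaussianFourier.integral_rexp_neg_mul_sq_norm (V := Spc n) hb
  have h2 := (gauss_integrable (n := n) hb).const_mul (((√t)⁻¹) ^ n)
  have e : ∀ x : Spc n, ((√t)⁻¹) ^ n * Real.exp (-‖x‖ ^ 2 / (A * t)) =
    ((√t)⁻¹) ^ n * Real.exp (-(A * t)⁻¹ * ‖x‖ ^ 2) := by
    intro x; congr 2; field_simp
  simp_rw [e]
  rw [← ofReal_integral_eq_lintegral_ofReal h2 (by filter_upwards with x; positivity),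
    integral_const_mul, h1]
  congr 1
  rw [finrank_euclideanSpace_fin]
  have hs : 0 < √t := Real.sqrt_pos.2 ht
  have : (π / (A * t)⁻¹) ^ ((n : ℝ) / 2) = √(π * A) ^ n * √t ^ n := by
    rw [← mul_pow, ← Real.sqrt_mul (by positivity), Real.sqrt_eq_rpow, ← Real.rpow_natCast,
      ← Real.rpow_mul (by positivity)]
    congr 1
    · field_simp
    · ring
  rw [this, inv_pow]
  field_simp

lemma lint_abs (g : ℝ → ENNReal) :
    ∫⁻ h, g |h| = 2 * ∫⁻ h in Ioi 0, g h := by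
  have h1 := lintegral_add_compl (μ := volume) (fun h : ℝ => g |h|) (measurableSet_Ioi (a := (0 : ℝ)))
  rw [← h1, two_mul]
  congr 1
  · refine setLIntegral_congr_fun measurableSet_Ioi ?_
    intro h hh
    simp only [abs_of_pos (show (0 : ℝ) < h from hh)]
  · rw [compl_Ioi, setLIntegral_congr (Iio_ae_eq_Iic (a := (0 : ℝ)) (μ := volume)).symm]
    have h2 := (Measure.measurePreserving_neg (volume : Measure ℝ)).setLIntegral_comp_preimage_emb
      (MeasurableEquiv.neg ℝ).measurableEmbedding g (Ioi 0)
    rw [← h2]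
    have : (Neg.neg ⁻¹' Ioi (0 : ℝ)) = Iio 0 := by ext; simp
    rw [this]
    refine setLIntegral_congr_fun measurableSet_Iio ?_
    intro h hh
    simp only [abs_of_neg (show h < (0 : ℝ) from hh)]

lemma rpow_three_half (h : ℝ) : |h| ^ (3 / 2 : ℝ) = |h| * √|h| := by
  rcases eq_or_ne h 0 with rfl | hh
  · simp
  · have : 0 < |h| := abs_pos.2 hh
    rw [show (3 / 2 : ℝ) = 1 + 1 / 2 by norm_num, Real.rpow_add this, Real.rpow_one,
      Real.sqrt_eq_rpow]

lemma lint_half_Ioc {T : ℝ} (hT : 0 < T) :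
    ∫⁻ h in Ioc 0 T, ENNReal.ofReal ((√h)⁻¹) = ENNReal.ofReal (2 * √T) := by
  have hi : IntervalIntegrable (fun h : ℝ => h ^ (-(1 / 2) : ℝ)) volume 0 T :=
    intervalIntegral.intervalIntegrable_rpow' (by norm_num)
  have h2 : IntegrableOn (fun h : ℝ => h ^ (-(1 / 2) : ℝ)) (Ioc 0 T) := by
    rwa [intervalIntegrable_iff_integrableOn_Ioc_of_le hT.le] at hi
  have e : ∀ h ∈ Ioc 0 T, ENNReal.ofReal ((√h)⁻¹) = ENNReal.ofReal (h ^ (-(1 / 2) : ℝ)) := by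
    intro h hh
    rw [Real.rpow_neg hh.1.le, Real.sqrt_eq_rpow]
  rw [setLIntegral_congr_fun measurableSet_Ioc e, ← ofReal_integral_eq_lintegral_ofReal h2]
  · rw [← intervalIntegral.integral_of_le hT.le, integral_rpow (Or.inl (by norm_num))]
    congr 1
    rw [Real.sqrt_eq_rpow]; norm_num; ring
  · filter_upwards [ae_restrict_mem measurableSet_Ioc] with h hh
    exact Real.rpow_nonneg hh.1.le _

lemma lint_threehalf_Ioi {T : ℝ} (hT : 0 < T) :
    ∫⁻ h in Ioi T, ENNReal.ofReal ((|h| ^ (3 / 2 : ℝ))⁻¹) = ENNReal.ofReal (2 / √T) := by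
  have h2 : IntegrableOn (fun h : ℝ => h ^ (-(3 / 2) : ℝ)) (Ioi T) :=
    integrableOn_Ioi_rpow_of_lt (by norm_num) hT
  have e : ∀ h ∈ Ioi T, ENNReal.ofReal ((|h| ^ (3 / 2 : ℝ))⁻¹) = ENNReal.ofReal (h ^ (-(3 / 2) : ℝ)) := by
    intro h hh
    have : 0 < h := hT.trans hh
    rw [Real.rpow_neg this.le, abs_of_pos this]
  rw [setLIntegral_congr_fun measurableSet_Ioi e, ← ofReal_integral_eq_lintegral_ofReal h2]
  · rw [integral_Ioi_rpow_of_lt (by norm_num) hT]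
    congr 1
    rw [Real.sqrt_eq_rpow, show (-(3 / 2) : ℝ) + 1 = -(1 / 2) by norm_num, Real.rpow_neg hT.le]
    field_simp
  · filter_upwards [ae_restrict_mem measurableSet_Ioi] with h hh
    exact Real.rpow_nonneg (hT.trans hh).le _

lemma lint_half_near {T : ℝ} (hT : 0 < T) :
    ∫⁻ h : ℝ, (if |h| ≤ T then ENNReal.ofReal ((√|h|)⁻¹) else 0) ≤ ENNReal.ofReal (4 * √T) := by
  rw [lint_abs (fun h => if h ≤ T then ENNReal.ofReal ((√h)⁻¹) else 0)]
  have : ∀ h ∈ Ioi (0 : ℝ), (if h ≤ T then ENNReal.ofReal ((√h)⁻¹) else 0) =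
      (Ioc 0 T).indicator (fun h => ENNReal.ofReal ((√h)⁻¹)) h := by
    intro h hh
    have hh' : 0 < h := hh
    simp [indicator, hh']
  rw [setLIntegral_congr_fun measurableSet_Ioi this]
  calc _ ≤ 2 * ∫⁻ h, (Ioc 0 T).indicator (fun h => ENNReal.ofReal ((√h)⁻¹)) h := by
        gcongr; exact Measure.restrict_le_self
    _ = _ := by
        rw [lintegral_indicator measurableSet_Ioc, lint_half_Ioc hT,
          show (2 : ENNReal) = ENNReal.ofReal 2 by simp, ← ENNReal.ofReal_mul (by norm_num)]
        ring_nf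

lemma lint_threehalf_far {T : ℝ} (hT : 0 < T) :
    ∫⁻ h : ℝ, (if T < |h| then ENNReal.ofReal ((|h| ^ (3 / 2 : ℝ))⁻¹) else 0) ≤
      ENNReal.ofReal (4 / √T) := by
  have e : ∀ h : ℝ, (if T < |h| then ENNReal.ofReal ((|h| ^ (3 / 2 : ℝ))⁻¹) else 0) =
    (fun h => if T < h then ENNReal.ofReal ((|h| ^ (3 / 2 : ℝ))⁻¹) else 0) |h| := by
    intro h; simp
  rw [lintegral_congr e,
    lint_abs (fun h => if T < h then ENNReal.ofReal ((|h| ^ (3 / 2 : ℝ))⁻¹) else 0)]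
  have : ∀ h ∈ Ioi (0 : ℝ), (fun h : ℝ => if T < h then ENNReal.ofReal ((|h| ^ (3 / 2 : ℝ))⁻¹) else 0) h =
      (Ioi T).indicator (fun h => ENNReal.ofReal ((|h| ^ (3 / 2 : ℝ))⁻¹)) h := by
    intro h hh
    simp [indicator]
  rw [setLIntegral_congr_fun measurableSet_Ioi this]
  calc _ ≤ 2 * ∫⁻ h, (Ioi T).indicator (fun h => ENNReal.ofReal ((|h| ^ (3 / 2 : ℝ))⁻¹)) h := by
        gcongr; exact Measure.restrict_le_self
    _ = _ := by
        rw [lintegral_indicator measurableSet_Ioi, lint_threehalf_Ioi hT,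
          show (2 : ENNReal) = ENNReal.ofReal 2 by simp, ← ENNReal.ofReal_mul (by norm_num)]
        ring_nf

lemma lint_min {T : ℝ} (hT : 0 < T) :
    ∫⁻ h : ℝ, ENNReal.ofReal (min 1 (|h| / T) * (|h| ^ (3 / 2 : ℝ))⁻¹) ≤ ENNReal.ofReal (8 / √T) := by
  calc _ ≤ ∫⁻ h : ℝ, (ENNReal.ofReal (T⁻¹) * (if |h| ≤ T then ENNReal.ofReal ((√|h|)⁻¹) else 0)
        + (if T < |h| then ENNReal.ofReal ((|h| ^ (3 / 2 : ℝ))⁻¹) else 0)) := by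
        refine lintegral_mono fun h => ?_
        by_cases hh : |h| ≤ T
        · simp only [hh, if_true, not_lt.2 hh, if_false, add_zero]
          rw [← ENNReal.ofReal_mul (by positivity)]
          refine ENNReal.ofReal_le_ofReal ?_
          calc _ ≤ (|h| / T) * (|h| ^ (3 / 2 : ℝ))⁻¹ := by gcongr; exact min_le_right _ _
            _ ≤ _ := by
              rw [rpow_three_half]
              rcases eq_or_ne h 0 with rfl | h0
              · simp
              · have : 0 < |h| := abs_pos.2 h0
                have : 0 < √|h| := Real.sqrt_pos.2 this
                apply le_of_eq; field_simp
        · have hh' := not_le.1 hh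
          simp only [hh, if_false, hh', if_true, mul_zero, zero_add]
          refine ENNReal.ofReal_le_ofReal ?_
          calc _ ≤ 1 * (|h| ^ (3 / 2 : ℝ))⁻¹ := by gcongr; exact min_le_left _ _
            _ = _ := one_mul _
    _ ≤ ENNReal.ofReal (T⁻¹) * ENNReal.ofReal (4 * √T) + ENNReal.ofReal (4 / √T) := by
        rw [lintegral_add_left, lintegral_const_mul]
        · gcongr
          · exact lint_half_near hT
          · exact lint_threehalf_far hT
        · exact Measurable.ite (measurableSet_le (by fun_prop) (by fun_prop)) (by fun_prop) (by fun_prop)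
        · exact (Measurable.ite (measurableSet_le (by fun_prop) (by fun_prop)) (by fun_prop) (by fun_prop)).const_mul _
    _ = _ := by
        rw [← ENNReal.ofReal_mul (by positivity), ← ENNReal.ofReal_add (by positivity) (by positivity)]
        congr 1
        have : 0 < √T := Real.sqrt_pos.2 hT
        have h2 : √T * √T = T := Real.mul_self_sqrt hT.le
        field_simp
        nlinarith

/-- `∫ g(t) |t-τ|^{-1/2} dt` for bounded integrable `g`. -/
lemma lint_half_conv (g : ℝ → ENNReal) (hg : Measurable g) (A : ENNReal) (hA : ∀ t, g t ≤ A)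
    {T : ℝ} (hT : 0 < T) (τ : ℝ) :
    ∫⁻ t, g t * ENNReal.ofReal ((√|t - τ|)⁻¹) ≤
      A * ENNReal.ofReal (4 * √T) + (∫⁻ t, g t) * ENNReal.ofReal ((√T)⁻¹) := by
  calc _ ≤ ∫⁻ t, (A * (if |t - τ| ≤ T then ENNReal.ofReal ((√|t - τ|)⁻¹) else 0) +
        g t * ENNReal.ofReal ((√T)⁻¹)) := by
        refine lintegral_mono fun t => ?_
        by_cases h : |t - τ| ≤ T
        · simp only [h, if_true]
          exact le_add_right (by gcongr; exact hA t)
        · simp only [h, if_false, mul_zero, zero_add]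
          have := not_le.1 h
          gcongr
    _ = A * (∫⁻ t, (if |t - τ| ≤ T then ENNReal.ofReal ((√|t - τ|)⁻¹) else 0)) +
        (∫⁻ t, g t) * ENNReal.ofReal ((√T)⁻¹) := by
        have hm : Measurable fun t : ℝ => (if |t - τ| ≤ T then ENNReal.ofReal ((√|t - τ|)⁻¹) else 0) :=
          Measurable.ite (measurableSet_le (by fun_prop) (by fun_prop)) (by fun_prop) (by fun_prop)
        rw [lintegral_add_left (hm.const_mul _), lintegral_const_mul _ hm, lintegral_mul_const _ hg]
    _ ≤ _ := by
        gcongr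
        rw [lintegral_sub_right_eq_self (fun h : ℝ => if |h| ≤ T then ENNReal.ofReal ((√|h|)⁻¹) else 0) τ]
        exact lint_half_near hT

lemma lint_heatW_le {n : ℕ} (t : ℝ) :
    ∫⁻ x : Spc n, ENNReal.ofReal (heatW (x, t)) ≤ ENNReal.ofReal (√(π * 8) ^ n) := by
  by_cases ht : 0 < t
  · rw [← lint_gauss (n := n) (A := 8) (t := t) (by norm_num) ht]
    refine lintegral_mono fun x => ENNReal.ofReal_le_ofReal ?_
    exact heatW_le_gG x ht
  · have : ∀ x : Spc n, heatW (x, t) = 0 := fun x => heatW_of_nonpos (by simpa using ht)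
    simp [this]

lemma heatW_diff_le {n : ℕ} (x : Spc n) {t s : ℝ} (ht : 0 < t) (hs : |s - t| ≤ t / 2) :
    |heatW (x, s) - heatW (x, t)| ≤ ((n : ℝ) / 2 + 2) * 2 * (√2) ^ n * (|s - t| / t) *
      (((√t)⁻¹) ^ n * Real.exp (-‖x‖ ^ 2 / (12 * t))) := by
  have key : ∀ σ ∈ Icc (t / 2) (3 * t / 2), |dtW (x, σ)| ≤ ((n : ℝ) / 2 + 2) * 2 * (√2) ^ n / t *
      (((√t)⁻¹) ^ n * Real.exp (-‖x‖ ^ 2 / (12 * t))) := by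
    intro σ hσ
    have hσ0 : 0 < σ := by linarith [hσ.1]
    refine (abs_dtW_le x hσ0).trans ?_
    have h1 : gG x σ ≤ (√2) ^ n * ((√t)⁻¹) ^ n * Real.exp (-‖x‖ ^ 2 / (12 * t)) := by
      unfold gG
      rw [← mul_pow]
      have h2 : (√σ)⁻¹ ≤ √2 * (√t)⁻¹ := by
        rw [← div_eq_mul_inv, ← Real.sqrt_div (by norm_num), ← Real.sqrt_inv]
        apply Real.sqrt_le_sqrt
        rw [inv_le_comm₀ hσ0 (by positivity)]
        rw [inv_div]; exact hσ.1
      have h3 : -‖x‖ ^ 2 / (8 * σ) ≤ -‖x‖ ^ 2 / (12 * t) := by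
        rw [neg_div, neg_div, neg_le_neg_iff]
        apply div_le_div_of_nonneg_left (by positivity) (by positivity)
        linarith [hσ.2]
      gcongr
    calc ((n : ℝ) / 2 + 2) * (gG x σ / σ)
        ≤ ((n : ℝ) / 2 + 2) * (((√2) ^ n * ((√t)⁻¹) ^ n * Real.exp (-‖x‖ ^ 2 / (12 * t))) / (t / 2)) := by
          gcongr
          exact hσ.1
      _ = _ := by field_simp
  rw [abs_le] at hs
  have := (convex_Icc (t / 2) (3 * t / 2)).norm_image_sub_le_of_norm_hasDerivWithin_le
    (f := fun s => heatW (x, s)) (f' := fun s => dtW (x, s)) (x := t) (y := s)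
    (fun σ hσ => (heatW_hasDerivAt x σ (Or.inr (by linarith [hσ.1]))).hasDerivWithinAt) key
    ⟨by linarith, by linarith⟩ ⟨by linarith, by linarith⟩
  simp only [Real.norm_eq_abs] at this
  refine this.trans (le_of_eq ?_)
  ring

/-- constant for the L¹ modulus of continuity -/
lemma lint_modulus (n : ℕ) : ∃ C : ℝ, 0 < C ∧ ∀ t s : ℝ, t ≠ 0 →
    ∫⁻ x : Spc n, ‖heatW (x, s) - heatW (x, t)‖ₑ ≤ ENNReal.ofReal (C * min 1 (|s - t| / |t|)) := by
  set C1 := ((n : ℝ) / 2 + 2) * 2 * (√2) ^ n * √(π * 12) ^ n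
  set C2 := √(π * 8) ^ n + √(π * 8) ^ n
  have hC1 : 0 < C1 := by positivity
  have hC2 : 0 < C2 := by positivity
  refine ⟨2 * C1 + 2 * C2, by positivity, fun t s ht => ?_⟩
  have triv : ∫⁻ x : Spc n, ‖heatW (x, s) - heatW (x, t)‖ₑ ≤ ENNReal.ofReal C2 := by
    calc _ ≤ ∫⁻ x : Spc n, (ENNReal.ofReal (heatW (x, s)) + ENNReal.ofReal (heatW (x, t))) := by
          refine lintegral_mono fun x => ?_
          rw [← ENNReal.ofReal_add (heatW_nonneg _) (heatW_nonneg _), Real.enorm_eq_ofReal_abs]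
          refine ENNReal.ofReal_le_ofReal ?_
          have h1 := heatW_nonneg (x, s)
          have h2 := heatW_nonneg (x, t)
          rw [abs_le]; constructor <;> linarith
      _ ≤ _ := by
          rw [lintegral_add_left (by have := heatW_measurable (n := n); fun_prop),
            ENNReal.ofReal_add (by positivity) (by positivity)]
          gcongr <;> exact lint_heatW_le _
  by_cases h1 : |t| / 2 ≤ |s - t|
  · refine triv.trans (ENNReal.ofReal_le_ofReal ?_)
    have : (1 : ℝ) / 2 ≤ min 1 (|s - t| / |t|) := by
      refine le_min (by norm_num) ?_
      rw [le_div_iff₀ (abs_pos.2 ht)]; linarith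
    nlinarith
  · push Not at h1
    rcases lt_or_gt_of_ne ht with h0 | h0
    · have hs : s ≤ 0 := by
        rw [abs_of_neg h0] at h1
        have := (abs_lt.1 h1).2
        linarith
      have : ∀ x : Spc n, ‖heatW (x, s) - heatW (x, t)‖ₑ = 0 := fun x => by
        rw [heatW_of_nonpos (by simpa using hs), heatW_of_nonpos (by simpa using h0.le)]; simp
      simp [this]
    · rw [abs_of_pos h0] at h1 ⊢
      calc _ ≤ ∫⁻ x : Spc n, ENNReal.ofReal (((n : ℝ) / 2 + 2) * 2 * (√2) ^ n * (|s - t| / t)) *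
              ENNReal.ofReal (((√t)⁻¹) ^ n * Real.exp (-‖x‖ ^ 2 / (12 * t))) := by
            refine lintegral_mono fun x => ?_
            rw [← ENNReal.ofReal_mul (by positivity), Real.enorm_eq_ofReal_abs]
            exact ENNReal.ofReal_le_ofReal (heatW_diff_le x h0 h1.le)
        _ = ENNReal.ofReal (C1 * (|s - t| / t)) := by
            rw [lintegral_const_mul _ (by fun_prop), lint_gauss (by norm_num) h0,
              ← ENNReal.ofReal_mul (by positivity)]
            congr 1; simp only [C1]; ring
        _ ≤ _ := by
            refine ENNReal.ofReal_le_ofReal ?_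
            have : |s - t| / t ≤ 1 := by rw [div_le_one h0]; linarith
            rw [min_eq_right this]
            have : 0 ≤ |s - t| / t := by positivity
            nlinarith

/-- absolute half-derivative kernel -/
def AK {n : ℕ} (p : Pt n) : ENNReal :=
  ∫⁻ s : ℝ, ‖heatW (p.1, s) - heatW p‖ₑ * ENNReal.ofReal ((|s - p.2| ^ (3 / 2 : ℝ))⁻¹)

lemma AK_measurable {n : ℕ} : Measurable (AK : Pt n → ENNReal) := by
  unfold AK
  have := heatW_measurable (n := n)
  refine Measurable.lintegral_prod_right' (f := fun q : Pt n × ℝ =>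
    ‖heatW (q.1.1, q.2) - heatW q.1‖ₑ * ENNReal.ofReal ((|q.2 - q.1.2| ^ (3 / 2 : ℝ))⁻¹)) ?_
  fun_prop

lemma lint_AK (n : ℕ) : ∃ C : ℝ, 0 < C ∧ ∀ t : ℝ, t ≠ 0 →
    ∫⁻ x : Spc n, AK (x, t) ≤ ENNReal.ofReal (C * (√|t|)⁻¹) := by
  obtain ⟨C, hC, h⟩ := lint_modulus n
  refine ⟨8 * C, by positivity, fun t ht => ?_⟩
  have hm := heatW_measurable (n := n)
  unfold AK
  rw [lintegral_lintegral_swap (by fun_prop)]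
  have ht' : 0 < |t| := abs_pos.2 ht
  calc _ ≤ ∫⁻ s : ℝ, ENNReal.ofReal C * ENNReal.ofReal (min 1 (|s - t| / |t|) * (|s - t| ^ (3 / 2 : ℝ))⁻¹) := by
        refine lintegral_mono fun s => ?_
        simp only
        rw [lintegral_mul_const _ (by fun_prop), ← ENNReal.ofReal_mul hC.le, ← mul_assoc,
          ENNReal.ofReal_mul (by positivity)]
        gcongr
        exact h t s ht
    _ ≤ _ := by
        rw [lintegral_const_mul _ (by fun_prop),
          lintegral_sub_right_eq_self (fun h : ℝ => ENNReal.ofReal (min 1 (|h| / |t|) * (|h| ^ (3 / 2 : ℝ))⁻¹)) t]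
        refine (mul_le_mul_right (lint_min ht') _).trans ?_
        rw [← ENNReal.ofReal_mul hC.le]
        exact ENNReal.ofReal_le_ofReal (le_of_eq (by ring))

/-- Constant of `lint_AK`. -/
def cK (n : ℕ) : ℝ := Classical.choose (lint_AK n)
lemma cK_pos (n : ℕ) : 0 < cK n := (Classical.choose_spec (lint_AK n)).1
lemma lint_AK' {n : ℕ} {t : ℝ} (ht : t ≠ 0) :
    ∫⁻ x : Spc n, AK (x, t) ≤ ENNReal.ofReal (cK n * (√|t|)⁻¹) :=
  (Classical.choose_spec (lint_AK n)).2 t ht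

lemma lint_time_AK {n : ℕ} (g : ℝ → ENNReal) (hg : Measurable g) (y : Pt n) :
    ∫⁻ p : Pt n, g p.2 * AK (p - y) ≤
      ENNReal.ofReal (cK n) * ∫⁻ t, g t * ENNReal.ofReal ((√|t - y.2|)⁻¹) := by
  have hm := AK_measurable (n := n)
  rw [Measure.volume_eq_prod, lintegral_prod_symm' _ (by fun_prop)]
  simp only
  have : ∀ t : ℝ, t ≠ y.2 → ∫⁻ x : Spc n, g t * AK ((x, t) - y) ≤
      ENNReal.ofReal (cK n) * (g t * ENNReal.ofReal ((√|t - y.2|)⁻¹)) := by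
    intro t ht
    rw [lintegral_const_mul _ (by fun_prop)]
    have h2 : ∫⁻ x : Spc n, AK ((x, t) - y) = ∫⁻ x : Spc n, AK (x, t - y.2) :=
      lintegral_sub_right_eq_self (fun x : Spc n => AK (x, t - y.2)) y.1
    rw [h2]
    refine (mul_le_mul_right (lint_AK' (sub_ne_zero.2 ht)) _).trans (le_of_eq ?_)
    rw [ENNReal.ofReal_mul (cK_pos n).le]; ring
  rw [← lintegral_const_mul _ (by fun_prop)]
  refine lintegral_mono_ae ?_
  have h0 : ∀ᵐ t : ℝ, t ≠ y.2 := by simp [ae_iff]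
  filter_upwards [h0] with t ht using this t ht

lemma lint_time_AK_conv {n : ℕ} (μ : Measure (Pt n)) [SFinite μ] (g : ℝ → ENNReal) (hg : Measurable g)
    (A : ENNReal) (hA : ∀ t, g t ≤ A) {T : ℝ} (hT : 0 < T) :
    ∫⁻ p : Pt n, g p.2 * ∫⁻ y, AK (p - y) ∂μ ≤
      ENNReal.ofReal (cK n) * (A * ENNReal.ofReal (4 * √T) + (∫⁻ t, g t) * ENNReal.ofReal ((√T)⁻¹)) * μ univ := by
  have hm := AK_measurable (n := n)
  calc _ = ∫⁻ p : Pt n, ∫⁻ y, g p.2 * AK (p - y) ∂μ := by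
        refine lintegral_congr fun p => ?_
        rw [lintegral_const_mul _ (by fun_prop)]
    _ = ∫⁻ y, (∫⁻ p : Pt n, g p.2 * AK (p - y)) ∂μ := by
        rw [lintegral_lintegral_swap (by fun_prop)]
    _ ≤ ∫⁻ _y, ENNReal.ofReal (cK n) * (A * ENNReal.ofReal (4 * √T) + (∫⁻ t, g t) * ENNReal.ofReal ((√T)⁻¹)) ∂μ := by
        refine lintegral_mono fun y => (lint_time_AK g hg y).trans ?_
        gcongr
        exact lint_half_conv g hg A hA hT y.2
    _ = _ := by rw [lintegral_const]

/-- auxiliary weight -/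
def gw (t : ℝ) : ENNReal := ENNReal.ofReal ((1 + t ^ 2)⁻¹)
lemma gw_meas : Measurable gw := by unfold gw; fun_prop
lemma gw_le (t : ℝ) : gw t ≤ 1 := by
  unfold gw
  rw [ENNReal.ofReal_le_one]
  exact inv_le_one_of_one_le₀ (by nlinarith [sq_nonneg t])
lemma gw_pos (t : ℝ) : gw t ≠ 0 := by
  unfold gw
  have : 0 < (1 + t ^ 2)⁻¹ := by positivity
  simpa using this
lemma gw_int : ∫⁻ t, gw t < ⊤ := by
  have := integrable_inv_one_add_sq.lintegral_lt_top
  exact this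

lemma ae_AK_lt_top {n : ℕ} (μ : Measure (Pt n)) [IsFiniteMeasure μ] :
    ∀ᵐ p : Pt n, ∫⁻ y, AK (p - y) ∂μ < ⊤ := by
  have hm := AK_measurable (n := n)
  have h1 := lint_time_AK_conv μ gw gw_meas 1 gw_le (T := 1) one_pos
  have h2 : ∫⁻ p : Pt n, gw p.2 * ∫⁻ y, AK (p - y) ∂μ ≠ ⊤ := by
    refine ne_top_of_le_ne_top ?_ h1
    have := gw_int.ne
    finiteness
  have hmm : Measurable fun p : Pt n => ∫⁻ y, AK (p - y) ∂μ :=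
    Measurable.lintegral_prod_right' (f := fun q : Pt n × Pt n => AK (q.1 - q.2)) (by fun_prop)
  have := ae_lt_top (by have := gw_meas; fun_prop) h2
  filter_upwards [this] with p hp
  by_contra hc
  rw [not_lt, top_le_iff] at hc
  rw [hc, ENNReal.mul_top (gw_pos _)] at hp
  exact lt_irrefl _ hp

lemma ae_heatW_lt_top {n : ℕ} (μ : Measure (Pt n)) [IsFiniteMeasure μ] :
    ∀ᵐ p : Pt n, ∫⁻ y, ENNReal.ofReal (heatW (p - y)) ∂μ < ⊤ := by
  have hm := heatW_measurable (n := n)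
  have hgm := gw_meas
  have h1 : ∫⁻ p : Pt n, gw p.2 * ∫⁻ y, ENNReal.ofReal (heatW (p - y)) ∂μ ≤
      (∫⁻ t, gw t) * ENNReal.ofReal (√(π * 8) ^ n) * μ univ := by
    calc _ = ∫⁻ p : Pt n, ∫⁻ y, gw p.2 * ENNReal.ofReal (heatW (p - y)) ∂μ := by
          refine lintegral_congr fun p => ?_
          rw [lintegral_const_mul _ (by fun_prop)]
      _ = ∫⁻ y, (∫⁻ p : Pt n, gw p.2 * ENNReal.ofReal (heatW (p - y))) ∂μ := by
          rw [lintegral_lintegral_swap (by fun_prop)]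
      _ ≤ ∫⁻ _y, (∫⁻ t, gw t) * ENNReal.ofReal (√(π * 8) ^ n) ∂μ := by
          refine lintegral_mono fun y => ?_
          rw [Measure.volume_eq_prod, lintegral_prod_symm' _ (by fun_prop), ← lintegral_mul_const _ gw_meas]
          refine lintegral_mono fun t => ?_
          simp only
          rw [lintegral_const_mul _ (by fun_prop)]
          gcongr
          have h2 : ∫⁻ x : Spc n, ENNReal.ofReal (heatW ((x, t) - y)) =
            ∫⁻ x : Spc n, ENNReal.ofReal (heatW (x, t - y.2)) :=
            lintegral_sub_right_eq_self (fun x : Spc n => ENNReal.ofReal (heatW (x, t - y.2))) y.1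
          rw [h2]
          exact lint_heatW_le _
      _ = _ := by rw [lintegral_const]
  have h2 : ∫⁻ p : Pt n, gw p.2 * ∫⁻ y, ENNReal.ofReal (heatW (p - y)) ∂μ ≠ ⊤ := by
    refine ne_top_of_le_ne_top ?_ h1
    have := gw_int.ne
    finiteness
  have hmm : Measurable fun p : Pt n => ∫⁻ y, ENNReal.ofReal (heatW (p - y)) ∂μ :=
    Measurable.lintegral_prod_right' (f := fun q : Pt n × Pt n => ENNReal.ofReal (heatW (q.1 - q.2))) (by fun_prop)
  have := ae_lt_top (by fun_prop) h2
  filter_upwards [this] with p hp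
  by_contra hc
  rw [not_lt, top_le_iff] at hc
  rw [hc, ENNReal.mul_top (gw_pos _)] at hp
  exact lt_irrefl _ hp

lemma integrable_heatW_of_lt_top {n : ℕ} (μ : Measure (Pt n)) {p : Pt n}
    (h : ∫⁻ y, ENNReal.ofReal (heatW (p - y)) ∂μ < ⊤) : Integrable (fun y => heatW (p - y)) μ := by
  have hm := heatW_measurable (n := n)
  refine ⟨Measurable.aestronglyMeasurable (by fun_prop), ?_⟩
  rw [hasFiniteIntegral_iff_ofReal (by filter_upwards with y using heatW_nonneg _)]
  exact h

lemma mconvW_measurable {n : ℕ} (μ : Measure (Pt n)) [SFinite μ] : StronglyMeasurable (mconvW μ) := by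
  unfold mconvW
  have hm := heatW_measurable (n := n)
  exact StronglyMeasurable.integral_prod_right (f := fun (p y : Pt n) => heatW (p - y))
    (by apply Measurable.stronglyMeasurable; simp only [Function.uncurry_def]; fun_prop)

lemma halfT_measurable {n : ℕ} {f : Pt n → ℝ} (hf : Measurable f) : StronglyMeasurable (halfT f) := by
  unfold halfT
  exact StronglyMeasurable.integral_prod_right
    (f := fun (p : Pt n) (s : ℝ) => (f (p.1, s) - f p) / |s - p.2| ^ (3 / 2 : ℝ))
    (by apply Measurable.stronglyMeasurable; simp only [Function.uncurry_def]; fun_prop)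

lemma AK_shift {n : ℕ} (p y : Pt n) : AK (p - y) =
    ∫⁻ s : ℝ, ‖heatW ((p.1, s) - y) - heatW (p - y)‖ₑ * ENNReal.ofReal ((|s - p.2| ^ (3 / 2 : ℝ))⁻¹) := by
  unfold AK
  rw [← lintegral_sub_right_eq_self _ y.2]
  refine lintegral_congr fun s => ?_
  have : s - y.2 - (p - y).2 = s - p.2 := by simp
  rw [this]
  rfl

lemma halfT_shift {n : ℕ} (p y : Pt n) : halfT heatW (p - y) =
    ∫ s : ℝ, (heatW ((p.1, s) - y) - heatW (p - y)) / |s - p.2| ^ (3 / 2 : ℝ) := by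
  unfold halfT
  rw [← integral_sub_right_eq_self _ y.2]
  refine integral_congr_ae (Filter.Eventually.of_forall fun s => ?_)
  have : s - y.2 - (p - y).2 = s - p.2 := by simp
  simp only
  rw [this]
  rfl

lemma enorm_halfT_heatW_le {n : ℕ} (p : Pt n) : ‖halfT heatW p‖ₑ ≤ AK p := by
  unfold halfT AK
  refine (enorm_integral_le_lintegral_enorm _).trans (lintegral_mono fun s => ?_)
  rw [div_eq_mul_inv, enorm_mul]
  gcongr
  rw [Real.enorm_of_nonneg (by positivity)]

lemma halfT_conv_ae {n : ℕ} (μ : Measure (Pt n)) [IsFiniteMeasure μ] :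
    ∀ᵐ p : Pt n, halfT (mconvW μ) p = ∫ y, halfT heatW (p - y) ∂μ := by
  have hm := heatW_measurable (n := n)
  have h1 := ae_AK_lt_top μ
  have h2 := ae_heatW_lt_top μ
  have h3 : ∀ᵐ p : Pt n, ∀ᵐ s : ℝ, ∫⁻ y, ENNReal.ofReal (heatW ((p.1, s) - y)) ∂μ < ⊤ := by
    rw [Measure.volume_eq_prod] at h2
    have := Measure.ae_ae_of_ae_prod h2
    rw [Measure.volume_eq_prod]
    exact (Measure.quasiMeasurePreserving_fst).ae this
  filter_upwards [h1, h2, h3] with p hp1 hp2 hp3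
  have hI := integrable_heatW_of_lt_top μ hp2
  have e1 : halfT (mconvW μ) p =
      ∫ s : ℝ, ∫ y, (heatW ((p.1, s) - y) - heatW (p - y)) / |s - p.2| ^ (3 / 2 : ℝ) ∂μ := by
    unfold halfT
    refine integral_congr_ae ?_
    filter_upwards [hp3] with s hs
    have hI2 := integrable_heatW_of_lt_top μ hs
    rw [integral_div, integral_sub hI2 hI]
    rfl
  rw [e1, integral_integral_swap]
  · refine integral_congr_ae (Filter.Eventually.of_forall fun y => ?_)
    simp only
    rw [halfT_shift]
  · refine ⟨Measurable.aestronglyMeasurable (by simp only [Function.uncurry_def]; fun_prop), ?_⟩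
    unfold HasFiniteIntegral
    rw [lintegral_prod_symm' _ (by simp only [Function.uncurry_def]; fun_prop)]
    refine lt_of_le_of_lt (le_of_eq ?_) hp1
    refine lintegral_congr fun y => ?_
    rw [AK_shift]
    refine lintegral_congr fun s => ?_
    simp only [Function.uncurry_def]
    rw [div_eq_mul_inv, enorm_mul, Real.enorm_of_nonneg (by positivity : (0 : ℝ) ≤ (|s - p.2| ^ (3 / 2 : ℝ))⁻¹)]

lemma enorm_halfT_conv_ae {n : ℕ} (μ : Measure (Pt n)) [IsFiniteMeasure μ] :
    ∀ᵐ p : Pt n, ‖halfT (mconvW μ) p‖ₑ ≤ ∫⁻ y, AK (p - y) ∂μ := by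
  filter_upwards [halfT_conv_ae μ] with p hp
  rw [hp]
  exact (enorm_integral_le_lintegral_enorm _).trans (lintegral_mono fun y => enorm_halfT_heatW_le _)

/-- Pairing of the half derivative with a tensor test function. -/
lemma pairing {n : ℕ} (μ : Measure (Pt n)) [IsFiniteMeasure μ] (η : Spc n → ℝ) (ψ : ℝ → ℝ)
    (hη : Measurable η) (hη1 : ∀ x, |η x| ≤ 1) (hψ : Measurable ψ) (A : ℝ) (hA : ∀ t, |ψ t| ≤ A)
    (hψi : Integrable ψ) :
    Integrable (fun p : Pt n => η p.1 * ψ p.2 * halfT (mconvW μ) p) ∧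
    ∫ p : Pt n, η p.1 * ψ p.2 * halfT (mconvW μ) p =
      ∫ y, (∫ x : Spc n, η x * (∫ t : ℝ, ψ t * halfT heatW ((x, t) - y))) ∂μ := by
  have hm := AK_measurable (n := n)
  have hmK : Measurable (halfT (heatW : Pt n → ℝ)) := (halfT_measurable heatW_measurable).measurable
  have hfin : ∫⁻ p : Pt n, ‖ψ p.2‖ₑ * ∫⁻ y, AK (p - y) ∂μ < ⊤ := by
    refine lt_of_le_of_lt (lint_time_AK_conv μ (fun t => ‖ψ t‖ₑ) (by fun_prop) (ENNReal.ofReal A)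
      (fun t => ?_) (T := 1) one_pos) ?_
    · simp only [Real.enorm_eq_ofReal_abs]; exact ENNReal.ofReal_le_ofReal (hA t)
    · have : ∫⁻ t, ‖ψ t‖ₑ ≠ ⊤ := hψi.2.ne
      exact Ne.lt_top (by finiteness)
  have hmm : Measurable fun p : Pt n => ∫⁻ y, AK (p - y) ∂μ :=
    Measurable.lintegral_prod_right' (f := fun q : Pt n × Pt n => AK (q.1 - q.2)) (by fun_prop)
  have hmb := (halfT_measurable (mconvW_measurable μ).measurable).measurable
  constructor
  · refine ⟨Measurable.aestronglyMeasurable (by fun_prop), ?_⟩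
    unfold HasFiniteIntegral
    refine lt_of_le_of_lt (lintegral_mono_ae ?_) hfin
    filter_upwards [enorm_halfT_conv_ae μ] with p hp
    rw [enorm_mul, enorm_mul]
    have h1 : ‖η p.1‖ₑ ≤ 1 := by
      rw [Real.enorm_eq_ofReal_abs, ENNReal.ofReal_le_one]; exact hη1 _
    calc _ ≤ 1 * ‖ψ p.2‖ₑ * ∫⁻ y, AK (p - y) ∂μ := by gcongr
      _ = _ := by rw [one_mul]
  · have e1 : ∫ p : Pt n, η p.1 * ψ p.2 * halfT (mconvW μ) p =
        ∫ p : Pt n, ∫ y, η p.1 * ψ p.2 * halfT heatW (p - y) ∂μ := by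
      refine integral_congr_ae ?_
      filter_upwards [halfT_conv_ae μ] with p hp
      rw [hp, integral_const_mul]
    have hIgl : Integrable (Function.uncurry fun (p y : Pt n) => η p.1 * ψ p.2 * halfT heatW (p - y))
        (volume.prod μ) := by
      refine ⟨Measurable.aestronglyMeasurable (by simp only [Function.uncurry_def]; fun_prop), ?_⟩
      unfold HasFiniteIntegral
      rw [lintegral_prod _ (by simp only [Function.uncurry_def]; fun_prop)]
      refine lt_of_le_of_lt (lintegral_mono fun p => ?_) hfin
      rw [← lintegral_const_mul _ (by fun_prop)]
      refine lintegral_mono fun y => ?_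
      simp only [Function.uncurry_def]
      rw [enorm_mul, enorm_mul]
      have h1 : ‖η p.1‖ₑ ≤ 1 := by
        rw [Real.enorm_eq_ofReal_abs, ENNReal.ofReal_le_one]; exact hη1 _
      calc _ ≤ 1 * ‖ψ p.2‖ₑ * AK (p - y) := by gcongr; exact enorm_halfT_heatW_le _
        _ = _ := by rw [one_mul]
    rw [e1, integral_integral_swap hIgl]
    have h5 := hIgl.prod_left_ae
    refine integral_congr_ae ?_
    filter_upwards [h5] with y hy
    simp only [Function.uncurry_def] at hy
    rw [Measure.volume_eq_prod] at hy ⊢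
    rw [integral_prod _ hy]
    refine integral_congr_ae (Filter.Eventually.of_forall fun x => ?_)
    simp only
    rw [← integral_const_mul]
    refine integral_congr_ae (Filter.Eventually.of_forall fun t => ?_)
    simp only
    ring

/-- sign kernel `sgn(s)|s|^{-1/2}` -/
def kk (s : ℝ) : ℝ := if 0 < s then (√|s|)⁻¹ else -(√|s|)⁻¹
lemma kk_meas : Measurable kk := by
  unfold kk
  exact Measurable.ite measurableSet_Ioi (by fun_prop) (by fun_prop)
lemma abs_kk (s : ℝ) : |kk s| = (√|s|)⁻¹ := by
  unfold kk
  split_ifs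
  · rw [abs_of_nonneg (by positivity)]
  · rw [abs_neg, abs_of_nonneg (by positivity)]

/-- difference of Heavisides over the fractional kernel -/
def eK (u h : ℝ) : ℝ := ((if u < h then 1 else 0) - (if u < 0 then 1 else 0)) / |h| ^ (3 / 2 : ℝ)

lemma eK_meas : Measurable (fun q : ℝ × ℝ => eK q.1 q.2) := by
  unfold eK
  refine Measurable.div (Measurable.sub ?_ ?_) (by fun_prop)
  · exact Measurable.ite (measurableSet_lt measurable_fst measurable_snd) (by fun_prop) (by fun_prop)
  · exact Measurable.ite (measurableSet_lt measurable_fst measurable_const) (by fun_prop) (by fun_prop)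

lemma lint_eK {u : ℝ} (hu : u ≠ 0) : ∫⁻ h, ‖eK u h‖ₑ ≤ ENNReal.ofReal (8 * (√|u|)⁻¹) := by
  have hu' : 0 < |u| := abs_pos.2 hu
  have h0 : 0 < |u| / 4 := by positivity
  calc _ ≤ ∫⁻ h : ℝ, (if |u| / 4 < |h| then ENNReal.ofReal ((|h| ^ (3 / 2 : ℝ))⁻¹) else 0) := by
        refine lintegral_mono fun h => ?_
        simp only
        split_ifs with hh
        · rw [Real.enorm_eq_ofReal_abs]
          refine ENNReal.ofReal_le_ofReal ?_
          unfold eK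
          rw [abs_div, abs_of_nonneg (by positivity : (0 : ℝ) ≤ |h| ^ (3 / 2 : ℝ)), div_eq_mul_inv]
          have : |((if u < h then 1 else 0) - (if u < 0 then 1 else 0) : ℝ)| ≤ 1 := by
            split_ifs <;> simp
          exact mul_le_of_le_one_left (by positivity) this
        · have : eK u h = 0 := by
            unfold eK
            have hh2 : |h| < |u| := by linarith
            rcases lt_or_gt_of_ne hu with h1 | h1
            · rw [abs_of_neg h1] at hh2
              have := (abs_lt.1 hh2).1
              rw [if_pos (by linarith), if_pos h1]; simp
            · rw [abs_of_pos h1] at hh2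
              have := (abs_lt.1 hh2).2
              rw [if_neg (by linarith), if_neg (by linarith)]; simp
          simp [this]
    _ ≤ _ := lint_threehalf_far h0
    _ = _ := by
        congr 1
        rw [Real.sqrt_div hu'.le, show (4 : ℝ) = 2 ^ 2 by norm_num, Real.sqrt_sq (by norm_num)]
        field_simp; norm_num

lemma int_threehalf {u : ℝ} (hu : 0 < u) : ∫ h in Ioi u, (|h| ^ (3 / 2 : ℝ))⁻¹ = 2 * (√u)⁻¹ := by
  rw [integral_eq_lintegral_of_nonneg_ae (by filter_upwards with x using by positivity)
    (Measurable.aestronglyMeasurable (by fun_prop)), lint_threehalf_Ioi hu, ENNReal.toReal_ofReal (by positivity)]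
  ring

lemma int_eK {u : ℝ} (hu : u ≠ 0) : ∫ h, eK u h = 2 * kk u := by
  rcases lt_or_gt_of_ne hu with h1 | h1
  · have : ∀ h, eK u h = (Iic u).indicator (fun h => -(|h| ^ (3 / 2 : ℝ))⁻¹) h := by
      intro h
      unfold eK
      by_cases hh : u < h
      · rw [if_pos hh, if_pos h1, indicator_of_notMem (by simpa using hh)]; simp
      · rw [if_neg hh, if_pos h1, indicator_of_mem (by simpa using hh)]; ring
    rw [integral_congr_ae (Filter.Eventually.of_forall this), integral_indicator measurableSet_Iic, integral_neg]
    have h2 := integral_comp_neg_Iic u (fun h => (|h| ^ (3 / 2 : ℝ))⁻¹)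
    simp only [abs_neg] at h2
    rw [h2, int_threehalf (by linarith)]
    unfold kk
    rw [if_neg (by linarith), abs_of_neg h1]; ring
  · have : ∀ h, eK u h = (Ioi u).indicator (fun h => (|h| ^ (3 / 2 : ℝ))⁻¹) h := by
      intro h
      unfold eK
      by_cases hh : u < h
      · rw [if_pos hh, if_neg (by linarith), indicator_of_mem (by simpa using hh)]; ring
      · rw [if_neg hh, if_neg (by linarith), indicator_of_notMem (by simpa using hh)]; simp
    rw [integral_congr_ae (Filter.Eventually.of_forall this), integral_indicator measurableSet_Ioi,
      int_threehalf h1]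
    unfold kk
    rw [if_pos h1, abs_of_pos h1]

lemma diff_eq_int {w w' : ℝ → ℝ} (hw : ∀ s, HasDerivAt w (w' s) s) (hi : Integrable w') (s t : ℝ) :
    w s - w t = ∫ σ, w' σ * ((if σ < s then 1 else 0) - (if σ < t then 1 else 0)) := by
  rw [← intervalIntegral.integral_eq_sub_of_hasDerivAt (fun x _ => hw x) hi.intervalIntegrable,
    ← intervalIntegral.integral_Iic_sub_Iic hi.integrableOn hi.integrableOn,
    integral_Iic_eq_integral_Iio, integral_Iic_eq_integral_Iio, ← integral_indicator measurableSet_Iio,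
    ← integral_indicator measurableSet_Iio, ← integral_sub (hi.indicator measurableSet_Iio) (hi.indicator measurableSet_Iio)]
  refine integral_congr_ae (Filter.Eventually.of_forall fun σ => ?_)
  simp only [indicator_apply, mem_Iio]
  split_ifs <;> simp

lemma halfD_formula {w w' : ℝ → ℝ} (hw : ∀ s, HasDerivAt w (w' s) s) (hm : Measurable w') {M : ℝ}
    (hb : ∀ s, |w' s| ≤ M) (hi : Integrable w') (t : ℝ) :
    ∫ s, (w s - w t) / |s - t| ^ (3 / 2 : ℝ) = 2 * ∫ σ, w' σ * kk (σ - t) := by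
  have e1 : ∀ s, (w s - w t) / |s - t| ^ (3 / 2 : ℝ) = ∫ σ, w' σ * eK (σ - t) (s - t) := by
    intro s
    rw [diff_eq_int hw hi s t, div_eq_mul_inv, ← integral_mul_const]
    refine integral_congr_ae (Filter.Eventually.of_forall fun σ => ?_)
    simp only [eK, sub_lt_sub_iff_right, sub_neg]
    ring
  have hem := eK_meas
  have hem2 : Measurable (Function.uncurry fun s σ : ℝ => w' σ * eK (σ - t) (s - t)) := by
    simp only [Function.uncurry_def]
    have : Measurable fun q : ℝ × ℝ => eK (q.2 - t) (q.1 - t) :=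
      hem.comp (g := fun q : ℝ × ℝ => eK q.1 q.2) (f := fun q : ℝ × ℝ => (q.2 - t, q.1 - t)) (by fun_prop)
    fun_prop
  have h0 : ∀ᵐ σ : ℝ, σ - t ≠ 0 := by
    have : ∀ᵐ σ : ℝ, σ ≠ t := by simp [ae_iff]
    filter_upwards [this] with σ hσ using sub_ne_zero.2 hσ
  rw [integral_congr_ae (Filter.Eventually.of_forall e1), integral_integral_swap, ← integral_const_mul]
  · refine integral_congr_ae ?_
    filter_upwards [h0] with σ hσ
    rw [integral_const_mul, integral_sub_right_eq_self (fun s => eK (σ - t) s) t, int_eK hσ]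
    ring
  · refine ⟨hem2.aestronglyMeasurable, ?_⟩
    unfold HasFiniteIntegral
    rw [lintegral_prod_symm' _ (by fun_prop)]
    calc _ ≤ ∫⁻ σ, ENNReal.ofReal 8 * (‖w' σ‖ₑ * ENNReal.ofReal ((√|σ - t|)⁻¹)) := by
          refine lintegral_mono_ae ?_
          filter_upwards [h0] with σ hσ
          simp only [Function.uncurry_def, enorm_mul]
          have hme : Measurable fun s => eK (σ - t) (s - t) :=
            hem.comp (g := fun q : ℝ × ℝ => eK q.1 q.2) (f := fun s : ℝ => (σ - t, s - t)) (by fun_prop)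
          rw [lintegral_const_mul _ (by fun_prop), lintegral_sub_right_eq_self (fun s => ‖eK (σ - t) s‖ₑ) t]
          refine (mul_le_mul_right (lint_eK hσ) _).trans (le_of_eq ?_)
          rw [ENNReal.ofReal_mul (by norm_num)]; ring
      _ = ENNReal.ofReal 8 * ∫⁻ σ, (‖w' σ‖ₑ * ENNReal.ofReal ((√|σ - t|)⁻¹)) := by
          rw [lintegral_const_mul _ (by fun_prop)]
      _ ≤ ENNReal.ofReal 8 * (ENNReal.ofReal M * ENNReal.ofReal (4 * √1) + (∫⁻ σ, ‖w' σ‖ₑ) * ENNReal.ofReal ((√1)⁻¹)) := by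
          gcongr
          refine lint_half_conv (fun σ => ‖w' σ‖ₑ) (by fun_prop) _ (fun σ => ?_) one_pos t
          simp only [Real.enorm_eq_ofReal_abs]; exact ENNReal.ofReal_le_ofReal (hb σ)
      _ < ⊤ := by
          have : ∫⁻ σ, ‖w' σ‖ₑ ≠ ⊤ := hi.2.ne
          exact Ne.lt_top (by finiteness)

/-- `|s|^{-1/2}` -/
def qq (s : ℝ) : ℝ := (√|s|)⁻¹
lemma qq_meas : Measurable qq := by unfold qq; fun_prop
lemma qq_nonneg (s : ℝ) : 0 ≤ qq s := by unfold qq; positivity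
lemma qq_neg (s : ℝ) : qq (-s) = qq s := by unfold qq; rw [abs_neg]
lemma kk_pos {s : ℝ} (h : 0 ≤ s) : kk s = qq s := by
  unfold kk qq
  rcases h.eq_or_lt with rfl | h
  · simp
  · rw [if_pos h]
lemma kk_neg (s : ℝ) : kk (-s) = - kk s := by
  unfold kk
  rcases lt_trichotomy s 0 with h | h | h
  · rw [if_pos (by linarith), if_neg (by linarith), abs_neg]; ring
  · subst h; simp
  · rw [if_neg (by linarith), if_pos (by linarith), abs_neg]
lemma qq_anti {a b : ℝ} (ha : 0 < a) (h : a ≤ |b|) : qq b ≤ qq a := by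
  unfold qq
  rw [abs_of_pos ha]
  exact inv_anti₀ (Real.sqrt_pos.2 ha) (Real.sqrt_le_sqrt h)
lemma qq_sq {a : ℝ} (ha : 0 < a) : qq a * qq a = a⁻¹ := by
  unfold qq
  rw [abs_of_pos ha, ← mul_inv, Real.mul_self_sqrt ha.le]

lemma lint_qq_le (S : Set ℝ) (hS : MeasurableSet S) (τ : ℝ) :
    ∫⁻ t in S, ‖qq (t - τ)‖ₑ ≤ 4 + volume S := by
  have h := lint_half_conv (S.indicator 1) (measurable_one.indicator hS) 1
    (fun t => by by_cases h : t ∈ S <;> simp [h]) (T := 1) one_pos τ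
  rw [lintegral_indicator_one hS] at h
  simp only [Real.sqrt_one, inv_one, ENNReal.ofReal_one, mul_one, one_mul] at h
  have h4 : ENNReal.ofReal 4 = 4 := by simp
  rw [h4] at h
  refine le_trans (le_of_eq ?_) h
  rw [← lintegral_indicator hS]
  refine lintegral_congr fun t => ?_
  by_cases h : t ∈ S
  · simp only [h, indicator_of_mem, Pi.one_apply, one_mul]
    rw [Real.enorm_of_nonneg (qq_nonneg _)]; rfl
  · simp [h]

lemma qq_intOn (S : Set ℝ) (hS : MeasurableSet S) (hf : volume S ≠ ⊤) (τ : ℝ) :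
    IntegrableOn (fun t => qq (t - τ)) S := by
  have := qq_meas
  refine ⟨Measurable.aestronglyMeasurable (by fun_prop), ?_⟩
  exact lt_of_le_of_lt (lint_qq_le S hS τ) (Ne.lt_top (by finiteness))

lemma qq_ii (a b τ : ℝ) : IntervalIntegrable (fun t => qq (t - τ)) volume a b := by
  rw [intervalIntegrable_iff]
  exact qq_intOn _ measurableSet_uIoc (by rw [Set.uIoc, Real.volume_Ioc]; finiteness) τ

lemma qqqq_le {c : ℝ} (hc : c ≠ 0) (s : ℝ) : qq (s - c) * qq s ≤ qq (|c| / 2) * (qq (s - c) + qq (s - 0)) := by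
  have hc' : 0 < |c| / 2 := by have := abs_pos.2 hc; positivity
  have h0 := qq_nonneg (s - c)
  have h1 := qq_nonneg s
  rw [sub_zero]
  rcases le_total (|c| / 2) |s| with h | h
  · have := qq_anti hc' h
    nlinarith [qq_nonneg (|c| / 2)]
  · have h2 : |c| / 2 ≤ |s - c| := by
      have := abs_sub_abs_le_abs_sub c s
      rw [abs_sub_comm] at this; linarith
    have := qq_anti hc' h2
    nlinarith [qq_nonneg (|c| / 2)]

lemma kkqq_ii {c : ℝ} (hc : c ≠ 0) (a b : ℝ) : IntervalIntegrable (fun s => kk (c - s) * qq s) volume a b := by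
  have h1 := qq_meas
  have h2 := kk_meas
  refine ((((qq_ii a b c).add (qq_ii a b 0)).const_mul (qq (|c| / 2)))).mono_fun (Measurable.aestronglyMeasurable (by fun_prop)) ?_
  filter_upwards with s
  rw [norm_mul, Real.norm_eq_abs, abs_kk, Real.norm_of_nonneg (qq_nonneg _)]
  have := qqqq_le hc s
  rw [Real.norm_eq_abs]
  refine le_trans ?_ (le_abs_self _)
  rw [abs_sub_comm]
  exact this

lemma qqqq_ii {c : ℝ} (hc : 0 < c) (a b : ℝ) : IntervalIntegrable (fun s => qq (s + c) * qq s) volume a b := by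
  have h1 := qq_meas
  have := kkqq_ii (neg_ne_zero.2 hc.ne') a b
  refine this.mono_fun (Measurable.aestronglyMeasurable (by fun_prop)) ?_
  filter_upwards with s
  rw [norm_mul, norm_mul, Real.norm_eq_abs (kk _), abs_kk, Real.norm_of_nonneg (qq_nonneg (s + c))]
  unfold qq
  rw [show -c - s = -(s + c) by ring, abs_neg]

/-- The constant `∫₀¹ (s(1-s))^{-1/2} ds`. -/
def bet : ℝ := ∫ s in (0 : ℝ)..1, kk (1 - s) * qq s

lemma bet_pos : 0 < bet := by
  refine intervalIntegral.intervalIntegral_pos_of_pos_on (kkqq_ii one_ne_zero 0 1) ?_ one_pos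
  intro s hs
  rw [kk_pos (by linarith [hs.2])]
  unfold qq
  have h1 : 0 < |1 - s| := abs_pos.2 (by linarith [hs.2])
  have h2 : 0 < |s| := abs_pos.2 (by linarith [hs.1])
  positivity

lemma bet_scale {c : ℝ} (hc : 0 < c) : ∫ s in (0 : ℝ)..c, kk (c - s) * qq s = bet := by
  have h := intervalIntegral.integral_comp_mul_left (a := 0) (b := 1) (fun s => kk (c - s) * qq s) hc.ne'
  rw [mul_zero, mul_one] at h
  have h2 : ∫ s in (0 : ℝ)..1, kk (c - c * s) * qq (c * s) = c⁻¹ * bet := by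
    unfold bet
    rw [← intervalIntegral.integral_const_mul]
    refine intervalIntegral.integral_congr fun s hs => ?_
    rw [uIcc_of_le zero_le_one] at hs
    rw [kk_pos (by nlinarith [hs.2]), kk_pos (by linarith [hs.2]), show c - c * s = c * (1 - s) by ring, ← qq_sq hc]
    unfold qq
    rw [abs_mul, abs_mul, Real.sqrt_mul (abs_nonneg _), Real.sqrt_mul (abs_nonneg _), mul_inv, mul_inv]
    ring
  rw [h2, smul_eq_mul] at h
  exact (mul_left_cancel₀ (inv_ne_zero hc.ne') h).symm

lemma J_pos {c : ℝ} (hc : 0 < c) {R e : ℝ} (hR : |e| + c ≤ R / 2) :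
    |(∫ s in (-R + e)..(R + e), kk (c - s) * qq s) - bet| ≤ (2 * |e| + c) * (2 / R) := by
  have he := abs_le.1 (le_refl |e|)
  have he0 := abs_nonneg e
  have hRp : 0 < R := by linarith
  have i := fun a b => kkqq_ii hc.ne' a b
  have j := fun a b => qqqq_ii hc a b
  have e1 : ∫ s in (-R + e)..0, kk (c - s) * qq s = ∫ s in (0 : ℝ)..(R - e), qq (s + c) * qq s := by
    have := intervalIntegral.integral_comp_neg (a := -R + e) (b := 0) (fun s => qq (s + c) * qq s)
    rw [neg_zero, show -(-R + e) = R - e by ring] at this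
    rw [← this]
    refine intervalIntegral.integral_congr fun s hs => ?_
    rw [uIcc_of_le (by linarith)] at hs
    rw [kk_pos (by linarith [hs.2]), qq_neg, show c - s = -s + c by ring]
  have e2 : ∫ s in c..(R + e), kk (c - s) * qq s = - ∫ s in (0 : ℝ)..(R + e - c), qq (s + c) * qq s := by
    have := intervalIntegral.integral_comp_sub_right (a := c) (b := R + e) (fun s => qq (s + c) * qq s) c
    rw [sub_self] at this
    rw [← this, ← intervalIntegral.integral_neg]
    refine intervalIntegral.integral_congr fun s hs => ?_
    rw [uIcc_of_le (by linarith)] at hs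
    rw [show c - s = -(s - c) by ring, kk_neg, kk_pos (by linarith [hs.1]), sub_add_cancel]
    ring
  rw [← intervalIntegral.integral_add_adjacent_intervals (i _ 0) (i _ _),
    ← intervalIntegral.integral_add_adjacent_intervals (i 0 c) (i _ _), bet_scale hc, e1, e2]
  have e3 : (∫ s in (0 : ℝ)..(R - e), qq (s + c) * qq s) - ∫ s in (0 : ℝ)..(R + e - c), qq (s + c) * qq s
     = ∫ s in (R + e - c)..(R - e), qq (s + c) * qq s :=
    intervalIntegral.integral_interval_sub_left (j _ _) (j _ _)
  rw [show ∀ x y : ℝ, x + (bet + -y) - bet = x - y by intros; ring, e3, ← Real.norm_eq_abs]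
  have := intervalIntegral.norm_integral_le_of_norm_le_const (a := R + e - c) (b := R - e) (C := 2 / R)
    (f := fun s => qq (s + c) * qq s) ?_
  · refine this.trans ?_
    rw [mul_comm]
    gcongr
    rw [show R - e - (R + e - c) = -(2 * e) + c by ring]
    refine (abs_add_le _ _).trans ?_
    rw [abs_neg, abs_mul, abs_of_pos hc]; norm_num
  · intro s hs
    have hs1 : R / 2 ≤ s := by
      rcases Set.mem_uIoc.1 hs with h | h <;> linarith [h.1]
    have h2 : 0 < R / 2 := by linarith
    rw [Real.norm_of_nonneg (mul_nonneg (qq_nonneg _) (qq_nonneg _))]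
    have k1 : qq (s + c) ≤ qq (R / 2) := qq_anti h2 (by rw [abs_of_pos] <;> linarith)
    have k2 : qq s ≤ qq (R / 2) := qq_anti h2 (by rw [abs_of_pos] <;> linarith)
    calc _ ≤ qq (R / 2) * qq (R / 2) := mul_le_mul k1 k2 (qq_nonneg _) (qq_nonneg _)
      _ = _ := by rw [qq_sq h2, inv_div]

/-- sign -/
def sg (c : ℝ) : ℝ := 1 - 2 * (if c < 0 then 1 else 0)

lemma J_all {c : ℝ} (hc : c ≠ 0) {R e : ℝ} (hR : |e| + |c| ≤ R / 2) :
    |(∫ s in (-R + e)..(R + e), kk (c - s) * qq s) - bet * sg c| ≤ (2 * |e| + |c|) * (2 / R) := by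
  rcases lt_or_gt_of_ne hc with h | h
  · have hs : sg c = -1 := by unfold sg; rw [if_pos h]; norm_num
    have h2 := J_pos (c := -c) (R := R) (e := -e) (by linarith) (by rw [abs_neg, ← abs_of_neg h]; exact hR)
    rw [abs_neg, ← abs_of_neg h] at h2
    refine le_trans (le_of_eq ?_) h2
    have h3 := intervalIntegral.integral_comp_neg (a := -R + e) (b := R + e) (fun s => kk (-c - s) * qq s)
    rw [show -(R + e) = -R + -e by ring, show -(-R + e) = R + -e by ring] at h3
    rw [abs_of_neg h, ← h3, hs, ← abs_neg]
    congr 1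
    have : ∀ s, kk (-c - -s) * qq (-s) = -(kk (c - s) * qq s) := by
      intro s
      rw [show -c - -s = -(c - s) by ring, kk_neg, qq_neg]; ring
    simp only [this, intervalIntegral.integral_neg]
    ring
  · have hs : sg c = 1 := by unfold sg; rw [if_neg (by linarith)]; norm_num
    rw [hs, mul_one, abs_of_pos h]
    exact J_pos h (by rwa [abs_of_pos h] at hR)

/-- time test function -/
def psi (t : ℝ) : ℝ := ∫ a in Ioc (1 : ℝ) 2, (qq (t + a) - qq (t - a))

lemma psi_meas : Measurable psi := by
  have := qq_meas
  refine StronglyMeasurable.measurable ?_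
  exact StronglyMeasurable.integral_prod_right (f := fun t a : ℝ => qq (t + a) - qq (t - a))
    (by apply Measurable.stronglyMeasurable; simp only [Function.uncurry_def]; fun_prop)

lemma psi_odd (t : ℝ) : psi (-t) = - psi t := by
  unfold psi
  rw [← integral_neg]
  refine integral_congr_ae (Filter.Eventually.of_forall fun a => ?_)
  simp only
  rw [show -t + a = -(t - a) by ring, show -t - a = -(t + a) by ring, qq_neg, qq_neg]; ring

lemma lint_psi (t : ℝ) : ∫⁻ a in Ioc (1 : ℝ) 2, ‖qq (t + a) - qq (t - a)‖ₑ ≤ 10 := by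
  have hm := qq_meas
  calc _ ≤ ∫⁻ a in Ioc (1 : ℝ) 2, (‖qq (a - (-t))‖ₑ + ‖qq (a - t)‖ₑ) := by
        refine lintegral_mono fun a => ?_
        simp only
        rw [← qq_neg (a - t), sub_neg_eq_add, add_comm a t, neg_sub]
        exact enorm_sub_le
    _ = (∫⁻ a in Ioc (1 : ℝ) 2, ‖qq (a - (-t))‖ₑ) + ∫⁻ a in Ioc (1 : ℝ) 2, ‖qq (a - t)‖ₑ :=
        lintegral_add_left (by fun_prop) _
    _ ≤ (4 + volume (Ioc (1 : ℝ) 2)) + (4 + volume (Ioc (1 : ℝ) 2)) :=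
        add_le_add (lint_qq_le _ measurableSet_Ioc _) (lint_qq_le _ measurableSet_Ioc _)
    _ = 10 := by rw [Real.volume_Ioc]; norm_num

lemma abs_psi_le (t : ℝ) : |psi t| ≤ 10 := by
  have h : ‖psi t‖ₑ ≤ 10 := (enorm_integral_le_lintegral_enorm _).trans (lint_psi t)
  rw [Real.enorm_eq_ofReal_abs] at h
  have : ENNReal.ofReal |psi t| ≤ ENNReal.ofReal 10 := by simpa using h
  exact (ENNReal.ofReal_le_ofReal_iff (by norm_num)).1 this

lemma qq_diff {u v m : ℝ} (hm : 0 < m) (hu : m ≤ |u|) (hv : m ≤ |v|) :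
    |qq u - qq v| ≤ |u - v| / (2 * (m * √m)) := by
  have h1 : 0 < √m := Real.sqrt_pos.2 hm
  have hU : √m ≤ √|u| := Real.sqrt_le_sqrt hu
  have hV : √m ≤ √|v| := Real.sqrt_le_sqrt hv
  have hU0 := h1.trans_le hU
  have hV0 := h1.trans_le hV
  have e : qq u - qq v = (|v| - |u|) / (√|u| * √|v| * (√|u| + √|v|)) := by
    unfold qq
    rw [inv_sub_inv hU0.ne' hV0.ne', div_eq_div_iff (by positivity) (by positivity)]
    have a1 := Real.sq_sqrt (abs_nonneg u)
    have a2 := Real.sq_sqrt (abs_nonneg v)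
    linear_combination (√|u| * √|v|) * (a2 - a1)
  rw [e, abs_div, abs_of_pos (by positivity : 0 < √|u| * √|v| * (√|u| + √|v|))]
  refine div_le_div₀ (abs_nonneg _) ?_ (by positivity) ?_
  · rw [abs_sub_comm u v]; exact abs_abs_sub_abs_le _ _
  · have : m = √m * √m := (Real.mul_self_sqrt hm.le).symm
    calc 2 * (m * √m) = (√m * √m) * (√m + √m) := by rw [← this]; ring
      _ ≤ _ := by gcongr

lemma psi_decay (t : ℝ) : |psi t| * (1 + |t| * √|t|) ≤ 90 := by
  rcases lt_or_ge |t| 4 with h | h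
  · have h1 : √|t| ≤ 2 := by
      rw [show (2 : ℝ) = √(2 ^ 2) by rw [Real.sqrt_sq (by norm_num)]]
      exact Real.sqrt_le_sqrt (by linarith)
    have h2 : |t| * √|t| ≤ 4 * 2 := by gcongr
    calc |psi t| * (1 + |t| * √|t|) ≤ 10 * (1 + 4 * 2) := by
          have := abs_psi_le t
          gcongr
      _ = 90 := by norm_num
  · have hb : |psi t| ≤ (4 / (2 * (|t| / 2 * √(|t| / 2)))) * 1 := by
      rw [← Real.norm_eq_abs]
      have := norm_setIntegral_le_of_norm_le_const (μ := volume) (s := Ioc (1 : ℝ) 2)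
        (f := fun a => qq (t + a) - qq (t - a)) (C := 4 / (2 * (|t| / 2 * √(|t| / 2)))) (by simp) ?_
      · unfold psi
        refine this.trans (le_of_eq ?_)
        rw [Real.volume_real_Ioc_of_le (by norm_num)]; norm_num
      · intro a ha
        have ha1 : |a| = a := abs_of_pos (by linarith [ha.1])
        rw [Real.norm_eq_abs]
        have h1 : |t| / 2 ≤ |t + a| := by
          have := abs_sub_abs_le_abs_sub t (-a)
          rw [abs_neg, sub_neg_eq_add] at this
          linarith [ha.2]
        have h2 : |t| / 2 ≤ |t - a| := by
          have := abs_sub_abs_le_abs_sub t a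
          linarith [ha.2]
        refine (qq_diff (by linarith) h1 h2).trans ?_
        gcongr
        rw [show t + a - (t - a) = 2 * a by ring, abs_mul, ha1]
        norm_num; linarith [ha.2]
    set X := |t| * √|t| with hX
    have ht : 0 < |t| := by linarith
    have hs2 : 2 ≤ √|t| := by
      rw [show (2 : ℝ) = √(2 ^ 2) by rw [Real.sqrt_sq (by norm_num)]]
      exact Real.sqrt_le_sqrt (by linarith)
    have hX1 : 8 ≤ X := by rw [hX]; nlinarith
    have h3 : X / 4 ≤ |t| / 2 * √(|t| / 2) := by
      rw [Real.sqrt_div ht.le, hX]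
      have : √2 ≤ 2 := by
        rw [Real.sqrt_le_left (by norm_num)]; norm_num
      have h4 : √|t| / 2 ≤ √|t| / √2 := by gcongr
      calc |t| * √|t| / 4 = |t| / 2 * (√|t| / 2) := by ring
        _ ≤ _ := by gcongr
    have h5 : 4 / (2 * (|t| / 2 * √(|t| / 2))) ≤ 8 / X := by
      calc _ ≤ 4 / (2 * (X / 4)) := by gcongr
        _ = _ := by field_simp; norm_num
    calc _ ≤ 8 / X * (1 + X) := by
          gcongr
          linarith
      _ = 8 + 8 / X := by field_simp; ring
      _ ≤ 8 + 8 / 8 := by gcongr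
      _ ≤ 90 := by norm_num

lemma psi_int : Integrable psi := by
  refine ⟨psi_meas.aestronglyMeasurable, ?_⟩
  unfold HasFiniteIntegral
  calc _ ≤ ∫⁻ t : ℝ, ((Icc (-1 : ℝ) 1).indicator (fun _ => 10) t +
        ENNReal.ofReal 90 * (if 1 < |t| then ENNReal.ofReal ((|t| ^ (3 / 2 : ℝ))⁻¹) else 0)) := by
        refine lintegral_mono fun t => ?_
        simp only
        rw [Real.enorm_eq_ofReal_abs]
        split_ifs with h
        · refine le_trans ?_ (le_add_left le_rfl)
          rw [← ENNReal.ofReal_mul (by norm_num)]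
          refine ENNReal.ofReal_le_ofReal ?_
          rw [rpow_three_half, ← div_eq_mul_inv, le_div_iff₀ (by have := Real.sqrt_pos.2 (one_pos.trans h); positivity)]
          have := psi_decay t
          nlinarith [abs_nonneg (psi t)]
        · refine le_trans ?_ (le_add_right le_rfl)
          rw [indicator_of_mem (by rw [mem_Icc]; exact abs_le.1 (not_lt.1 h))]
          have : ENNReal.ofReal |psi t| ≤ ENNReal.ofReal 10 := ENNReal.ofReal_le_ofReal (abs_psi_le t)
          simpa using this
    _ = (∫⁻ t : ℝ, (Icc (-1 : ℝ) 1).indicator (fun _ => 10) t) + ENNReal.ofReal 90 * ∫⁻ t : ℝ, (if 1 < |t| then ENNReal.ofReal ((|t| ^ (3 / 2 : ℝ))⁻¹) else 0) := by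
        rw [lintegral_add_left (measurable_const.indicator measurableSet_Icc), lintegral_const_mul]
        exact Measurable.ite (measurableSet_lt measurable_const (by fun_prop)) (by fun_prop) (by fun_prop)
    _ ≤ 10 * volume (Icc (-1 : ℝ) 1) + ENNReal.ofReal 90 * ENNReal.ofReal (4 / √1) := by
        gcongr
        · rw [lintegral_indicator_const measurableSet_Icc]
        · exact lint_threehalf_far one_pos
    _ < ⊤ := by rw [Real.volume_Icc]; exact Ne.lt_top (by finiteness)

lemma psi_integral : ∫ t, psi t = 0 := by
  have := integral_neg_eq_self psi volume
  simp only [psi_odd, integral_neg] at this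
  linarith

lemma psikk_int (σ : ℝ) : Integrable (fun t => psi t * kk (σ - t)) := by
  have h1 := psi_meas
  have h2 := kk_meas
  refine ⟨Measurable.aestronglyMeasurable (by fun_prop), ?_⟩
  unfold HasFiniteIntegral
  calc _ = ∫⁻ t, ‖psi t‖ₑ * ENNReal.ofReal ((√|t - σ|)⁻¹) := by
        refine lintegral_congr fun t => ?_
        rw [enorm_mul, Real.enorm_eq_ofReal_abs (kk _), abs_kk, abs_sub_comm]
    _ ≤ _ := lint_half_conv (fun t => ‖psi t‖ₑ) (by fun_prop) (ENNReal.ofReal 10)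
        (fun t => by simp only [Real.enorm_eq_ofReal_abs]; exact ENNReal.ofReal_le_ofReal (abs_psi_le t)) one_pos σ
    _ < ⊤ := by
        have := psi_int.2.ne
        exact Ne.lt_top (by finiteness)

lemma T_trunc (σ : ℝ) {R : ℝ} (hR : 2 * (4 + |σ|) ≤ R) :
    |(∫ t in (-R)..R, psi t * kk (σ - t)) - bet * ∫ a in Ioc (1 : ℝ) 2, (sg (σ + a) - sg (σ - a))| ≤
      2 * ((6 + |σ|) * (2 / R)) := by
  have hq := qq_meas
  have hk := kk_meas
  have hσ := abs_nonneg σ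
  have hsg : Measurable sg := by
    unfold sg
    exact measurable_const.sub (measurable_const.mul (Measurable.ite measurableSet_Iio (by fun_prop) (by fun_prop)))
  have hRR : -R ≤ R := by linarith
  have hIgl : Integrable (Function.uncurry fun t a : ℝ => (qq (t + a) - qq (t - a)) * kk (σ - t))
      ((volume.restrict (Ioc (-R) R)).prod (volume.restrict (Ioc 1 2))) := by
    refine ⟨Measurable.aestronglyMeasurable (by simp only [Function.uncurry_def]; fun_prop), ?_⟩
    unfold HasFiniteIntegral
    rw [lintegral_prod _ (by simp only [Function.uncurry_def]; fun_prop)]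
    calc _ ≤ ∫⁻ t in Ioc (-R) R, 10 * ‖qq (t - σ)‖ₑ := by
          refine lintegral_mono fun t => ?_
          simp only [Function.uncurry_def, enorm_mul]
          rw [lintegral_mul_const _ (by fun_prop)]
          refine mul_le_mul' (lint_psi t) (le_of_eq ?_)
          rw [Real.enorm_eq_ofReal_abs, abs_kk, Real.enorm_of_nonneg (qq_nonneg _), abs_sub_comm]; rfl
      _ = 10 * ∫⁻ t in Ioc (-R) R, ‖qq (t - σ)‖ₑ := by rw [lintegral_const_mul _ (by fun_prop)]
      _ ≤ 10 * (4 + volume (Ioc (-R) R)) := by gcongr; exact lint_qq_le _ measurableSet_Ioc _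
      _ < ⊤ := by rw [Real.volume_Ioc]; exact Ne.lt_top (by finiteness)
  have e1 : ∫ t in (-R)..R, psi t * kk (σ - t) =
      ∫ a in Ioc (1 : ℝ) 2, ∫ t in (-R)..R, (qq (t + a) - qq (t - a)) * kk (σ - t) := by
    simp only [intervalIntegral.integral_of_le hRR]
    rw [← integral_integral_swap hIgl]
    refine integral_congr_ae (Filter.Eventually.of_forall fun t => ?_)
    simp only [psi]
    rw [integral_mul_const]
  have hi1 : Integrable (fun a => ∫ t in (-R)..R, (qq (t + a) - qq (t - a)) * kk (σ - t)) (volume.restrict (Ioc 1 2)) := by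
    have := hIgl.integral_prod_right
    simp only [Function.uncurry_def, ← intervalIntegral.integral_of_le hRR] at this
    exact this
  have hi2 : Integrable (fun a => sg (σ + a) - sg (σ - a)) (volume.restrict (Ioc (1 : ℝ) 2)) := by
    refine Integrable.of_bound (C := 4) (Measurable.aestronglyMeasurable (by fun_prop)) ?_
    filter_upwards with a
    rw [Real.norm_eq_abs]
    unfold sg
    split_ifs <;> norm_num
  rw [e1, ← integral_const_mul, ← integral_sub hi1 (hi2.const_mul _), ← Real.norm_eq_abs]
  have hae : ∀ᵐ a ∂(volume.restrict (Ioc (1 : ℝ) 2)),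
     ‖(∫ t in (-R)..R, (qq (t + a) - qq (t - a)) * kk (σ - t)) - bet * (sg (σ + a) - sg (σ - a))‖ ≤ 2 * ((6 + |σ|) * (2 / R)) := by
    have n1 : ∀ᵐ a : ℝ ∂(volume.restrict (Ioc (1 : ℝ) 2)), a ≠ σ := ae_restrict_of_ae (by simp [ae_iff])
    have n2 : ∀ᵐ a : ℝ ∂(volume.restrict (Ioc (1 : ℝ) 2)), a ≠ -σ := ae_restrict_of_ae (by simp [ae_iff])
    filter_upwards [n1, n2, ae_restrict_mem measurableSet_Ioc] with a h1 h2 ha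
    have haa : |a| = a := abs_of_pos (by linarith [ha.1])
    have c1 : σ + a ≠ 0 := fun h => h2 (by linarith)
    have c2 : σ - a ≠ 0 := fun h => h1 (by linarith)
    have b1 : |σ + a| ≤ |σ| + 2 := (abs_add_le _ _).trans (by rw [haa]; linarith [ha.2])
    have b2 : |σ - a| ≤ |σ| + 2 := (abs_sub _ _).trans (by rw [haa]; linarith [ha.2])
    have j1 := J_all c1 (R := R) (e := a) (by rw [haa]; linarith [ha.2])
    have j2 := J_all c2 (R := R) (e := -a) (by rw [abs_neg, haa]; linarith [ha.2])
    have s1 := intervalIntegral.integral_comp_add_right (a := -R) (b := R) (fun s => kk (σ + a - s) * qq s) a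
    have s2 := intervalIntegral.integral_comp_add_right (a := -R) (b := R) (fun s => kk (σ - a - s) * qq s) (-a)
    have i1 := (kkqq_ii c1 (-R + a) (R + a)).comp_add_right a
    have i2 := (kkqq_ii c2 (-R + -a) (R + -a)).comp_add_right (-a)
    simp only [add_sub_cancel_right] at i1 i2
    rw [← s1] at j1
    rw [← s2] at j2
    have e2 : ∫ t in (-R)..R, (qq (t + a) - qq (t - a)) * kk (σ - t) =
        (∫ t in (-R)..R, kk (σ + a - (t + a)) * qq (t + a)) - ∫ t in (-R)..R, kk (σ - a - (t + -a)) * qq (t + -a) := by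
      rw [← intervalIntegral.integral_sub i1 i2]
      refine intervalIntegral.integral_congr fun t _ => ?_
      rw [show σ + a - (t + a) = σ - t by ring, show σ - a - (t + -a) = σ - t by ring, ← sub_eq_add_neg t a]
      ring
    rw [e2, Real.norm_eq_abs]
    have hR0 : 0 < R := by linarith
    have k1 : (2 * |a| + |σ + a|) * (2 / R) ≤ (6 + |σ|) * (2 / R) := by
      refine mul_le_mul_of_nonneg_right ?_ (by positivity)
      rw [haa]; linarith [ha.2]
    have k2 : (2 * |-a| + |σ - a|) * (2 / R) ≤ (6 + |σ|) * (2 / R) := by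
      refine mul_le_mul_of_nonneg_right ?_ (by positivity)
      rw [abs_neg, haa]; linarith [ha.2]
    have := abs_le.1 (j1.trans k1)
    have := abs_le.1 (j2.trans k2)
    rw [abs_le]
    constructor <;> linarith
  have := norm_integral_le_of_norm_le_const hae
  simpa [Measure.real] using this.trans (le_of_eq (by
    rw [measureReal_restrict_apply_univ, Real.volume_real_Ioc_of_le (by norm_num)]; norm_num))

lemma T_formula (σ : ℝ) : ∫ t, psi t * kk (σ - t) =
    2 * bet * ∫ a in Ioc (1 : ℝ) 2, ((if σ < a then 1 else 0) - (if σ < -a then 1 else 0)) := by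
  have h1 := intervalIntegral_tendsto_integral (psikk_int σ) Filter.tendsto_neg_atTop_atBot Filter.tendsto_id
  have h2 : Filter.Tendsto (fun R : ℝ => ∫ t in (-R)..R, psi t * kk (σ - t)) Filter.atTop
      (nhds (bet * ∫ a in Ioc (1 : ℝ) 2, (sg (σ + a) - sg (σ - a)))) := by
    rw [tendsto_iff_norm_sub_tendsto_zero]
    have h3 : Filter.Tendsto (fun R : ℝ => 2 * ((6 + |σ|) * (2 / R))) Filter.atTop (nhds 0) := by
      have : Filter.Tendsto (fun R : ℝ => 2 / R) Filter.atTop (nhds 0) := tendsto_const_nhds.div_atTop Filter.tendsto_id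
      simpa using (this.const_mul (6 + |σ|)).const_mul 2
    refine squeeze_zero' (Filter.Eventually.of_forall fun R => norm_nonneg _) ?_ h3
    filter_upwards [Filter.eventually_ge_atTop (2 * (4 + |σ|))] with R hR
    exact T_trunc σ hR
  rw [tendsto_nhds_unique h1 h2, mul_comm 2 bet, mul_assoc, ← integral_const_mul 2]
  congr 1
  refine integral_congr_ae (Filter.Eventually.of_forall fun a => ?_)
  simp only [sg]
  have e1 : σ + a < 0 ↔ σ < -a := by constructor <;> intro h <;> linarith
  have e2 : σ - a < 0 ↔ σ < a := by constructor <;> intro h <;> linarith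
  simp only [e1, e2]
  ring

lemma oneD {w w' : ℝ → ℝ} (hw : ∀ s, HasDerivAt w (w' s) s) (hm : Measurable w') {M : ℝ}
    (hb : ∀ s, |w' s| ≤ M) (hi : Integrable w') :
    ∫ t, psi t * (∫ s, (w s - w t) / |s - t| ^ (3 / 2 : ℝ)) =
      4 * bet * ∫ a in Ioc (1 : ℝ) 2, (w a - w (-a)) := by
  have hpm := psi_meas
  have hk := kk_meas
  have hIgl : Integrable (Function.uncurry fun t σ : ℝ => psi t * (w' σ * kk (σ - t))) (volume.prod volume) := by
    refine ⟨Measurable.aestronglyMeasurable (by simp only [Function.uncurry_def]; fun_prop), ?_⟩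
    unfold HasFiniteIntegral
    rw [lintegral_prod _ (by simp only [Function.uncurry_def]; fun_prop)]
    calc _ ≤ ∫⁻ t, ‖psi t‖ₑ * (ENNReal.ofReal M * ENNReal.ofReal (4 * √1) + (∫⁻ σ, ‖w' σ‖ₑ) * ENNReal.ofReal ((√1)⁻¹)) := by
          refine lintegral_mono fun t => ?_
          simp only [Function.uncurry_def, enorm_mul]
          rw [lintegral_const_mul _ (by fun_prop)]
          gcongr
          refine le_trans (le_of_eq ?_) (lint_half_conv (fun σ => ‖w' σ‖ₑ) (by fun_prop) _ (fun σ => ?_) one_pos t)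
          · refine lintegral_congr fun σ => ?_
            rw [Real.enorm_eq_ofReal_abs (kk _), abs_kk]
          · simp only [Real.enorm_eq_ofReal_abs]; exact ENNReal.ofReal_le_ofReal (hb σ)
      _ = (∫⁻ t, ‖psi t‖ₑ) * (ENNReal.ofReal M * ENNReal.ofReal (4 * √1) + (∫⁻ σ, ‖w' σ‖ₑ) * ENNReal.ofReal ((√1)⁻¹)) := by
          rw [lintegral_mul_const _ (by fun_prop)]
      _ < ⊤ := by
          have h1 : ∫⁻ σ, ‖w' σ‖ₑ ≠ ⊤ := hi.2.ne
          have h2 : ∫⁻ σ, ‖psi σ‖ₑ ≠ ⊤ := psi_int.2.ne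
          exact Ne.lt_top (by finiteness)
  have hIgl2 : Integrable (Function.uncurry fun (σ a : ℝ) => w' σ * (((if σ < a then 1 else 0) - (if σ < -a then 1 else 0)) : ℝ))
      (volume.prod (volume.restrict (Ioc (1 : ℝ) 2))) := by
    have h1 : Integrable (fun q : ℝ × ℝ => w' q.1 * 1) (volume.prod (volume.restrict (Ioc (1 : ℝ) 2))) :=
      hi.mul_prod (g := fun _ => (1 : ℝ)) (integrable_const 1)
    refine h1.mono (Measurable.aestronglyMeasurable ?_) ?_
    · simp only [Function.uncurry_def]
      refine Measurable.mul (by fun_prop) (Measurable.sub ?_ ?_)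
      · exact Measurable.ite (measurableSet_lt measurable_fst measurable_snd) (by fun_prop) (by fun_prop)
      · exact Measurable.ite (measurableSet_lt measurable_fst (by fun_prop)) (by fun_prop) (by fun_prop)
    · filter_upwards with q
      simp only [Function.uncurry_def, norm_mul]
      gcongr
      split_ifs <;> simp
  have e1 : ∀ t, psi t * (∫ s, (w s - w t) / |s - t| ^ (3 / 2 : ℝ)) = 2 * ∫ σ, psi t * (w' σ * kk (σ - t)) := by
    intro t
    rw [halfD_formula hw hm hb hi t, integral_const_mul]; ring
  simp only [e1]
  rw [integral_const_mul, integral_integral_swap hIgl]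
  have e2 : ∀ σ, ∫ t, psi t * (w' σ * kk (σ - t)) =
      2 * bet * ∫ a in Ioc (1 : ℝ) 2, w' σ * (((if σ < a then 1 else 0) - (if σ < -a then 1 else 0)) : ℝ) := by
    intro σ
    rw [integral_const_mul, show ∀ x y z : ℝ, x * (y * z) = y * (x * z) by intros; ring, ← T_formula σ, ← integral_const_mul]
    refine integral_congr_ae (Filter.Eventually.of_forall fun t => ?_)
    simp only; ring
  simp only [e2]
  rw [integral_const_mul, integral_integral_swap hIgl2, ← mul_assoc, ← mul_assoc]
  congr 1
  · ring
  · refine integral_congr_ae (Filter.Eventually.of_forall fun a => ?_)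
    simp only
    rw [diff_eq_int hw hi]

lemma integrable_of_decay {f : ℝ → ℝ} (hf : Measurable f) {A B : ℝ} (hA : ∀ t, |f t| ≤ A)
    (hB : ∀ t, |f t| * (|t| * √|t|) ≤ B) : Integrable f := by
  have hB0 : 0 ≤ B := le_trans (by positivity) (hB 0)
  refine ⟨hf.aestronglyMeasurable, ?_⟩
  unfold HasFiniteIntegral
  calc _ ≤ ∫⁻ t : ℝ, ((Icc (-1 : ℝ) 1).indicator (fun _ => ENNReal.ofReal A) t +
        ENNReal.ofReal B * (if 1 < |t| then ENNReal.ofReal ((|t| ^ (3 / 2 : ℝ))⁻¹) else 0)) := by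
        refine lintegral_mono fun t => ?_
        simp only
        rw [Real.enorm_eq_ofReal_abs]
        split_ifs with h
        · refine le_trans ?_ (le_add_left le_rfl)
          rw [← ENNReal.ofReal_mul hB0]
          refine ENNReal.ofReal_le_ofReal ?_
          rw [rpow_three_half, ← div_eq_mul_inv, le_div_iff₀ (by have := Real.sqrt_pos.2 (one_pos.trans h); positivity)]
          exact hB t
        · refine le_trans ?_ (le_add_right le_rfl)
          rw [indicator_of_mem (by rw [mem_Icc]; exact abs_le.1 (not_lt.1 h))]
          exact ENNReal.ofReal_le_ofReal (hA t)
    _ = (∫⁻ t : ℝ, (Icc (-1 : ℝ) 1).indicator (fun _ => ENNReal.ofReal A) t) + ENNReal.ofReal B * ∫⁻ t : ℝ, (if 1 < |t| then ENNReal.ofReal ((|t| ^ (3 / 2 : ℝ))⁻¹) else 0) := by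
        rw [lintegral_add_left (measurable_const.indicator measurableSet_Icc), lintegral_const_mul]
        exact Measurable.ite (measurableSet_lt measurable_const (by fun_prop)) (by fun_prop) (by fun_prop)
    _ ≤ ENNReal.ofReal A * volume (Icc (-1 : ℝ) 1) + ENNReal.ofReal B * ENNReal.ofReal (4 / √1) := by
        gcongr
        · rw [lintegral_indicator_const measurableSet_Icc]
        · exact lint_threehalf_far one_pos
    _ < ⊤ := by rw [Real.volume_Icc]; exact Ne.lt_top (by finiteness)

lemma dtW_integrable {n : ℕ} (hn : 1 ≤ n) {z : Spc n} (hz : z ≠ 0) :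
    (∃ M, ∀ t, |dtW (z, t)| ≤ M) ∧ Integrable (fun t => dtW (z, t)) := by
  have hz' : 0 < ‖z‖ := norm_pos_iff.2 hz
  set C := ((n : ℝ) / 2 + 2) * cM (n + 2)
  have hC : 0 ≤ C := by have := cM_pos (n + 2); positivity
  have hb : ∀ t, |dtW (z, t)| ≤ C / ‖z‖ ^ (n + 2) := by
    intro t
    rw [le_div_iff₀ (by positivity)]
    refine le_trans ?_ (dtW_pnorm (z, t))
    rw [mul_comm]
    gcongr
    exact norm_le_pnorm (z, t)
  refine ⟨⟨_, hb⟩, integrable_of_decay (A := C / ‖z‖ ^ (n + 2)) (B := C / ‖z‖ ^ (n - 1)) ?_ hb ?_⟩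
  · have := dtW_measurable (n := n); fun_prop
  · intro t
    rw [le_div_iff₀ (by positivity)]
    refine le_trans ?_ (dtW_pnorm (z, t))
    have h1 : |t| * √|t| ≤ pnorm (z, t) ^ 3 := by
      calc |t| * √|t| = √|t| ^ 3 := by nth_rw 1 [← Real.sq_sqrt (abs_nonneg t)]; ring
        _ ≤ _ := by gcongr; exact sqrt_le_pnorm (z, t)
    have h2 : ‖z‖ ^ (n - 1) ≤ pnorm (z, t) ^ (n - 1) := by gcongr; exact norm_le_pnorm (z, t)
    have h3 : pnorm (z, t) ^ (n + 2) = pnorm (z, t) ^ 3 * pnorm (z, t) ^ (n - 1) := by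
      rw [← pow_add]; congr 1; omega
    rw [h3]
    have := pnorm_nonneg (z, t)
    calc _ = (|t| * √|t|) * ‖z‖ ^ (n - 1) * |dtW (z, t)| := by ring
      _ ≤ _ := by gcongr

lemma heat1D {n : ℕ} (hn : 1 ≤ n) {z : Spc n} (hz : z ≠ 0) {L : ℝ} (hL : 0 < L) (t0 τ : ℝ) :
    ∫ t, psi ((t - t0) / L) * halfT heatW (z, t - τ) =
      4 * bet * √L * ∫ a in Ioc (1 : ℝ) 2, (heatW (z, t0 + a * L - τ) - heatW (z, t0 - a * L - τ)) := by
  obtain ⟨⟨M, hM⟩, hi⟩ := dtW_integrable hn hz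
  have hsL : 0 < √L := Real.sqrt_pos.2 hL
  set c0 := t0 - τ with hc0
  have hw : ∀ u, HasDerivAt (fun u => heatW (z, L * u + c0)) (L * dtW (z, L * u + c0)) u := by
    intro u
    have h1 := heatW_hasDerivAt z (L * u + c0) (Or.inl hz)
    have h2 : HasDerivAt (fun u : ℝ => L * u + c0) L u := by
      simpa using ((hasDerivAt_id u).const_mul L).add_const c0
    have := h1.comp u h2
    refine this.congr_deriv (by ring)
  have hi2 : Integrable fun u => L * dtW (z, L * u + c0) := by
    have h3 : Integrable fun t => dtW (z, t + c0) := hi.comp_add_right c0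
    exact (h3.comp_mul_left' hL.ne').const_mul L
  have key := oneD hw (by have := dtW_measurable (n := n); fun_prop) (M := L * M) (fun u => by
    rw [abs_mul, abs_of_pos hL]; have := hM (L * u + c0); gcongr) hi2
  have e1 : ∀ u, ∫ s, (heatW (z, L * s + c0) - heatW (z, L * u + c0)) / |s - u| ^ (3 / 2 : ℝ) =
      √L * halfT heatW (z, L * u + c0) := by
    intro u
    unfold halfT
    simp only
    have h1 := integral_add_right_eq_self (μ := (volume : Measure ℝ)) (fun s => (heatW (z, s) - heatW (z, L * u + c0)) / |s - (L * u + c0)| ^ (3 / 2 : ℝ)) c0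
    have h2 := Measure.integral_comp_mul_left (fun s => (heatW (z, s + c0) - heatW (z, L * u + c0)) / |s + c0 - (L * u + c0)| ^ (3 / 2 : ℝ)) L
    rw [h1, smul_eq_mul, abs_of_pos (inv_pos.2 hL)] at h2
    have h3 : ∀ s, (heatW (z, L * s + c0) - heatW (z, L * u + c0)) / |s - u| ^ (3 / 2 : ℝ) =
       (L * √L) * ((heatW (z, L * s + c0) - heatW (z, L * u + c0)) / |L * s + c0 - (L * u + c0)| ^ (3 / 2 : ℝ)) := by
      intro s
      rw [show L * s + c0 - (L * u + c0) = L * (s - u) by ring, rpow_three_half, rpow_three_half, abs_mul,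
        abs_of_pos hL, Real.sqrt_mul hL.le]
      rcases eq_or_ne s u with rfl | hne
      · simp
      · have : 0 < |s - u| := abs_pos.2 (sub_ne_zero.2 hne)
        have : 0 < √|s - u| := Real.sqrt_pos.2 this
        field_simp
    simp only [h3]
    rw [integral_const_mul, h2]
    field_simp
  simp only [e1] at key
  have f1 := integral_sub_right_eq_self (μ := (volume : Measure ℝ)) (fun t => psi (t / L) * halfT heatW (z, t + c0)) t0
  have f2 := Measure.integral_comp_mul_left (fun t => psi (t / L) * halfT heatW (z, t + c0)) L
  rw [smul_eq_mul, abs_of_pos (inv_pos.2 hL)] at f2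
  have f3 : ∀ t, t - t0 + c0 = t - τ := by intro t; rw [hc0]; ring
  simp only [f3] at f1
  rw [f1]
  have f4 : ∀ u, psi (L * u / L) * halfT heatW (z, L * u + c0) = (√L)⁻¹ * (psi u * (√L * halfT heatW (z, L * u + c0))) := by
    intro u
    rw [mul_div_cancel_left₀ _ hL.ne']
    field_simp
  simp only [f4] at f2
  rw [integral_const_mul, key] at f2
  have f5 : ∫ t, psi (t / L) * halfT heatW (z, t + c0) = L * ((√L)⁻¹ * (4 * bet * ∫ a in Ioc (1 : ℝ) 2, (heatW (z, L * a + c0) - heatW (z, L * -a + c0)))) := by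
    rw [f2]; field_simp
  rw [f5]
  have f6 : ∀ a, (heatW (z, L * a + c0) - heatW (z, L * -a + c0)) = heatW (z, t0 + a * L - τ) - heatW (z, t0 - a * L - τ) := by
    intro a
    rw [hc0, show L * a + (t0 - τ) = t0 + a * L - τ by ring, show L * -a + (t0 - τ) = t0 - a * L - τ by ring]
  simp only [f6]
  have : L = √L * √L := (Real.mul_self_sqrt hL.le).symm
  have h7 : L * (√L)⁻¹ = √L := by nth_rw 1 [this]; field_simp
  rw [← mul_assoc, h7]; ring

/-- constant for the gradient -/
def cG (n : ℕ) : ℝ := √(π * 8) ^ n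
lemma cG_pos (n : ℕ) : 0 < cG n := by unfold cG; positivity
lemma lint_gradW {n : ℕ} (t : ℝ) : ∫⁻ x : Spc n, ‖gradW (x, t)‖ₑ ≤ ENNReal.ofReal (cG n * (√|t|)⁻¹) := by
  by_cases ht : 0 < t
  · calc _ ≤ ∫⁻ x : Spc n, ENNReal.ofReal ((√t)⁻¹) * ENNReal.ofReal (gG x t) := by
          refine lintegral_mono fun x => ?_
          simp only
          rw [← ENNReal.ofReal_mul (by positivity), ← ofReal_norm]
          exact ENNReal.ofReal_le_ofReal (norm_gradW_le x ht)
      _ = ENNReal.ofReal ((√t)⁻¹) * ENNReal.ofReal (cG n) := by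
          rw [lintegral_const_mul' _ _ ENNReal.ofReal_ne_top]
          congr 1
          exact lint_gauss (by norm_num) ht
      _ = _ := by rw [← ENNReal.ofReal_mul (by positivity), abs_of_pos ht, mul_comm]
  · have : ∀ x : Spc n, gradW (x, t) = 0 := by intro x; unfold gradW; rw [if_neg (by simpa using ht)]
    simp [this]

lemma heatW_one {n : ℕ} (z : Spc n) {σ : ℝ} (hσ : 0 < σ) :
    (√σ) ^ n * heatW (√σ • z, σ) = heatW (z, 1) := by
  unfold heatW
  simp only
  rw [if_pos hσ, if_pos one_pos, norm_smul, Real.norm_of_nonneg (Real.sqrt_nonneg σ), mul_pow, Real.sq_sqrt hσ.le,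
    Real.mul_rpow (by positivity) hσ.le]
  have h1 : (√σ) ^ n * σ ^ (-(n : ℝ) / 2) = 1 := by
    rw [Real.sqrt_eq_rpow, ← Real.rpow_natCast, ← Real.rpow_mul hσ.le, ← Real.rpow_add hσ]
    rw [show (1 / 2 * (n : ℝ) + -(n : ℝ) / 2) = 0 by ring, Real.rpow_zero]
  have h2 : -(σ * ‖z‖ ^ 2) / (4 * σ) = -‖z‖ ^ 2 / (4 * 1) := by field_simp
  rw [h2]
  calc (√σ) ^ n * ((4 * π) ^ (-(n : ℝ) / 2) * σ ^ (-(n : ℝ) / 2) * rexp (-‖z‖ ^ 2 / (4 * 1)))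
      = ((√σ) ^ n * σ ^ (-(n : ℝ) / 2)) * ((4 * π) ^ (-(n : ℝ) / 2) * rexp (-‖z‖ ^ 2 / (4 * 1))) := by ring
    _ = _ := by rw [h1, one_mul, mul_one (4 * π)]

lemma gradW_eq {n : ℕ} (p : Pt n) : gradW p = (-(1 / (2 * p.2)) * heatW p) • p.1 := by
  unfold gradW heatW
  split_ifs
  · congr 1; ring
  · simp

lemma gradW_one {n : ℕ} (z : Spc n) {σ : ℝ} (hσ : 0 < σ) :
    (√σ) ^ n • gradW (√σ • z, σ) = (-(qq σ / 2) * heatW (z, 1)) • z := by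
  rw [gradW_eq, smul_smul, ← heatW_one z hσ, smul_smul]
  congr 1
  unfold qq
  rw [abs_of_pos hσ]
  have : σ = √σ * √σ := (Real.mul_self_sqrt hσ.le).symm
  have h0 : 0 < √σ := Real.sqrt_pos.2 hσ
  simp only
  have h3 : 1 / (2 * σ) * √σ = (√σ)⁻¹ / 2 := by
    nth_rw 1 [this]; field_simp
  linear_combination (-(√σ ^ n * heatW (√σ • z, σ))) * h3

lemma heatW_integrable {n : ℕ} (t : ℝ) : Integrable (fun x : Spc n => heatW (x, t)) := by
  have hm := heatW_measurable (n := n)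
  refine ⟨Measurable.aestronglyMeasurable (by fun_prop), ?_⟩
  rw [hasFiniteIntegral_iff_ofReal (by filter_upwards with y using heatW_nonneg _)]
  exact (lint_heatW_le t).trans_lt ENNReal.ofReal_lt_top

lemma heatW_int_one {n : ℕ} : ∫ z : Spc n, heatW (z, 1) = 1 := by
  have h := GaussianFourier.integral_rexp_neg_mul_sq_norm (V := Spc n) (b := 1 / 4) (by norm_num)
  have e : ∀ z : Spc n, heatW (z, 1) = (4 * π) ^ (-(n : ℝ) / 2) * rexp (-(1 / 4) * ‖z‖ ^ 2) := by
    intro z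
    unfold heatW
    simp only
    rw [if_pos one_pos]
    congr 2
    · ring
    · ring
  simp only [e]
  rw [integral_const_mul, h, finrank_euclideanSpace_fin, show π / (1 / 4) = 4 * π by ring, ← Real.rpow_add (by positivity),
    show -(n : ℝ) / 2 + (n : ℝ) / 2 = 0 by ring, Real.rpow_zero]

lemma int_scale {n : ℕ} {s : ℝ} (hs : 0 < s) (f : Spc n → ℝ) (y : Spc n) :
    ∫ x, f x = ∫ z, s ^ n * f (y + s • z) := by
  have h := Measure.integral_comp_smul (volume : Measure (Spc n)) (fun x => f (y + x)) s
  rw [integral_add_left_eq_self f y, finrank_euclideanSpace_fin, smul_eq_mul, abs_of_pos (by positivity)] at h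
  rw [integral_const_mul, h]
  field_simp

lemma semigroup {n : ℕ} {η : Spc n → ℝ} (hη : ContDiff ℝ 1 η) (hη1 : ∀ x, |η x| ≤ 1) {K : ℝ}
    (hK : ∀ x, ‖fderiv ℝ η x‖ ≤ K) (y : Spc n) {b : ℝ} (hb : 0 < b) :
    ∫ x, η x * heatW (x - y, b) = η y - ∫ σ in Ioc 0 b, ∫ x, fderiv ℝ η x (gradW (x - y, σ)) := by
  have hK0 : 0 ≤ K := (norm_nonneg _).trans (hK 0)
  have hc : Continuous (fderiv ℝ η) := hη.continuous_fderiv one_ne_zero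
  have hηc : Continuous η := hη.continuous
  have hm := heatW_measurable (n := n)
  have hq := qq_meas
  have hsb := Real.sqrt_pos.2 hb
  have e1 : ∫ x, η x * heatW (x - y, b) = ∫ z, η (y + √b • z) * heatW (z, 1) := by
    rw [int_scale hsb _ y]
    refine integral_congr_ae (Filter.Eventually.of_forall fun z => ?_)
    simp only
    rw [add_sub_cancel_left, ← heatW_one z hb]; ring
  have e2 : ∀ σ ∈ Ioc 0 b, ∫ x, fderiv ℝ η x (gradW (x - y, σ)) =
      ∫ z, -(heatW (z, 1) * (qq σ / 2 * fderiv ℝ η (y + √σ • z) z)) := by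
    intro σ hσ
    rw [int_scale (Real.sqrt_pos.2 hσ.1) _ y]
    refine integral_congr_ae (Filter.Eventually.of_forall fun z => ?_)
    simp only
    rw [add_sub_cancel_left, ← smul_eq_mul, ← map_smul, gradW_one z hσ.1, map_smul, smul_eq_mul]; ring
  have hcont : Continuous fun q : ℝ × Spc n => fderiv ℝ η (y + √q.1 • q.2) q.2 := by fun_prop
  have hIgl : Integrable (Function.uncurry fun (σ : ℝ) (z : Spc n) => -(heatW (z, 1) * (qq σ / 2 * fderiv ℝ η (y + √σ • z) z)))
      ((volume.restrict (Ioc 0 b)).prod volume) := by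
    have g1 : Integrable (fun z : Spc n => K * ‖gradW (z, 1)‖) := by
      refine Integrable.const_mul (Integrable.norm ⟨Measurable.aestronglyMeasurable ?_, ?_⟩) K
      · have := gradW_measurable (n := n); fun_prop
      · exact (lint_gradW 1).trans_lt ENNReal.ofReal_lt_top
    have g2 : Integrable (fun σ => qq (σ - 0)) (volume.restrict (Ioc 0 b)) :=
      qq_intOn _ measurableSet_Ioc (by rw [Real.volume_Ioc]; finiteness) 0
    refine (g2.mul_prod g1).mono (Measurable.aestronglyMeasurable ?_) ?_
    · simp only [Function.uncurry_def]
      have := hcont.measurable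
      fun_prop
    · filter_upwards with q
      simp only [Function.uncurry_def, norm_neg, norm_mul, sub_zero, norm_norm]
      have h1 : ‖fderiv ℝ η (y + √q.1 • q.2) q.2‖ ≤ K * ‖q.2‖ := (ContinuousLinearMap.le_opNorm _ _).trans (by gcongr; exact hK _)
      rw [gradW_eq, norm_smul, norm_mul, norm_div, Real.norm_of_nonneg hK0]
      norm_num
      calc _ ≤ |heatW (q.2, 1)| * (|qq q.1| / 2 * (K * ‖q.2‖)) := by
            rw [Real.norm_eq_abs] at h1
            gcongr
        _ = _ := by ring
  rw [e1, setIntegral_congr_fun measurableSet_Ioc e2, integral_integral_swap hIgl]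
  have e3 : ∀ z : Spc n, ∫ σ in Ioc 0 b, -(heatW (z, 1) * (qq σ / 2 * fderiv ℝ η (y + √σ • z) z)) =
      heatW (z, 1) * η y - η (y + √b • z) * heatW (z, 1) := by
    intro z
    have hcz : Continuous fun σ : ℝ => η (y + √σ • z) := by fun_prop
    have ftc := intervalIntegral.integral_eq_sub_of_hasDerivAt_of_le (a := 0) (b := b) hb.le
      (f := fun σ : ℝ => η (y + √σ • z)) (f' := fun σ => qq σ / 2 * fderiv ℝ η (y + √σ • z) z) hcz.continuousOn ?_ ?_
    · rw [intervalIntegral.integral_of_le hb.le] at ftc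
      rw [integral_neg, integral_const_mul, ftc]
      simp only [Real.sqrt_zero, zero_smul, add_zero]
      ring
    · intro σ hσ
      have h1 : HasDerivAt (fun σ : ℝ => y + √σ • z) ((1 / (2 * √σ)) • z) σ :=
        ((Real.hasDerivAt_sqrt hσ.1.ne').smul_const z).const_add y
      have h2 : HasFDerivAt η (fderiv ℝ η (y + √σ • z)) (y + √σ • z) :=
        (hη.differentiable one_ne_zero).differentiableAt.hasFDerivAt
      refine (h2.comp_hasDerivAt σ h1).congr_deriv ?_
      rw [map_smul, smul_eq_mul]
      unfold qq
      rw [abs_of_pos hσ.1]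
      field_simp
    · have g2 := (qq_ii 0 b 0).const_mul (K * ‖z‖)
      refine g2.mono_fun (Measurable.aestronglyMeasurable ?_) ?_
      · have := (hcont.comp (by fun_prop : Continuous fun σ : ℝ => (σ, z))).measurable
        simp only [Function.comp_def] at this
        fun_prop
      · filter_upwards with σ
        rw [sub_zero, norm_mul, norm_div, norm_mul, Real.norm_of_nonneg (qq_nonneg σ)]
        have h1 : ‖fderiv ℝ η (y + √σ • z) z‖ ≤ K * ‖z‖ := (ContinuousLinearMap.le_opNorm _ _).trans (by gcongr; exact hK _)
        rw [norm_mul, norm_norm, Real.norm_of_nonneg hK0]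
        have := qq_nonneg σ
        calc _ ≤ qq σ / ‖(2 : ℝ)‖ * (K * ‖z‖) := by gcongr
          _ ≤ qq σ * (K * ‖z‖) := by gcongr; norm_num; linarith
          _ = _ := by ring
  simp only [e3]
  have i1 : Integrable fun z : Spc n => heatW (z, 1) * η y := (heatW_integrable 1).mul_const _
  have i2 : Integrable fun z : Spc n => η (y + √b • z) * heatW (z, 1) := by
    refine (heatW_integrable 1).bdd_mul (c := 1) (Continuous.aestronglyMeasurable (by fun_prop)) ?_
    filter_upwards with z
    exact hη1 _
  rw [integral_sub i1 i2, integral_mul_const, heatW_int_one]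
  ring

lemma gradW_of_nonpos {n : ℕ} {p : Pt n} (h : p.2 ≤ 0) : gradW p = 0 := by
  unfold gradW; rw [if_neg (not_lt.2 h)]

/-- uniform space-time bound for the gradient -/
lemma lint_gradW_slab {n : ℕ} (S : Set ℝ) (hS : MeasurableSet S) (y : Pt n) :
    ∫⁻ q : Pt n, S.indicator (fun _ => (1 : ENNReal)) q.2 * ‖gradW (q - y)‖ₑ ≤
      ENNReal.ofReal (cG n) * (ENNReal.ofReal 4 + volume S) := by
  have hm := gradW_measurable (n := n)
  have hi : Measurable (S.indicator (fun _ => (1 : ENNReal))) := measurable_const.indicator hS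
  rw [Measure.volume_eq_prod, lintegral_prod_symm _ (Measurable.aemeasurable (by fun_prop))]
  have h1 : ∀ t : ℝ, ∫⁻ x : Spc n, S.indicator (fun _ => (1 : ENNReal)) (x, t).2 * ‖gradW ((x, t) - y)‖ₑ ≤
      ENNReal.ofReal (cG n) * (S.indicator (fun _ => (1 : ENNReal)) t * ENNReal.ofReal ((√|t - y.2|)⁻¹)) := by
    intro t
    simp only
    rw [lintegral_const_mul _ (by fun_prop)]
    have h2 : ∫⁻ x : Spc n, ‖gradW ((x, t) - y)‖ₑ = ∫⁻ x : Spc n, ‖gradW (x, t - y.2)‖ₑ := by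
      rw [← lintegral_sub_right_eq_self (fun x : Spc n => ‖gradW (x, t - y.2)‖ₑ) y.1]
      rfl
    rw [h2]
    calc _ ≤ S.indicator (fun _ => (1 : ENNReal)) t * ENNReal.ofReal (cG n * (√|t - y.2|)⁻¹) := by
            gcongr; exact lint_gradW _
      _ = _ := by rw [ENNReal.ofReal_mul (cG_pos n).le]; ring
  refine (lintegral_mono h1).trans ?_
  rw [lintegral_const_mul _ (by fun_prop)]
  gcongr
  have := lint_half_conv (S.indicator (fun _ => (1 : ENNReal))) hi 1 (fun t => by
    by_cases h : t ∈ S <;> simp [h]) one_pos y.2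
  refine this.trans ?_
  rw [lintegral_indicator_const hS]
  simp

lemma slab_integrable {n : ℕ} {S : Set ℝ} (hS : MeasurableSet S) (hf : volume S ≠ ⊤)
    {g : Spc n → (Spc n →L[ℝ] ℝ)} (hg : Continuous g) {K : ℝ} (hK : ∀ x, ‖g x‖ ≤ K) (y : Pt n) :
    Integrable (fun q : Pt n => S.indicator (fun _ => (1 : ℝ)) q.2 * g q.1 (gradW (q - y))) := by
  have hm := gradW_measurable (n := n)
  have hi : Measurable (S.indicator (fun _ => (1 : ℝ))) := measurable_const.indicator hS
  have hap : Measurable fun q : Pt n => g q.1 (gradW (q - y)) := by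
    have h1 : Continuous fun z : (Spc n →L[ℝ] ℝ) × Spc n => z.1 z.2 := by fun_prop
    have h2 := hg.measurable
    have h4 : Measurable fun q : Pt n => g q.1 := by fun_prop
    have h5 : Measurable fun q : Pt n => gradW (q - y) := by fun_prop
    exact h1.measurable.comp (h4.prodMk h5)
  refine ⟨Measurable.aestronglyMeasurable (by fun_prop), ?_⟩
  have hK0 : 0 ≤ K := (norm_nonneg _).trans (hK 0)
  refine lt_of_le_of_lt (b := ENNReal.ofReal K * (ENNReal.ofReal (cG n) * (ENNReal.ofReal 4 + volume S))) ?_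
    (Ne.lt_top (by finiteness))
  refine le_trans ?_ (mul_le_mul_right (lint_gradW_slab S hS y) _)
  rw [← lintegral_const_mul _ (by
    have hi : Measurable (S.indicator (fun _ => (1 : ENNReal))) := measurable_const.indicator hS
    fun_prop)]
  refine lintegral_mono fun q => ?_
  simp only
  by_cases h : q.2 ∈ S
  · simp only [h, indicator_of_mem, one_mul]
    rw [← ofReal_norm, ← ofReal_norm, ← ENNReal.ofReal_mul hK0]
    exact ENNReal.ofReal_le_ofReal ((ContinuousLinearMap.le_opNorm _ _).trans (by gcongr; exact hK _))
  · simp [h]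

lemma Aconv {n : ℕ} {η : Spc n → ℝ} (hη : ContDiff ℝ 1 η) (hη1 : ∀ x, |η x| ≤ 1) {K : ℝ}
    (hK : ∀ x, ‖fderiv ℝ η x‖ ≤ K) (y : Pt n) {u v : ℝ} (huv : u ≤ v) :
    ∫ x, η x * (heatW ((x, v) - y) - heatW ((x, u) - y)) =
      (Ico u v).indicator (fun _ => (1 : ℝ)) y.2 * η y.1 -
        ∫ q : Pt n, (Ioc u v).indicator (fun _ => (1 : ℝ)) q.2 * fderiv ℝ η q.1 (gradW (q - y)) := by
  have hc : Continuous (fderiv ℝ η) := hη.continuous_fderiv one_ne_zero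
  have hηc : Continuous η := hη.continuous
  set B : ℝ → ℝ := fun σ => ∫ x, fderiv ℝ η x (gradW ((x, σ) - y)) with hB
  have hslab := fun (a b : ℝ) => slab_integrable (S := Ioc a b) measurableSet_Ioc (by rw [Real.volume_Ioc]; finiteness) hc hK y
  -- integral over q as time integral of B
  have hq : ∀ a b : ℝ, ∫ q : Pt n, (Ioc a b).indicator (fun _ => (1 : ℝ)) q.2 * fderiv ℝ η q.1 (gradW (q - y)) =
      ∫ σ in Ioc a b, B σ := by
    intro a b
    rw [Measure.volume_eq_prod, integral_prod_symm _ (hslab a b), ← integral_indicator measurableSet_Ioc]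
    refine integral_congr_ae (Filter.Eventually.of_forall fun σ => ?_)
    simp only
    by_cases h : σ ∈ Ioc a b <;> simp [h, hB]
  have hBi : ∀ a b : ℝ, IntegrableOn B (Ioc a b) := by
    intro a b
    rw [← integrable_indicator_iff measurableSet_Ioc]
    have := hslab a b
    rw [Measure.volume_eq_prod] at this
    refine this.swap.integral_prod_left.congr (Filter.Eventually.of_forall fun σ => ?_)
    simp only [Function.comp, Prod.swap]
    by_cases h : σ ∈ Ioc a b <;> simp [h, hB]
  have hB0 : ∀ σ ≤ y.2, B σ = 0 := by
    intro σ h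
    simp only [hB]
    have : ∀ x : Spc n, gradW ((x, σ) - y) = 0 := fun x => gradW_of_nonpos (by simpa using h)
    simp [this]
  have hbi : ∀ b : ℝ, Integrable (fun x : Spc n => η x * heatW ((x, b) - y)) := by
    intro b
    refine Integrable.bdd_mul (c := 1) ?_ hηc.aestronglyMeasurable (Filter.Eventually.of_forall fun x => hη1 x)
    exact (heatW_integrable (b - y.2)).comp_sub_right y.1
  -- single-time formula
  have key : ∀ b, ∫ x, η x * heatW ((x, b) - y) = (if y.2 < b then η y.1 else 0) - ∫ σ in y.2..(max b y.2), B σ := by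
    intro b
    by_cases h : y.2 < b
    · rw [if_pos h, max_eq_left h.le, intervalIntegral.integral_of_le h.le]
      have := semigroup hη hη1 hK y.1 (sub_pos.2 h)
      have e : ∫ σ in Ioc 0 (b - y.2), ∫ x, fderiv ℝ η x (gradW (x - y.1, σ)) = ∫ σ in Ioc y.2 b, B σ := by
        rw [← intervalIntegral.integral_of_le (by linarith), ← intervalIntegral.integral_of_le h.le]
        have := intervalIntegral.integral_comp_sub_right (a := y.2) (b := b)
          (fun σ => ∫ x, fderiv ℝ η x (gradW (x - y.1, σ))) y.2
        rw [sub_self] at this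
        rw [← this]
        rfl
      rw [← e, ← this]
      rfl
    · push Not at h
      rw [if_neg (not_lt.2 h), max_eq_right h, intervalIntegral.integral_same]
      have : ∀ x : Spc n, heatW ((x, b) - y) = 0 := fun x => heatW_of_nonpos (by simpa using h)
      simp [this]
  have hii : ∀ a b, IntervalIntegrable B volume a b := fun a b => ⟨hBi a b, hBi b a⟩
  have hmax : ∀ b, ∫ σ in y.2..(max b y.2), B σ = ∫ σ in y.2..b, B σ := by
    intro b
    rcases le_total y.2 b with h | h
    · rw [max_eq_left h]
    · rw [max_eq_right h, intervalIntegral.integral_same, intervalIntegral.integral_of_ge h,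
        setIntegral_congr_fun measurableSet_Ioc (g := fun _ => (0 : ℝ)) (fun σ hσ => hB0 σ hσ.2)]
      simp
  simp only [mul_sub]
  rw [integral_sub (hbi v) (hbi u), key, key, hmax, hmax, hq, ← intervalIntegral.integral_of_le huv,
    ← intervalIntegral.integral_add_adjacent_intervals (hii y.2 u) (hii u v)]
  have e3 : (Ico u v).indicator (fun _ => (1 : ℝ)) y.2 * η y.1 =
      (if y.2 < v then η y.1 else 0) - (if y.2 < u then η y.1 else 0) := by
    simp only [indicator, mem_Ico]
    by_cases h1 : y.2 < v <;> by_cases h2 : y.2 < u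
    · simp [h1, h2]
    · simp [h1, h2, not_lt.1 h2]
    · exact absurd (h2.trans_le huv) h1
    · simp [h1, h2]
  rw [e3]
  ring

lemma ae_gradW_int {n : ℕ} (μ : Measure (Pt n)) [IsFiniteMeasure μ] :
    ∀ᵐ q : Pt n, Integrable (fun y => gradW (q - y)) μ := by
  have hm := gradW_measurable (n := n)
  have h : ∀ k : ℕ, ∀ᵐ q : Pt n, (Icc (-(k : ℝ)) k).indicator (fun _ => (1 : ENNReal)) q.2 * ∫⁻ y, ‖gradW (q - y)‖ₑ ∂μ < ⊤ := by
    intro k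
    have hi : Measurable ((Icc (-(k : ℝ)) k).indicator (fun _ => (1 : ENNReal))) := measurable_const.indicator measurableSet_Icc
    refine ae_lt_top (by fun_prop) ?_
    have e : ∫⁻ q : Pt n, (Icc (-(k : ℝ)) k).indicator (fun _ => (1 : ENNReal)) q.2 * ∫⁻ y, ‖gradW (q - y)‖ₑ ∂μ
        = ∫⁻ y, (∫⁻ q : Pt n, (Icc (-(k : ℝ)) k).indicator (fun _ => (1 : ENNReal)) q.2 * ‖gradW (q - y)‖ₑ) ∂μ := by
      rw [lintegral_lintegral_swap (Measurable.aemeasurable (by fun_prop))]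
      refine lintegral_congr fun q => ?_
      rw [lintegral_const_mul _ (by fun_prop)]
    rw [e]
    refine ne_of_lt (lt_of_le_of_lt (lintegral_mono fun y => lint_gradW_slab _ measurableSet_Icc y) ?_)
    rw [lintegral_const, Real.volume_Icc]
    exact Ne.lt_top (by finiteness)
  filter_upwards [ae_all_iff.2 h] with q hq
  obtain ⟨k, hk⟩ := exists_nat_ge |q.2|
  have := hq k
  rw [indicator_of_mem (by rw [mem_Icc]; exact abs_le.1 hk), one_mul] at this
  exact ⟨Measurable.aestronglyMeasurable (by fun_prop), this⟩

lemma meas_ind {L t0 : ℝ} : Measurable fun z : ℝ × ℝ =>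
    (Ioc (t0 - z.1 * L) (t0 + z.1 * L)).indicator (fun _ => (1 : ℝ)) z.2 := by
  have : MeasurableSet {z : ℝ × ℝ | z.2 ∈ Ioc (t0 - z.1 * L) (t0 + z.1 * L)} := by
    have h1 : MeasurableSet {z : ℝ × ℝ | t0 - z.1 * L < z.2} := measurableSet_lt (by fun_prop) (by fun_prop)
    have h2 : MeasurableSet {z : ℝ × ℝ | z.2 ≤ t0 + z.1 * L} := measurableSet_le (by fun_prop) (by fun_prop)
    exact h1.inter h2
  exact (measurable_const (a := (1 : ℝ))).indicator this

lemma meas_ind' {L t0 : ℝ} : Measurable fun z : ℝ × ℝ =>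
    (Ico (t0 - z.1 * L) (t0 + z.1 * L)).indicator (fun _ => (1 : ℝ)) z.2 := by
  have : MeasurableSet {z : ℝ × ℝ | z.2 ∈ Ico (t0 - z.1 * L) (t0 + z.1 * L)} := by
    have h1 : MeasurableSet {z : ℝ × ℝ | t0 - z.1 * L ≤ z.2} := measurableSet_le (by fun_prop) (by fun_prop)
    have h2 : MeasurableSet {z : ℝ × ℝ | z.2 < t0 + z.1 * L} := measurableSet_lt (by fun_prop) (by fun_prop)
    exact h1.inter h2
  exact (measurable_const (a := (1 : ℝ))).indicator this

lemma perY {n : ℕ} (hn : 1 ≤ n) {η : Spc n → ℝ} (hη : ContDiff ℝ 1 η) (hη1 : ∀ x, |η x| ≤ 1) {K : ℝ}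
    (hK : ∀ x, ‖fderiv ℝ η x‖ ≤ K) (y : Pt n) {L : ℝ} (hL : 0 < L) (t0 : ℝ) :
    ∫ x, η x * (∫ t, psi ((t - t0) / L) * halfT heatW ((x, t) - y)) =
      4 * bet * √L * ∫ a in Ioc (1 : ℝ) 2, ((Ico (t0 - a * L) (t0 + a * L)).indicator (fun _ => (1 : ℝ)) y.2 * η y.1 -
        ∫ q : Pt n, (Ioc (t0 - a * L) (t0 + a * L)).indicator (fun _ => (1 : ℝ)) q.2 * fderiv ℝ η q.1 (gradW (q - y))) := by
  have hm := heatW_measurable (n := n)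
  have hηc : Continuous η := hη.continuous
  have : Nonempty (Fin n) := ⟨⟨0, hn⟩⟩
  have hne : ∀ᵐ x : Spc n, x - y.1 ≠ 0 := by
    have h0 : (volume : Measure (Spc n)) {y.1} = 0 := measure_singleton _
    filter_upwards [compl_mem_ae_iff.2 h0] with x hx
    exact sub_ne_zero.2 hx
  have e1 : ∫ x, η x * (∫ t, psi ((t - t0) / L) * halfT heatW ((x, t) - y)) =
      ∫ x, 4 * bet * √L * ∫ a in Ioc (1 : ℝ) 2, η x * (heatW ((x, t0 + a * L) - y) - heatW ((x, t0 - a * L) - y)) := by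
    refine integral_congr_ae ?_
    filter_upwards [hne] with x hx
    have := heat1D hn hx hL t0 y.2
    rw [integral_const_mul]
    calc _ = η x * (∫ t, psi ((t - t0) / L) * halfT heatW (x - y.1, t - y.2)) := rfl
      _ = _ := by rw [this]; simp only [Prod.sub_def]; ring
  rw [e1, integral_const_mul]
  congr 1
  rw [integral_integral_swap]
  · refine setIntegral_congr_fun measurableSet_Ioc fun a ha => ?_
    have : 0 < a := by linarith [ha.1]
    exact Aconv hη hη1 hK y (by nlinarith)
  · have hb : ∀ σ : ℝ → ℝ, Measurable σ → Integrable (fun z : Spc n × ℝ => η z.1 * heatW ((z.1, σ z.2) - y))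
        (volume.prod (volume.restrict (Ioc (1 : ℝ) 2))) := by
      intro σ hσ
      refine Integrable.bdd_mul (c := 1) ?_ (Continuous.aestronglyMeasurable (by fun_prop)) (Filter.Eventually.of_forall fun x => hη1 _)
      refine ⟨Measurable.aestronglyMeasurable (by fun_prop), ?_⟩
      rw [hasFiniteIntegral_iff_ofReal (by filter_upwards with y using heatW_nonneg _),
        lintegral_prod_symm _ (Measurable.aemeasurable (by fun_prop))]
      refine lt_of_le_of_lt (lintegral_mono (g := fun _ => ENNReal.ofReal (√(π * 8) ^ n)) fun t => ?_) ?_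
      · simp only
        refine le_trans (le_of_eq ?_) (lint_heatW_le (n := n) (σ t - y.2))
        rw [← lintegral_sub_right_eq_self (fun x : Spc n => ENNReal.ofReal (heatW (x, σ t - y.2))) y.1]
        rfl
      · rw [lintegral_const, Measure.restrict_apply MeasurableSet.univ, univ_inter, Real.volume_Ioc]
        exact Ne.lt_top (by finiteness)
    have := (hb (fun a => t0 + a * L) (by fun_prop)).sub (hb (fun a => t0 - a * L) (by fun_prop))
    refine this.congr (Filter.Eventually.of_forall fun z => ?_)
    simp only [Function.uncurry, Pi.sub_apply]
    ring

lemma pairing_lower {n : ℕ} (hn : 1 ≤ n) (μ : Measure (Pt n)) [IsFiniteMeasure μ]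
    (hgrad : ∀ p, ‖mconvGradW μ p‖ ≤ 1) {η : Spc n → ℝ} (hη : ContDiff ℝ 1 η) (hη0 : ∀ x, 0 ≤ η x) (hη1 : ∀ x, η x ≤ 1)
    {K : ℝ} (hK : ∀ x, ‖fderiv ℝ η x‖ ≤ K) (hIgl : Integrable (fun x => ‖fderiv ℝ η x‖)) {L : ℝ} (hL : 0 < L) (t0 : ℝ)
    (S : Set (Pt n)) (hS : MeasurableSet S) (hS1 : ∀ p ∈ S, η p.1 = 1) (hS2 : ∀ p ∈ S, |p.2 - t0| < L) :
    4 * bet * √L * ((μ S).toReal - 4 * L * ∫ x, ‖fderiv ℝ η x‖) ≤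
      ∫ p : Pt n, η p.1 * psi ((p.2 - t0) / L) * halfT (mconvW μ) p := by
  have hc : Continuous (fderiv ℝ η) := hη.continuous_fderiv one_ne_zero
  have hηc : Continuous η := hη.continuous
  have hpm := psi_meas
  have hη' : ∀ x, |η x| ≤ 1 := fun x => abs_le.2 ⟨by linarith [hη0 x], hη1 x⟩
  have hm := gradW_measurable (n := n)
  have hK0 : 0 ≤ K := (norm_nonneg _).trans (hK 0)
  rw [(pairing μ η (fun t => psi ((t - t0) / L)) hηc.measurable hη' (by fun_prop) 10 (fun t => abs_psi_le _)
    ((psi_int.comp_div hL.ne').comp_sub_right t0)).2]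
  simp only [perY hn hη hη' hK _ hL t0]
  rw [integral_const_mul]
  have hb := bet_pos
  refine mul_le_mul_of_nonneg_left ?_ (by positivity)
  set ν : Measure ℝ := volume.restrict (Ioc (1 : ℝ) 2) with hν
  have hν1 : ν univ = 1 := by rw [hν, Measure.restrict_apply MeasurableSet.univ, univ_inter, Real.volume_Ioc]; norm_num
  have : IsFiniteMeasure ν := ⟨by rw [hν1]; exact ENNReal.one_lt_top⟩
  -- the big function
  set F : Pt n → ℝ × Pt n → ℝ := fun y z =>
    (Ioc (t0 - z.1 * L) (t0 + z.1 * L)).indicator (fun _ => (1 : ℝ)) z.2.2 * fderiv ℝ η z.2.1 (gradW (z.2 - y)) with hF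
  have hFm : Measurable (Function.uncurry F) := by
    simp only [hF, Function.uncurry_def]
    have h1 : Continuous fun z : (Spc n →L[ℝ] ℝ) × Spc n => z.1 z.2 := by fun_prop
    have h2 := hc.measurable
    have h4 : Measurable fun q : Pt n × ℝ × Pt n => fderiv ℝ η q.2.2.1 := by fun_prop
    have h5 : Measurable fun q : Pt n × ℝ × Pt n => gradW (q.2.2 - q.1) := by fun_prop
    have h6 := h1.measurable.comp (h4.prodMk h5)
    have h7 : Measurable fun q : Pt n × ℝ × Pt n => (q.2.1, q.2.2.2) := by fun_prop
    exact ((meas_ind (L := L) (t0 := t0)).comp h7).mul h6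
  have hsup : ∀ a ∈ Ioc (1 : ℝ) 2, ∀ s, s ∈ Ioc (t0 - a * L) (t0 + a * L) → s ∈ Icc (t0 - 2 * L) (t0 + 2 * L) := by
    intro a ha s hs
    have : a * L ≤ 2 * L := by gcongr; exact ha.2
    exact ⟨by linarith [hs.1], by linarith [hs.2]⟩
  have hFi : Integrable (Function.uncurry F) (μ.prod (ν.prod volume)) := by
    refine ⟨hFm.aestronglyMeasurable, ?_⟩
    unfold HasFiniteIntegral
    rw [lintegral_prod _ (by fun_prop)]
    refine lt_of_le_of_lt (lintegral_mono (g := fun _ => ENNReal.ofReal K * (ENNReal.ofReal (cG n) * (ENNReal.ofReal 4 + volume (Icc (t0 - 2 * L) (t0 + 2 * L))))) fun y => ?_) ?_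
    · simp only [Function.uncurry]
      rw [lintegral_prod _ (Measurable.aemeasurable (by fun_prop))]
      have : ∀ a ∈ Ioc (1 : ℝ) 2, ∫⁻ q, ‖F y (a, q)‖ₑ ≤ ENNReal.ofReal K * (ENNReal.ofReal (cG n) * (ENNReal.ofReal 4 + volume (Icc (t0 - 2 * L) (t0 + 2 * L)))) := by
        intro a ha
        refine le_trans ?_ (mul_le_mul_right (lint_gradW_slab (Icc (t0 - 2 * L) (t0 + 2 * L)) measurableSet_Icc y) _)
        rw [← lintegral_const_mul _ (by
          have hi : Measurable ((Icc (t0 - 2 * L) (t0 + 2 * L)).indicator (fun _ => (1 : ENNReal))) := measurable_const.indicator measurableSet_Icc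
          fun_prop)]
        refine lintegral_mono fun q => ?_
        simp only [hF]
        by_cases h : q.2 ∈ Ioc (t0 - a * L) (t0 + a * L)
        · rw [indicator_of_mem h, indicator_of_mem (hsup a ha _ h), one_mul, one_mul]
          rw [← ofReal_norm, ← ofReal_norm, ← ENNReal.ofReal_mul hK0]
          exact ENNReal.ofReal_le_ofReal ((ContinuousLinearMap.le_opNorm _ _).trans (by gcongr; exact hK _))
        · simp [h]
      refine (setLIntegral_mono measurable_const this).trans ?_
      rw [lintegral_const]
      simp only [← hν, hν1, mul_one, le_refl]
    · rw [lintegral_const, Real.volume_Icc]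
      exact Ne.lt_top (by finiteness)
  -- first function
  set G : Pt n → ℝ → ℝ := fun y a => (Ico (t0 - a * L) (t0 + a * L)).indicator (fun _ => (1 : ℝ)) y.2 * η y.1 with hG
  have hGm : Measurable (Function.uncurry G) := by
    simp only [hG, Function.uncurry_def]
    have h7 : Measurable fun q : Pt n × ℝ => (q.2, q.1.2) := by fun_prop
    exact ((meas_ind' (L := L) (t0 := t0)).comp h7).mul (by fun_prop)
  have hG01 : ∀ y a, 0 ≤ G y a ∧ G y a ≤ 1 := by
    intro y a
    simp only [hG, indicator]
    split_ifs
    · exact ⟨by linarith [hη0 y.1], by linarith [hη1 y.1]⟩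
    · simp
  have hGi : Integrable (Function.uncurry G) (μ.prod ν) := by
    refine Integrable.of_bound hGm.aestronglyMeasurable 1 (Filter.Eventually.of_forall fun z => ?_)
    simp only [Function.uncurry_def]
    rw [Real.norm_of_nonneg (hG01 _ _).1]; exact (hG01 _ _).2
  -- split
  have e1 : ∫ y, (∫ a, (G y a - ∫ q : Pt n, F y (a, q)) ∂ν) ∂μ =
      ∫ y, (∫ a, G y a ∂ν) ∂μ - ∫ y, (∫ z, F y z ∂(ν.prod volume)) ∂μ := by
    have hG' : Integrable (fun y => ∫ a, G y a ∂ν) μ := hGi.integral_prod_left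
    have hF' : Integrable (fun y => ∫ z, F y z ∂(ν.prod volume)) μ := hFi.integral_prod_left
    rw [← integral_sub hG' hF']
    refine integral_congr_ae ?_
    filter_upwards [hFi.prod_right_ae] with y hy
    have hGy : Integrable (G y) ν := by
      refine Integrable.of_bound (hGm.of_uncurry_left (x := y)).aestronglyMeasurable 1 (Filter.Eventually.of_forall fun z => ?_)
      rw [Real.norm_of_nonneg (hG01 _ _).1]; exact (hG01 _ _).2
    simp only [Function.uncurry] at hy ⊢
    rw [integral_sub hGy hy.integral_prod_left, integral_prod _ hy]
  change _ ≤ ∫ y, (∫ a, (G y a - ∫ q : Pt n, F y (a, q)) ∂ν) ∂μ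
  rw [e1]
  refine sub_le_sub ?_ ?_
  · have h1 : (μ S).toReal = ∫ y, S.indicator (fun _ => (1 : ℝ)) y ∂μ := by
      rw [integral_indicator_const _ hS]; simp [Measure.real]
    rw [h1]
    refine integral_mono ((integrable_const (1 : ℝ)).indicator hS) hGi.integral_prod_left fun y => ?_
    simp only
    by_cases hy : y ∈ S
    · rw [indicator_of_mem hy]
      have : ∀ a ∈ Ioc (1 : ℝ) 2, G y a = 1 := by
        intro a ha
        have h3 := abs_lt.1 (hS2 y hy)
        have h4 : 1 * L ≤ a * L := by gcongr; exact ha.1.le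
        simp only [hG]
        rw [indicator_of_mem (mem_Ico.2 ⟨by linarith [h3.1], by linarith [h3.2]⟩), hS1 y hy, one_mul]
      rw [hν, setIntegral_congr_fun measurableSet_Ioc this]
      simp; norm_num
    · rw [indicator_of_notMem hy]
      exact integral_nonneg fun a => (hG01 y a).1
  · rw [integral_integral_swap hFi]
    have hsl : Integrable (fun q : Pt n => ‖fderiv ℝ η q.1‖ * (Icc (t0 - 2 * L) (t0 + 2 * L)).indicator (fun _ => (1 : ℝ)) q.2) := by
      rw [Measure.volume_eq_prod]
      exact hIgl.mul_prod (f := fun x => ‖fderiv ℝ η x‖) (g := (Icc (t0 - 2 * L) (t0 + 2 * L)).indicator (fun _ => (1 : ℝ))) ((integrableOn_const (by rw [Real.volume_Icc]; finiteness)).integrable_indicator measurableSet_Icc)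
    have hdom := (integrable_const (μ := ν) (1 : ℝ)).mul_prod hsl
    refine (Real.le_norm_self _).trans ((norm_integral_le_of_norm_le hdom ?_).trans (le_of_eq ?_))
    · have hae : ∀ᵐ z ∂(ν.prod (volume : Measure (Pt n))), z.1 ∈ Ioc (1 : ℝ) 2 ∧ Integrable (fun y => gradW (z.2 - y)) μ := by
        have h1 : ∀ᵐ a ∂ν, a ∈ Ioc (1 : ℝ) 2 := ae_restrict_mem measurableSet_Ioc
        have h2 := ae_gradW_int μ
        exact (Measure.quasiMeasurePreserving_fst.ae h1).and (Measure.quasiMeasurePreserving_snd.ae h2)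
      filter_upwards [hae] with z hz
      rw [one_mul]
      by_cases h : z.2.2 ∈ Ioc (t0 - z.1 * L) (t0 + z.1 * L)
      · rw [indicator_of_mem (hsup _ hz.1 _ h), mul_one]
        simp only [hF, indicator_of_mem h, one_mul]
        rw [ContinuousLinearMap.integral_comp_comm _ hz.2]
        refine (ContinuousLinearMap.le_opNorm _ _).trans ?_
        exact mul_le_of_le_one_right (norm_nonneg _) (hgrad z.2)
      · simp only [hF, indicator_of_notMem h, zero_mul, integral_zero, norm_zero]
        exact mul_nonneg (norm_nonneg _) (indicator_nonneg (fun _ _ => zero_le_one) _)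
    · rw [integral_prod_mul (f := fun _ : ℝ => (1 : ℝ)) (g := fun q : Pt n => ‖fderiv ℝ η q.1‖ * (Icc (t0 - 2 * L) (t0 + 2 * L)).indicator (fun _ => (1 : ℝ)) q.2),
        Measure.volume_eq_prod, integral_prod_mul (f := fun x : Spc n => ‖fderiv ℝ η x‖) (g := (Icc (t0 - 2 * L) (t0 + 2 * L)).indicator (fun _ => (1 : ℝ))), integral_const, integral_indicator_const _ measurableSet_Icc]
      simp only [Measure.real, hν1, Real.volume_Icc]
      rw [show t0 + 2 * L - (t0 - 2 * L) = 4 * L by ring, ENNReal.toReal_ofReal (by positivity)]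
      simp; ring

lemma cube_eq {n : ℕ} (Q : PCube n) : Q.toSet =
    ((fun x : Spc n => x.ofLp) ⁻¹' (Icc Q.corner (fun i => Q.corner i + Q.len))) ×ˢ Icc Q.time (Q.time + Q.len ^ 2) := by
  ext p
  simp only [PCube.toSet, mem_ofPred_eq, mem_prod, mem_preimage, mem_Icc, Pi.le_def]
  constructor
  · rintro ⟨h1, h2⟩; exact ⟨⟨fun i => (h1 i).1, fun i => (h1 i).2⟩, h2⟩
  · rintro ⟨h1, h2⟩; exact ⟨fun i => ⟨h1.1 i, h1.2 i⟩, h2⟩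

lemma cube_meas {n : ℕ} (Q : PCube n) : MeasurableSet Q.toSet := by
  rw [cube_eq]
  refine MeasurableSet.prod ?_ measurableSet_Icc
  exact (PiLp.volume_preserving_ofLp (Fin n)).measurable measurableSet_Icc

lemma cube_vol {n : ℕ} (Q : PCube n) : volume Q.toSet = ENNReal.ofReal (Q.len ^ (n + 2)) := by
  have hl := Q.len_pos
  rw [cube_eq, Measure.volume_eq_prod, Measure.prod_prod,
    (PiLp.volume_preserving_ofLp (Fin n)).measure_preimage measurableSet_Icc.nullMeasurableSet, Real.volume_Icc_pi, Real.volume_Icc]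
  simp only [add_sub_cancel_left, Finset.prod_const, Finset.card_univ, Fintype.card_fin]
  rw [← ENNReal.ofReal_pow hl.le, ← ENNReal.ofReal_mul (by positivity)]
  congr 1; ring

lemma cube_volr {n : ℕ} (Q : PCube n) : volume.real Q.toSet = Q.len ^ (n + 2) := by
  have hl := Q.len_pos
  rw [Measure.real, cube_vol, ENNReal.toReal_ofReal (by positivity)]

lemma cube_int_const {n : ℕ} (Q : PCube n) (c : ℝ) : IntegrableOn (fun _ : Pt n => c) Q.toSet :=
  integrableOn_const (by rw [cube_vol]; exact ENNReal.ofReal_ne_top)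

lemma cube_int_abs {n : ℕ} {b : Pt n → ℝ} (hb : ∀ Q : PCube n, IntegrableOn b Q.toSet) (Q : PCube n) (c : ℝ) :
    IntegrableOn (fun p => |b p - c|) Q.toSet := ((hb Q).sub (cube_int_const Q c)).abs

lemma bmo_int {n : ℕ} {b : Pt n → ℝ} (h : ParabBMOLe b 1) (Q : PCube n) :
    ∫ p in Q.toSet, |b p - ⨍ q in Q.toSet, b q| ≤ Q.len ^ (n + 2) := by
  have h1 := h Q
  have hl := Q.len_pos
  rw [setAverage_eq, cube_volr, smul_eq_mul, inv_mul_le_iff₀ (by positivity), mul_one] at h1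
  exact h1

lemma avg_sub_le {n : ℕ} {b : Pt n → ℝ} (hb : ∀ Q : PCube n, IntegrableOn b Q.toSet) (Q : PCube n) (c : ℝ) :
    |(⨍ q in Q.toSet, b q) - c| ≤ (Q.len ^ (n + 2))⁻¹ * ∫ p in Q.toSet, |b p - c| := by
  have hl := Q.len_pos
  have e : (⨍ q in Q.toSet, b q) - c = (Q.len ^ (n + 2))⁻¹ * ∫ p in Q.toSet, (b p - c) := by
    rw [integral_sub (hb Q) (cube_int_const Q c), setAverage_eq, cube_volr, setIntegral_const, cube_volr, smul_eq_mul, smul_eq_mul]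
    field_simp
  rw [e, abs_mul, abs_of_pos (by positivity)]
  gcongr
  exact abs_integral_le_integral_abs

lemma parent {n : ℕ} {b : Pt n → ℝ} (hb : ∀ Q : PCube n, IntegrableOn b Q.toSet) (h : ParabBMOLe b 1) {Q P : PCube n}
    (hQP : Q.toSet ⊆ P.toSet) (hl : P.len = 2 * Q.len) :
    |(⨍ q in Q.toSet, b q) - ⨍ q in P.toSet, b q| ≤ 2 ^ (n + 2) := by
  have hp := Q.len_pos
  refine (avg_sub_le hb Q _).trans ?_
  rw [inv_mul_le_iff₀ (by positivity)]
  calc _ ≤ ∫ p in P.toSet, |b p - ⨍ q in P.toSet, b q| := by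
        refine setIntegral_mono_set ?_ (Filter.Eventually.of_forall fun _ => abs_nonneg _) hQP.eventuallyLE
        exact ((hb P).sub (cube_int_const P _)).abs
    _ ≤ P.len ^ (n + 2) := bmo_int h P
    _ = _ := by rw [hl, mul_pow]; ring

lemma cube_sub {n : ℕ} (Q P : PCube n) (hc : Q.corner = P.corner) (hl : Q.len ≤ P.len) (ht : P.time ≤ Q.time)
    (ht2 : Q.time + Q.len ^ 2 ≤ P.time + P.len ^ 2) : Q.toSet ⊆ P.toSet := by
  rintro p ⟨h1, h2⟩
  refine ⟨fun i => ?_, ?_⟩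
  · have := h1 i
    rw [hc] at this
    exact ⟨this.1, by linarith [this.2]⟩
  · exact ⟨by linarith [h2.1], by linarith [h2.2]⟩

lemma chain {n : ℕ} {b : Pt n → ℝ} (hb : ∀ Q : PCube n, IntegrableOn b Q.toSet) (h : ParabBMOLe b 1)
    (c : Fin n → ℝ) (s l : ℝ) (hl : 0 < l) (k : ℕ) :
    |(⨍ q in (PCube.mk c s l hl).toSet, b q) - ⨍ q in (PCube.mk c s (2 ^ k * l) (by positivity)).toSet, b q| ≤ k * 2 ^ (n + 2) := by
  induction k with
  | zero => simp
  | succ k ih =>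
    have h1 := parent hb h (Q := PCube.mk c s (2 ^ k * l) (by positivity)) (P := PCube.mk c s (2 ^ (k + 1) * l) (by positivity))
      (cube_sub _ _ rfl (by simp only; gcongr <;> norm_num) le_rfl (by simp only; gcongr <;> norm_num)) (by simp only; ring)
    refine (abs_sub_le _ _ _).trans ((add_le_add ih h1).trans (le_of_eq ?_))
    push_cast; ring

lemma shift_avg {n : ℕ} {b : Pt n → ℝ} (hb : ∀ Q : PCube n, IntegrableOn b Q.toSet) (h : ParabBMOLe b 1)
    (c : Fin n → ℝ) (s l : ℝ) (hl : 0 < l) (k : ℕ) (u : ℝ) (hu : |u| ≤ 4 ^ k * l ^ 2) :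
    |(⨍ q in (PCube.mk c (s + u) l hl).toSet, b q) - ⨍ q in (PCube.mk c s l hl).toSet, b q| ≤ (2 * k + 2) * 2 ^ (n + 2) := by
  have h0 : 0 < 2 ^ k * l := by positivity
  have h1 := chain hb h c (s + u) l hl k
  have h2 := chain hb h c s l hl k
  have hu' := abs_le.1 hu
  have e1 : (2 ^ k * l) ^ 2 = 4 ^ k * l ^ 2 := by rw [mul_pow, ← pow_mul, mul_comm k 2, pow_mul]; norm_num
  have e2 : (2 * (2 ^ k * l)) ^ 2 = 4 * (4 ^ k * l ^ 2) := by rw [mul_pow, e1]; norm_num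
  have hm := min_le_left s (s + u)
  have hm2 := min_le_right s (s + u)
  have hm3 : s + u - 4 ^ k * l ^ 2 ≤ min s (s + u) := le_min (by linarith) (by linarith [abs_nonneg u])
  have hm4 : s - 4 ^ k * l ^ 2 ≤ min s (s + u) := le_min (by linarith [abs_nonneg u]) (by linarith)
  have h3 := parent hb h (Q := PCube.mk c (s + u) (2 ^ k * l) h0) (P := PCube.mk c (min s (s + u)) (2 * (2 ^ k * l)) (by positivity))
      (cube_sub _ _ rfl (by simp only; linarith) hm2 (by simp only [e1, e2]; linarith [abs_nonneg u])) rfl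
  have h4 := parent hb h (Q := PCube.mk c s (2 ^ k * l) h0) (P := PCube.mk c (min s (s + u)) (2 * (2 ^ k * l)) (by positivity))
      (cube_sub _ _ rfl (by simp only; linarith) hm (by simp only [e1, e2]; linarith [abs_nonneg u])) rfl
  rw [abs_le] at h1 h2 h3 h4 ⊢
  constructor <;> linarith [h1.1, h1.2, h2.1, h2.2, h3.1, h3.2, h4.1, h4.2]

lemma shift_int {n : ℕ} {b : Pt n → ℝ} (hb : ∀ Q : PCube n, IntegrableOn b Q.toSet) (h : ParabBMOLe b 1)
    (c : Fin n → ℝ) (s l : ℝ) (hl : 0 < l) (j : ℤ) :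
    ∫ p in (PCube.mk c (s + j * l ^ 2) l hl).toSet, |b p - ⨍ q in (PCube.mk c s l hl).toSet, b q| ≤
      l ^ (n + 2) * (13 * 2 ^ (n + 2) * (1 + |(j : ℝ)|) ^ (1 / 4 : ℝ)) := by
  set k := ⌈Real.log (1 + |(j : ℝ)|)⌉₊ with hk
  have hj := abs_nonneg (j : ℝ)
  have hk1 : Real.log (1 + |(j : ℝ)|) ≤ k := Nat.le_ceil _
  have hk2 : (k : ℝ) ≤ Real.log (1 + |(j : ℝ)|) + 1 := (Nat.ceil_lt_add_one (Real.log_nonneg (by linarith))).le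
  have h4 : 1 + |(j : ℝ)| ≤ 4 ^ k := by
    rw [← Real.log_le_log_iff (by positivity) (by positivity), Real.log_pow]
    refine hk1.trans (le_mul_of_one_le_right (by positivity) ?_)
    rw [show (4 : ℝ) = 2 ^ 2 by norm_num, Real.log_pow]
    have := Real.log_two_gt_d9
    push_cast; linarith
  have hone : (1 : ℝ) ≤ (1 + |(j : ℝ)|) ^ (1 / 4 : ℝ) := Real.one_le_rpow (by linarith) (by norm_num)
  have hlog := Real.log_le_rpow_div (x := 1 + |(j : ℝ)|) (ε := 1 / 4) (by positivity) (by norm_num)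
  have hk3 : (2 * k + 3 : ℝ) ≤ 13 * (1 + |(j : ℝ)|) ^ (1 / 4 : ℝ) := by linarith
  have hu : |(j : ℝ) * l ^ 2| ≤ 4 ^ k * l ^ 2 := by
    rw [abs_mul, abs_of_pos (by positivity : 0 < l ^ 2)]; gcongr; linarith
  have hs := shift_avg hb h c s l hl k (j * l ^ 2) hu
  set Q := PCube.mk c (s + j * l ^ 2) l hl with hQ
  set m := ⨍ q in (PCube.mk c s l hl).toSet, b q
  calc ∫ p in Q.toSet, |b p - m| ≤ ∫ p in Q.toSet, (|b p - ⨍ q in Q.toSet, b q| + |(⨍ q in Q.toSet, b q) - m|) := by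
        refine setIntegral_mono ((hb Q).sub (cube_int_const Q _)).abs (((hb Q).sub (cube_int_const Q _)).abs.add (cube_int_const Q _)) fun p => ?_
        exact abs_sub_le _ _ _
    _ = (∫ p in Q.toSet, |b p - ⨍ q in Q.toSet, b q|) + l ^ (n + 2) * |(⨍ q in Q.toSet, b q) - m| := by
        rw [integral_add (cube_int_abs hb Q _) (cube_int_const Q _), setIntegral_const, cube_volr, smul_eq_mul]
    _ ≤ l ^ (n + 2) + l ^ (n + 2) * ((2 * k + 2) * 2 ^ (n + 2)) := by
        gcongr
        exact bmo_int h Q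
    _ = l ^ (n + 2) * (1 + (2 * k + 2) * 2 ^ (n + 2)) := by ring
    _ ≤ l ^ (n + 2) * ((2 * k + 3) * 2 ^ (n + 2)) := by
        gcongr
        have : (1 : ℝ) ≤ 2 ^ (n + 2) := one_le_pow₀ (by norm_num)
        linarith
    _ ≤ l ^ (n + 2) * (13 * (1 + |(j : ℝ)|) ^ (1 / 4 : ℝ) * 2 ^ (n + 2)) := by gcongr
    _ = _ := by ring

lemma psi_j (u : ℝ) (j : ℤ) (h1 : 16 * (j : ℝ) ≤ u) (h2 : u ≤ 16 * (j + 1)) :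
    |psi u| ≤ 90 * (1 + |(j : ℝ)|) ^ (-(3 / 2) : ℝ) := by
  have hj : 16 * (|(j : ℝ)| - 1) ≤ |u| := by
    rcases abs_cases (j : ℝ) with h | h <;> rcases abs_cases u with h' | h' <;> rw [h.1, h'.1] <;> linarith
  rw [Real.rpow_neg (by positivity), ← div_eq_mul_inv, le_div_iff₀ (by positivity)]
  have e : (1 + |(j : ℝ)|) ^ (3 / 2 : ℝ) = (1 + |(j : ℝ)|) * √(1 + |(j : ℝ)|) := by
    have := rpow_three_half (1 + |(j : ℝ)|)
    rwa [abs_of_pos (by positivity)] at this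
  rw [e]
  have hd := psi_decay u
  have h10 := abs_psi_le u
  have hp := abs_nonneg (psi u)
  by_cases hu : |u| ≤ 32
  · have h3 : 1 + |(j : ℝ)| ≤ 4 := by linarith
    have h4 : √(1 + |(j : ℝ)|) ≤ 2 := by
      rw [show (2 : ℝ) = √4 by rw [show (4 : ℝ) = 2 ^ 2 by norm_num]; simp]
      exact Real.sqrt_le_sqrt h3
    calc |psi u| * ((1 + |(j : ℝ)|) * √(1 + |(j : ℝ)|)) ≤ 10 * (4 * 2) := by gcongr
      _ ≤ 90 := by norm_num
  · push Not at hu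
    have h3 : 1 + |(j : ℝ)| ≤ |u| := by linarith
    calc _ ≤ |psi u| * (|u| * √|u|) := by gcongr
      _ ≤ |psi u| * (1 + |u| * √|u|) := by gcongr; linarith
      _ ≤ 90 := hd

lemma sum_j : Summable fun j : ℤ => (1 + |(j : ℝ)|) ^ (-(5 / 4) : ℝ) := by
  have h1 := Real.summable_abs_int_rpow (b := 5 / 4) (by norm_num)
  have h2 : Summable fun j : ℤ => |(j : ℝ)| ^ (-(5 / 4) : ℝ) + (if j = 0 then 1 else 0) :=
    h1.add (summable_of_hasFiniteSupport (Set.Finite.subset (Set.finite_singleton (0 : ℤ)) (by intro j; simp)))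
  refine Summable.of_nonneg_of_le (fun j => by positivity) (fun j => ?_) h2
  by_cases hj : j = 0
  · simp [hj]
  · rw [if_neg hj, add_zero]
    have : (0 : ℝ) < |(j : ℝ)| := abs_pos.2 (by exact_mod_cast hj)
    exact Real.rpow_le_rpow_of_nonpos this (by linarith) (by norm_num)

/-- the constant for pairing BMO functions -/
def cB (n : ℕ) : ℝ := 90 * (13 * 2 ^ (n + 2)) * ∑' j : ℤ, (1 + |(j : ℝ)|) ^ (-(5 / 4) : ℝ)

lemma cB_nonneg (n : ℕ) : 0 ≤ cB n := by
  unfold cB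
  have : 0 ≤ ∑' j : ℤ, (1 + |(j : ℝ)|) ^ (-(5 / 4) : ℝ) := tsum_nonneg fun j => by positivity
  positivity

lemma bmo_pair {n : ℕ} {b : Pt n → ℝ} (hb : ∀ Q : PCube n, IntegrableOn b Q.toSet) (h : ParabBMOLe b 1)
    (c : Fin n → ℝ) (t0 r : ℝ) (hr : 0 < r) {η : Spc n → ℝ} (hη : Measurable η) (hη1 : ∀ x, |η x| ≤ 1)
    (hηi : Integrable η) (hηs : ∀ x, η x ≠ 0 → ∀ i, x i ∈ Icc (c i) (c i + 4 * r))
    (hi : Integrable (fun p : Pt n => η p.1 * psi ((p.2 - t0) / r ^ 2) * b p)) :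
    |∫ p : Pt n, η p.1 * psi ((p.2 - t0) / r ^ 2) * b p| ≤ cB n * (4 * r) ^ (n + 2) := by
  have hl : 0 < 4 * r := by positivity
  have hr2 : 0 < r ^ 2 := by positivity
  have hpm := psi_meas
  set m := ⨍ q in (PCube.mk c t0 (4 * r) hl).toSet, b q with hm
  have hψi : Integrable (fun t => psi ((t - t0) / r ^ 2)) := (psi_int.comp_div hr2.ne').comp_sub_right t0
  have hψ0 : ∫ t, psi ((t - t0) / r ^ 2) = 0 := by
    have h1 := integral_sub_right_eq_self (μ := (volume : Measure ℝ)) (fun t => psi (t / r ^ 2)) t0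
    rw [h1, Measure.integral_comp_div, psi_integral, smul_zero]
  have hprod : Integrable (fun p : Pt n => η p.1 * psi ((p.2 - t0) / r ^ 2)) := by
    rw [Measure.volume_eq_prod]; exact hηi.mul_prod hψi
  have hz : ∫ p : Pt n, η p.1 * psi ((p.2 - t0) / r ^ 2) = 0 := by
    rw [Measure.volume_eq_prod, integral_prod_mul η (fun t => psi ((t - t0) / r ^ 2)), hψ0, mul_zero]
  have e1 : ∫ p : Pt n, η p.1 * psi ((p.2 - t0) / r ^ 2) * b p = ∫ p : Pt n, η p.1 * psi ((p.2 - t0) / r ^ 2) * (b p - m) := by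
    simp only [mul_sub]
    rw [integral_sub hi (hprod.mul_const m), integral_mul_const, hz]; ring
  rw [e1]
  have hcov : (Function.support fun p : Pt n => ‖η p.1 * psi ((p.2 - t0) / r ^ 2) * (b p - m)‖ₑ) ⊆
      ⋃ j : ℤ, (PCube.mk c (t0 + j * (4 * r) ^ 2) (4 * r) hl).toSet := by
    intro p hp
    have hp1 : η p.1 ≠ 0 := by
      intro h0; apply hp; simp [h0]
    rw [mem_iUnion]
    refine ⟨⌊(p.2 - t0) / (4 * r) ^ 2⌋, hηs _ hp1, ?_⟩
    have h1 := Int.floor_le ((p.2 - t0) / (4 * r) ^ 2)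
    have h2 := Int.lt_floor_add_one ((p.2 - t0) / (4 * r) ^ 2)
    rw [le_div_iff₀ (by positivity)] at h1
    rw [div_lt_iff₀ (by positivity)] at h2
    exact ⟨by simp only; linarith, by simp only; linarith⟩
  have hbound : ∫⁻ p : Pt n, ‖η p.1 * psi ((p.2 - t0) / r ^ 2) * (b p - m)‖ₑ ≤ ENNReal.ofReal (cB n * (4 * r) ^ (n + 2)) := by
    rw [← setLIntegral_eq_of_support_subset hcov]
    refine (lintegral_iUnion_le _ _).trans ?_
    have hterm : ∀ j : ℤ, ∫⁻ p in (PCube.mk c (t0 + j * (4 * r) ^ 2) (4 * r) hl).toSet, ‖η p.1 * psi ((p.2 - t0) / r ^ 2) * (b p - m)‖ₑ ≤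
        ENNReal.ofReal ((90 * (13 * 2 ^ (n + 2)) * (4 * r) ^ (n + 2)) * (1 + |(j : ℝ)|) ^ (-(5 / 4) : ℝ)) := by
      intro j
      set Q := PCube.mk c (t0 + j * (4 * r) ^ 2) (4 * r) hl with hQ
      have hj : (0 : ℝ) < 1 + |(j : ℝ)| := by positivity
      calc _ ≤ ∫⁻ p in Q.toSet, ENNReal.ofReal (90 * (1 + |(j : ℝ)|) ^ (-(3 / 2) : ℝ)) * ENNReal.ofReal |b p - m| := by
            refine setLIntegral_mono' (cube_meas Q) fun p hp => ?_
            rw [← ENNReal.ofReal_mul (by positivity), ← ofReal_norm]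
            refine ENNReal.ofReal_le_ofReal ?_
            rw [norm_mul, norm_mul, Real.norm_eq_abs, Real.norm_eq_abs, Real.norm_eq_abs]
            refine mul_le_mul_of_nonneg_right ?_ (abs_nonneg _)
            have hp2 := hp.2
            simp only [hQ, mem_Icc] at hp2
            have := psi_j ((p.2 - t0) / r ^ 2) j (by rw [le_div_iff₀ hr2]; nlinarith [hp2.1]) (by rw [div_le_iff₀ hr2]; nlinarith [hp2.2])
            calc _ ≤ 1 * |psi ((p.2 - t0) / r ^ 2)| := by gcongr; exact hη1 _
              _ ≤ _ := by rw [one_mul]; exact this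
        _ = ENNReal.ofReal (90 * (1 + |(j : ℝ)|) ^ (-(3 / 2) : ℝ)) * ENNReal.ofReal (∫ p in Q.toSet, |b p - m|) := by
            rw [lintegral_const_mul' _ _ ENNReal.ofReal_ne_top, ofReal_integral_eq_lintegral_ofReal (cube_int_abs hb Q _)
              (Filter.Eventually.of_forall fun p => abs_nonneg _)]
        _ ≤ ENNReal.ofReal (90 * (1 + |(j : ℝ)|) ^ (-(3 / 2) : ℝ)) *
            ENNReal.ofReal ((4 * r) ^ (n + 2) * (13 * 2 ^ (n + 2) * (1 + |(j : ℝ)|) ^ (1 / 4 : ℝ))) := by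
            gcongr; exact shift_int hb h c t0 (4 * r) hl j
        _ = _ := by
            rw [← ENNReal.ofReal_mul (by positivity)]
            congr 1
            have : (1 + |(j : ℝ)|) ^ (-(5 / 4) : ℝ) = (1 + |(j : ℝ)|) ^ (-(3 / 2) : ℝ) * (1 + |(j : ℝ)|) ^ (1 / 4 : ℝ) := by
              rw [← Real.rpow_add hj]; norm_num
            rw [this]; ring
    refine (ENNReal.tsum_le_tsum hterm).trans (le_of_eq ?_)
    rw [← ENNReal.ofReal_tsum_of_nonneg (fun j => by positivity) (sum_j.mul_left _), tsum_mul_left]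
    congr 1
    unfold cB; ring
  have h3 := ENNReal.toReal_mono ENNReal.ofReal_ne_top hbound
  rw [ENNReal.toReal_ofReal (mul_nonneg (cB_nonneg n) (by positivity))] at h3
  refine le_trans ?_ h3
  have := norm_integral_le_lintegral_norm (μ := (volume : Measure (Pt n))) (fun p : Pt n => η p.1 * psi ((p.2 - t0) / r ^ 2) * (b p - m))
  simpa only [ofReal_norm, Real.norm_eq_abs (∫ _, _)] using this

lemma halfT_cube_int {n : ℕ} (μ : Measure (Pt n)) [IsFiniteMeasure μ] (Q : PCube n) :
    IntegrableOn (halfT (mconvW μ)) Q.toSet := by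
  have h := (pairing μ (fun _ => 1) ((Icc Q.time (Q.time + Q.len ^ 2)).indicator fun _ => (1 : ℝ)) measurable_const
    (fun _ => by simp) (measurable_const.indicator measurableSet_Icc) 1
    (fun t => by by_cases h : t ∈ Icc Q.time (Q.time + Q.len ^ 2) <;> simp only [h, indicator_of_mem, indicator_of_notMem, not_false_eq_true] <;> simp)
    ((integrableOn_const (by rw [Real.volume_Icc]; finiteness)).integrable_indicator measurableSet_Icc)).1
  refine (h.integrableOn (s := Q.toSet)).congr_fun (fun p hp => ?_) (cube_meas Q)
  simp only
  rw [indicator_of_mem hp.2]; ring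

lemma pball_meas {n : ℕ} (c : Pt n) (r : ℝ) : MeasurableSet (pball c r) := by
  have h : Continuous fun p : Pt n => pnorm (p - c) := by unfold pnorm; fun_prop
  exact measurableSet_lt h.measurable measurable_const

/-- the model bump -/
def bump (n : ℕ) : ContDiffBump (0 : Spc n) := ⟨1, 2, one_pos, one_lt_two⟩

lemma bump_fderiv (n : ℕ) : Continuous (fderiv ℝ (bump n)) ∧ HasCompactSupport (fderiv ℝ (bump n)) :=
  ⟨((bump n).contDiff (n := 1)).continuous_fderiv one_ne_zero, (bump n).hasCompactSupport.fderiv (𝕜 := ℝ)⟩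

/-- integral of the gradient of the model bump -/
def cI (n : ℕ) : ℝ := ∫ x, ‖fderiv ℝ (bump n) x‖

lemma cI_nonneg (n : ℕ) : 0 ≤ cI n := integral_nonneg fun _ => norm_nonneg _

/-- growth constant -/
def cGr (n : ℕ) : ℝ := 1 + 4 * cI n + cB n * 4 ^ (n + 2) / (4 * bet)

lemma one_le_cGr (n : ℕ) : 1 ≤ cGr n := by
  unfold cGr
  have := cI_nonneg n
  have := cB_nonneg n
  have := bet_pos
  have : 0 ≤ cB n * 4 ^ (n + 2) / (4 * bet) := by positivity
  linarith

lemma growth {n : ℕ} (hn : 1 ≤ n) (μ : Measure (Pt n)) [IsFiniteMeasure μ]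
    (hgrad : ∀ p, ‖mconvGradW μ p‖ ≤ 1) (hB : ParabBMOLe (halfT (mconvW μ)) 1) (c : Pt n) (r : ℝ) (hr : 0 < r) :
    μ (pball c r) ≤ ENNReal.ofReal (cGr n * r ^ (n + 1)) := by
  obtain ⟨hfc, hfs⟩ := bump_fderiv n
  set η : Spc n → ℝ := fun x => bump n (r⁻¹ • (x - c.1)) with hη
  have hηd : ContDiff ℝ 1 η := by
    have h1 : ContDiff ℝ 1 (bump n) := (bump n).contDiff
    exact h1.comp (by fun_prop)
  have hη0 : ∀ x, 0 ≤ η x := fun x => (bump n).nonneg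
  have hη1 : ∀ x, η x ≤ 1 := fun x => (bump n).le_one
  have hη' : ∀ x, |η x| ≤ 1 := fun x => abs_le.2 ⟨by linarith [hη0 x], hη1 x⟩
  have hfd : ∀ x, fderiv ℝ η x = r⁻¹ • fderiv ℝ (bump n) (r⁻¹ • (x - c.1)) := by
    intro x
    have h1 : HasFDerivAt (bump n : Spc n → ℝ) (fderiv ℝ (bump n) (r⁻¹ • (x - c.1))) (r⁻¹ • (x - c.1)) :=
      (((bump n).contDiff (n := 1)).differentiable one_ne_zero).differentiableAt.hasFDerivAt
    have h2 : HasFDerivAt (fun x : Spc n => r⁻¹ • (x - c.1)) (r⁻¹ • ContinuousLinearMap.id ℝ (Spc n)) x :=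
      ((hasFDerivAt_id x).sub_const c.1).const_smul r⁻¹
    have h3 := (h1.comp x h2).fderiv
    have h4 : fderiv ℝ η x = _ := h3
    rw [h4]
    ext v; simp
  obtain ⟨K, hK⟩ := hfs.exists_bound_of_continuous hfc
  have hKη : ∀ x, ‖fderiv ℝ η x‖ ≤ r⁻¹ * K := by
    intro x
    rw [hfd, norm_smul, Real.norm_of_nonneg (by positivity)]
    gcongr; exact hK _
  have hfi : Integrable (fun x => ‖fderiv ℝ (bump n) x‖) := (hfc.integrable_of_hasCompactSupport hfs).norm
  have hηi : Integrable (fun x => ‖fderiv ℝ η x‖) := by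
    have h1 := ((hfi.comp_smul (inv_ne_zero hr.ne')).comp_sub_right c.1).const_mul (r⁻¹)
    refine h1.congr (Filter.Eventually.of_forall fun x => ?_)
    simp only
    rw [hfd, norm_smul, Real.norm_of_nonneg (by positivity : 0 ≤ r⁻¹)]
  have hI : ∫ x, ‖fderiv ℝ η x‖ = r ^ n * r⁻¹ * cI n := by
    rw [int_scale hr _ c.1, cI, ← integral_const_mul]
    refine integral_congr_ae (Filter.Eventually.of_forall fun x => ?_)
    simp only
    rw [hfd, norm_smul, Real.norm_of_nonneg (by positivity : 0 ≤ r⁻¹), add_sub_cancel_left, smul_smul, inv_mul_cancel₀ hr.ne', one_smul]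
    ring
  have hηint : Integrable η :=
    (((bump n).continuous.integrable_of_hasCompactSupport (bump n).hasCompactSupport).comp_smul (inv_ne_zero hr.ne')).comp_sub_right c.1
  have hL : 0 < r ^ 2 := by positivity
  have hpm := psi_meas
  have hpi := (pairing μ η (fun t => psi ((t - c.2) / r ^ 2)) hηd.continuous.measurable hη' (by fun_prop) 10 (fun t => abs_psi_le _)
    ((psi_int.comp_div hL.ne').comp_sub_right c.2)).1
  have hlow := pairing_lower hn μ hgrad hηd hη0 hη1 hKη hηi hL c.2 (pball c r) (pball_meas c r) (by
      intro p hp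
      have h1 : ‖p.1 - c.1‖ < r := lt_of_le_of_lt (le_max_left _ _) hp
      refine (bump n).one_of_mem_closedBall ?_
      rw [mem_closedBall_zero_iff, norm_smul, norm_inv, Real.norm_of_nonneg hr.le]
      change r⁻¹ * ‖p.1 - c.1‖ ≤ 1
      rw [inv_mul_le_iff₀ hr]; linarith) (by
      intro p hp
      have h1 : √|p.2 - c.2| < r := lt_of_le_of_lt (le_max_right _ _) hp
      rwa [Real.sqrt_lt' hr] at h1)
  have hup := bmo_pair (halfT_cube_int μ) hB (fun i => c.1 i - 2 * r) c.2 r hr hηd.continuous.measurable hη' hηint (by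
      intro x hx i
      have h1 : r⁻¹ • (x - c.1) ∈ Function.support (bump n) := hx
      rw [(bump n).support_eq, mem_ball_zero_iff, norm_smul, norm_inv, Real.norm_of_nonneg hr.le] at h1
      change r⁻¹ * ‖x - c.1‖ < 2 at h1
      rw [inv_mul_lt_iff₀ hr] at h1
      have h2 := (PiLp.norm_apply_le (x - c.1) i).trans h1.le
      rw [Real.norm_eq_abs, abs_le] at h2
      simp only [PiLp.sub_apply] at h2
      exact ⟨by linarith [h2.1], by linarith [h2.2]⟩) hpi
  have h3 := hlow.trans ((le_abs_self _).trans hup)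
  rw [Real.sqrt_sq hr.le, hI] at h3
  have hb := bet_pos
  rw [ENNReal.le_ofReal_iff_toReal_le (measure_ne_top _ _) (mul_nonneg (by linarith [one_le_cGr n]) (by positivity))]
  have h4 : (μ (pball c r)).toReal ≤ 4 * r ^ 2 * (r ^ n * r⁻¹ * cI n) + cB n * (4 * r) ^ (n + 2) / (4 * bet * r) := by
    rw [← sub_le_iff_le_add', le_div_iff₀ (by positivity)]; linarith
  refine h4.trans ?_
  have e : 4 * r ^ 2 * (r ^ n * r⁻¹ * cI n) + cB n * (4 * r) ^ (n + 2) / (4 * bet * r) = (4 * cI n + cB n * 4 ^ (n + 2) / (4 * bet)) * r ^ (n + 1) := by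
    field_simp; ring
  rw [e]
  gcongr
  unfold cGr
  linarith

lemma pnorm_neg {n : ℕ} (p : Pt n) : pnorm (-p) = pnorm p := by
  unfold pnorm; simp [abs_neg]

lemma pnorm_sub_comm {n : ℕ} (p q : Pt n) : pnorm (p - q) = pnorm (q - p) := by
  rw [← pnorm_neg, neg_sub]

lemma pnorm_cont {n : ℕ} : Continuous (pnorm : Pt n → ℝ) := by unfold pnorm; fun_prop

lemma sqrt_abs_add_le (a b : ℝ) : √|a + b| ≤ √|a| + √|b| := by
  refine (Real.sqrt_le_sqrt (abs_add_le a b)).trans ?_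
  rw [Real.sqrt_le_left (by positivity)]
  have h1 := Real.sq_sqrt (abs_nonneg a)
  have h2 := Real.sq_sqrt (abs_nonneg b)
  nlinarith [mul_nonneg (Real.sqrt_nonneg |a|) (Real.sqrt_nonneg |b|)]

lemma pnorm_add_le {n : ℕ} (p q : Pt n) : pnorm (p + q) ≤ pnorm p + pnorm q := by
  refine max_le ?_ ?_
  · exact (norm_add_le _ _).trans (add_le_add (norm_le_pnorm p) (norm_le_pnorm q))
  · exact (sqrt_abs_add_le _ _).trans (add_le_add (sqrt_le_pnorm p) (sqrt_le_pnorm q))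

lemma heatW_le_pnorm {n : ℕ} (hn : 1 ≤ n) (p : Pt n) : heatW p ≤ cM n * (pnorm p ^ n)⁻¹ := by
  have h := heatW_pnorm p 0
  simp only [mul_zero, add_zero, pow_zero, mul_one] at h
  rcases (pnorm_nonneg p).eq_or_lt with h0 | h0
  · have h2 : √|p.2| = 0 := le_antisymm (h0 ▸ sqrt_le_pnorm p) (Real.sqrt_nonneg _)
    rw [Real.sqrt_eq_zero (abs_nonneg _), abs_eq_zero] at h2
    rw [heatW_of_nonpos h2.le, ← h0, zero_pow (by omega)]; simp
  · rw [← div_eq_mul_inv, le_div_iff₀ (by positivity), mul_comm]; exact h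

/-- far constant -/
def cF (n : ℕ) : ℝ := ((n : ℝ) / 2 + 2) * cM (n + 2) * 2 ^ (n + 2)
lemma cF_pos (n : ℕ) : 0 < cF n := by unfold cF; have := cM_pos (n + 2); positivity

lemma heatW_far {n : ℕ} (q : Pt n) (h : ℝ) (hq : 0 < pnorm q) (hh : 2 * √|h| ≤ pnorm q) :
    |heatW (q.1, q.2 + h) - heatW q| ≤ cF n * |h| * (pnorm q ^ (n + 2))⁻¹ := by
  have hp : ∀ σ ∈ uIcc q.2 (q.2 + h), pnorm q / 2 ≤ pnorm (q.1, σ) := by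
    intro σ hσ
    have h1 : |q.2 - σ| ≤ |h| := by
      have := abs_sub_left_of_mem_uIcc hσ
      rw [abs_sub_comm]; simpa using this
    have h2 : pnorm q ≤ pnorm (q.1, σ) + pnorm ((0, q.2 - σ) : Pt n) := by
      have := pnorm_add_le (q.1, σ) ((0, q.2 - σ) : Pt n)
      simpa using this
    have h3 : pnorm ((0, q.2 - σ) : Pt n) ≤ √|h| := by
      unfold pnorm; simp only [norm_zero]
      exact max_le (Real.sqrt_nonneg _) (Real.sqrt_le_sqrt h1)
    linarith
  have hd : ∀ σ ∈ uIcc q.2 (q.2 + h), HasDerivWithinAt (fun s => heatW (q.1, s)) (dtW (q.1, σ)) (uIcc q.2 (q.2 + h)) σ := by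
    intro σ hσ
    refine (heatW_hasDerivAt q.1 σ ?_).hasDerivWithinAt
    by_contra hc
    push Not at hc
    have := hp σ hσ
    rw [hc.1, hc.2] at this
    unfold pnorm at this hq
    simp at this
    linarith
  have hb : ∀ σ ∈ uIcc q.2 (q.2 + h), ‖dtW (q.1, σ)‖ ≤ cF n * (pnorm q ^ (n + 2))⁻¹ := by
    intro σ hσ
    have h1 := hp σ hσ
    have h2 := dtW_pnorm (q.1, σ)
    rw [Real.norm_eq_abs, ← div_eq_mul_inv, le_div_iff₀ (by positivity)]
    have h3 : pnorm q ^ (n + 2) ≤ 2 ^ (n + 2) * pnorm (q.1, σ) ^ (n + 2) := by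
      rw [← mul_pow]; gcongr; linarith
    calc _ ≤ |dtW (q.1, σ)| * (2 ^ (n + 2) * pnorm (q.1, σ) ^ (n + 2)) := by gcongr
      _ = (pnorm (q.1, σ) ^ (n + 2) * |dtW (q.1, σ)|) * 2 ^ (n + 2) := by ring
      _ ≤ (((n : ℝ) / 2 + 2) * cM (n + 2)) * 2 ^ (n + 2) := by gcongr
      _ = cF n := rfl
  have := (convex_uIcc q.2 (q.2 + h)).norm_image_sub_le_of_norm_hasDerivWithin_le hd hb left_mem_uIcc right_mem_uIcc
  rw [Real.norm_eq_abs, Real.norm_eq_abs, add_sub_cancel_left] at this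
  calc _ ≤ _ := this
    _ = _ := by ring

lemma growth_near {n : ℕ} (hn : 1 ≤ n) {μ : Measure (Pt n)} (hg : PGrowth μ) (p : Pt n) {r : ℝ} (hr : 0 < r) :
    ∫⁻ y in {y | pnorm (p - y) < r}, ENNReal.ofReal ((pnorm (p - y) ^ n)⁻¹) ∂μ ≤ ENNReal.ofReal (4 ^ (n + 2) * r) := by
  have hpc := pnorm_cont (n := n)
  set f : Pt n → ENNReal := fun y => ENNReal.ofReal ((pnorm (p - y) ^ n)⁻¹) with hf
  have hms : MeasurableSet {y : Pt n | pnorm (p - y) < r} := measurableSet_lt (by fun_prop) measurable_const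
  rw [← lintegral_indicator hms]
  have hcov : Function.support ({y : Pt n | pnorm (p - y) < r}.indicator f) ⊆
      ⋃ k : ℕ, {y | (1 / 2 : ℝ) ^ (k + 1) * r < pnorm (p - y) ∧ pnorm (p - y) ≤ (1 / 2) ^ k * r} := by
    intro y hy
    rw [Function.mem_support] at hy
    have h1 : y ∈ {y : Pt n | pnorm (p - y) < r} := mem_of_indicator_ne_zero hy
    rw [indicator_of_mem h1] at hy
    have h2 : 0 < pnorm (p - y) := by
      rcases (pnorm_nonneg (p - y)).eq_or_lt with h0 | h0
      · exfalso; apply hy; simp only [hf]; rw [← h0, zero_pow (by omega)]; simp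
      · exact h0
    obtain ⟨k, hk1, hk2⟩ := exists_nat_pow_near_of_lt_one (x := pnorm (p - y) / r) (y := (1 / 2 : ℝ)) (by positivity)
      (by rw [div_le_one hr]; exact (le_of_lt h1)) (by norm_num) (by norm_num)
    rw [lt_div_iff₀ hr] at hk1
    rw [div_le_iff₀ hr] at hk2
    exact mem_iUnion.2 ⟨k, hk1, hk2⟩
  rw [← setLIntegral_eq_of_support_subset hcov]
  refine (lintegral_iUnion_le _ _).trans ?_
  have hterm : ∀ k : ℕ, ∫⁻ y in {y | (1 / 2 : ℝ) ^ (k + 1) * r < pnorm (p - y) ∧ pnorm (p - y) ≤ (1 / 2) ^ k * r},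
      ({y : Pt n | pnorm (p - y) < r}.indicator f) y ∂μ ≤ ENNReal.ofReal (2 * 4 ^ n * r * (1 / 2) ^ k) := by
    intro k
    have hk : 0 < (1 / 2 : ℝ) ^ (k + 1) * r := by positivity
    calc _ ≤ ∫⁻ y in {y | (1 / 2 : ℝ) ^ (k + 1) * r < pnorm (p - y) ∧ pnorm (p - y) ≤ (1 / 2) ^ k * r},
          ENNReal.ofReal ((((1 / 2 : ℝ) ^ (k + 1) * r) ^ n)⁻¹) ∂μ := by
          refine setLIntegral_mono measurable_const fun y hy => ?_
          refine (indicator_le_self _ _ _).trans ?_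
          refine ENNReal.ofReal_le_ofReal ?_
          have := hy.1.le
          gcongr
      _ = ENNReal.ofReal ((((1 / 2 : ℝ) ^ (k + 1) * r) ^ n)⁻¹) * μ {y | (1 / 2 : ℝ) ^ (k + 1) * r < pnorm (p - y) ∧ pnorm (p - y) ≤ (1 / 2) ^ k * r} := by
          rw [setLIntegral_const]
      _ ≤ ENNReal.ofReal ((((1 / 2 : ℝ) ^ (k + 1) * r) ^ n)⁻¹) * μ (pball p (2 * ((1 / 2) ^ k * r))) := by
          gcongr
          intro y hy
          change pnorm (y - p) < _
          rw [pnorm_sub_comm]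
          have : 0 < (1 / 2 : ℝ) ^ k * r := by positivity
          linarith [hy.2]
      _ ≤ ENNReal.ofReal ((((1 / 2 : ℝ) ^ (k + 1) * r) ^ n)⁻¹) * ENNReal.ofReal ((2 * ((1 / 2) ^ k * r)) ^ (n + 1)) := by
          gcongr; exact hg p _ (by positivity)
      _ = _ := by
          rw [← ENNReal.ofReal_mul (by positivity)]
          congr 1
          have e : (2 * ((1 / 2 : ℝ) ^ k * r)) = 4 * ((1 / 2 : ℝ) ^ (k + 1) * r) := by ring
          have e2 : 2 * 4 ^ n * r * (1 / 2 : ℝ) ^ k = 2 * 4 ^ n * 2 * ((1 / 2 : ℝ) ^ (k + 1) * r) := by ring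
          rw [e, e2]
          generalize (1 / 2 : ℝ) ^ (k + 1) * r = w at hk
          rw [mul_pow, pow_succ w, pow_succ 4]
          field_simp
          try norm_num
  refine (ENNReal.tsum_le_tsum hterm).trans ?_
  have hs : Summable fun k : ℕ => 2 * 4 ^ n * r * (1 / 2 : ℝ) ^ k := summable_geometric_two.mul_left _
  rw [← ENNReal.ofReal_tsum_of_nonneg (fun j => by positivity) hs, tsum_mul_left, tsum_geometric_two]
  refine ENNReal.ofReal_le_ofReal ?_
  rw [pow_add]
  have : 0 < (4 : ℝ) ^ n * r := by positivity
  nlinarith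

lemma growth_far {n : ℕ} {μ : Measure (Pt n)} (hg : PGrowth μ) (p : Pt n) {r : ℝ} (hr : 0 < r) :
    ∫⁻ y in {y | r ≤ pnorm (p - y)}, ENNReal.ofReal ((pnorm (p - y) ^ (n + 2))⁻¹) ∂μ ≤ ENNReal.ofReal (4 ^ (n + 2) / r) := by
  have hpc := pnorm_cont (n := n)
  set f : Pt n → ENNReal := fun y => ENNReal.ofReal ((pnorm (p - y) ^ (n + 2))⁻¹) with hf
  have hcov : {y : Pt n | r ≤ pnorm (p - y)} ⊆
      ⋃ k : ℕ, {y | (2 : ℝ) ^ k * r ≤ pnorm (p - y) ∧ pnorm (p - y) < 2 ^ (k + 1) * r} := by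
    intro y hy
    obtain ⟨k, hk1, hk2⟩ := exists_nat_pow_near (x := pnorm (p - y) / r) (y := (2 : ℝ))
      (by rw [le_div_iff₀ hr, one_mul]; exact hy) (by norm_num)
    rw [le_div_iff₀ hr] at hk1
    rw [div_lt_iff₀ hr] at hk2
    exact mem_iUnion.2 ⟨k, hk1, hk2⟩
  refine (lintegral_mono_set hcov).trans ((lintegral_iUnion_le _ _).trans ?_)
  have hterm : ∀ k : ℕ, ∫⁻ y in {y | (2 : ℝ) ^ k * r ≤ pnorm (p - y) ∧ pnorm (p - y) < 2 ^ (k + 1) * r}, f y ∂μ ≤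
      ENNReal.ofReal (2 ^ (n + 1) / r * (1 / 2) ^ k) := by
    intro k
    have hk : 0 < (2 : ℝ) ^ k * r := by positivity
    calc _ ≤ ∫⁻ y in {y | (2 : ℝ) ^ k * r ≤ pnorm (p - y) ∧ pnorm (p - y) < 2 ^ (k + 1) * r},
          ENNReal.ofReal ((((2 : ℝ) ^ k * r) ^ (n + 2))⁻¹) ∂μ := by
          refine setLIntegral_mono measurable_const fun y hy => ?_
          refine ENNReal.ofReal_le_ofReal ?_
          have := hy.1
          gcongr
      _ = ENNReal.ofReal ((((2 : ℝ) ^ k * r) ^ (n + 2))⁻¹) * μ {y | (2 : ℝ) ^ k * r ≤ pnorm (p - y) ∧ pnorm (p - y) < 2 ^ (k + 1) * r} := by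
          rw [setLIntegral_const]
      _ ≤ ENNReal.ofReal ((((2 : ℝ) ^ k * r) ^ (n + 2))⁻¹) * μ (pball p (2 ^ (k + 1) * r)) := by
          gcongr
          intro y hy
          change pnorm (y - p) < _
          rw [pnorm_sub_comm]
          exact hy.2
      _ ≤ ENNReal.ofReal ((((2 : ℝ) ^ k * r) ^ (n + 2))⁻¹) * ENNReal.ofReal ((2 ^ (k + 1) * r) ^ (n + 1)) := by
          gcongr; exact hg p _ (by positivity)
      _ = _ := by
          rw [← ENNReal.ofReal_mul (by positivity)]
          congr 1
          have e : ((2 : ℝ) ^ (k + 1) * r) = 2 * (2 ^ k * r) := by ring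
          have e2 : 2 ^ (n + 1) / r * (1 / 2 : ℝ) ^ k = 2 ^ (n + 1) / (2 ^ k * r) := by
            rw [one_div, inv_pow]; field_simp
          rw [e, e2]
          generalize (2 : ℝ) ^ k * r = w at hk
          rw [mul_pow, pow_succ w (n + 1)]
          field_simp
  refine (ENNReal.tsum_le_tsum hterm).trans ?_
  have hs : Summable fun k : ℕ => 2 ^ (n + 1) / r * (1 / 2 : ℝ) ^ k := summable_geometric_two.mul_left _
  rw [← ENNReal.ofReal_tsum_of_nonneg (fun j => by positivity) hs, tsum_mul_left, tsum_geometric_two]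
  refine ENNReal.ofReal_le_ofReal ?_
  rw [div_mul_eq_mul_div]
  gcongr
  calc (2 : ℝ) ^ (n + 1) * 2 = 2 ^ (n + 2) := by ring
    _ ≤ 4 ^ (n + 2) := by gcongr; norm_num

lemma heatW_near_lint {n : ℕ} (hn : 1 ≤ n) {μ : Measure (Pt n)} (hg : PGrowth μ) (p : Pt n) {r : ℝ} (hr : 0 < r) :
    ∫⁻ y in {y | pnorm (p - y) < r}, ENNReal.ofReal (heatW (p - y)) ∂μ ≤ ENNReal.ofReal (cM n * (4 ^ (n + 2) * r)) := by
  have hc := cM_pos n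
  have hpc := pnorm_cont (n := n)
  calc _ ≤ ∫⁻ y in {y | pnorm (p - y) < r}, ENNReal.ofReal (cM n) * ENNReal.ofReal ((pnorm (p - y) ^ n)⁻¹) ∂μ := by
        refine lintegral_mono fun y => ?_
        simp only
        rw [← ENNReal.ofReal_mul hc.le]
        exact ENNReal.ofReal_le_ofReal (heatW_le_pnorm hn _)
    _ = ENNReal.ofReal (cM n) * ∫⁻ y in {y | pnorm (p - y) < r}, ENNReal.ofReal ((pnorm (p - y) ^ n)⁻¹) ∂μ := by
        rw [lintegral_const_mul]
        have : Measurable (fun y : Pt n => pnorm (p - y)) := by fun_prop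
        exact ((this.pow_const n).inv).ennreal_ofReal
    _ ≤ ENNReal.ofReal (cM n) * ENNReal.ofReal (4 ^ (n + 2) * r) := by
        gcongr; exact growth_near hn hg p hr
    _ = _ := by rw [← ENNReal.ofReal_mul hc.le]

lemma heatW_int_all {n : ℕ} (hn : 1 ≤ n) {μ : Measure (Pt n)} [IsFiniteMeasure μ] (hg : PGrowth μ) (p : Pt n) :
    Integrable (fun y => heatW (p - y)) μ := by
  have hc := cM_pos n
  have hpc := pnorm_cont (n := n)
  have hms : MeasurableSet {y : Pt n | pnorm (p - y) < 1} := measurableSet_lt (by fun_prop) measurable_const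
  refine integrable_heatW_of_lt_top μ ?_
  rw [← lintegral_add_compl _ hms]
  refine ENNReal.add_lt_top.2 ⟨(heatW_near_lint hn hg p one_pos).trans_lt ENNReal.ofReal_lt_top, ?_⟩
  calc _ ≤ ∫⁻ y in {y : Pt n | pnorm (p - y) < 1}ᶜ, ENNReal.ofReal (cM n) ∂μ := by
        refine setLIntegral_mono measurable_const fun y hy => ?_
        refine ENNReal.ofReal_le_ofReal ((heatW_le_pnorm hn _).trans ?_)
        have h1 : 1 ≤ pnorm (p - y) := not_lt.1 hy
        have h2 : (pnorm (p - y) ^ n)⁻¹ ≤ 1 := inv_le_one_of_one_le₀ (one_le_pow₀ h1)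
        nlinarith
    _ < ⊤ := by
        rw [setLIntegral_const]; finiteness

lemma heatW_far_lint {n : ℕ} {μ : Measure (Pt n)} (hg : PGrowth μ) (p : Pt n) (s : ℝ) {r : ℝ} (hr : 0 < r)
    (hs : 2 * √|s - p.2| ≤ r) :
    ∫⁻ y in {y | pnorm (p - y) < r}ᶜ, ‖heatW ((p.1, s) - y) - heatW (p - y)‖ₑ ∂μ ≤
      ENNReal.ofReal (cF n * |s - p.2| * (4 ^ (n + 2) / r)) := by
  have hc := cF_pos n
  have hpc := pnorm_cont (n := n)
  have he : {y | pnorm (p - y) < r}ᶜ = {y | r ≤ pnorm (p - y)} := by ext y; simp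
  have hms : MeasurableSet {y : Pt n | r ≤ pnorm (p - y)} := measurableSet_le measurable_const (by fun_prop)
  rw [he]
  calc _ ≤ ∫⁻ y in {y | r ≤ pnorm (p - y)}, ENNReal.ofReal (cF n * |s - p.2|) * ENNReal.ofReal ((pnorm (p - y) ^ (n + 2))⁻¹) ∂μ := by
        refine setLIntegral_mono' hms fun y hy => ?_
        have hy' : r ≤ pnorm (p - y) := hy
        rw [← ENNReal.ofReal_mul (by positivity), ← ofReal_norm]
        refine ENNReal.ofReal_le_ofReal ?_
        have := heatW_far (p - y) (s - p.2) (by linarith) (by linarith)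
        have e : ((p.1, s) - y : Pt n) = ((p - y).1, (p - y).2 + (s - p.2)) := by
          ext1
          · simp
          · simp
        rw [e]; exact this
    _ = ENNReal.ofReal (cF n * |s - p.2|) * ∫⁻ y in {y | r ≤ pnorm (p - y)}, ENNReal.ofReal ((pnorm (p - y) ^ (n + 2))⁻¹) ∂μ := by
        rw [lintegral_const_mul]
        have : Measurable (fun y : Pt n => pnorm (p - y)) := by fun_prop
        exact ((this.pow_const _).inv).ennreal_ofReal
    _ ≤ ENNReal.ofReal (cF n * |s - p.2|) * ENNReal.ofReal (4 ^ (n + 2) / r) := by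
        gcongr; exact growth_far hg p hr
    _ = _ := by rw [← ENNReal.ofReal_mul (by positivity)]

/-- Lip-1/2 constant. -/
def cL (n : ℕ) : ℝ := (5 * cM n + cF n) * 4 ^ (n + 2)
lemma cL_pos (n : ℕ) : 0 < cL n := by unfold cL; have := cM_pos n; have := cF_pos n; positivity

lemma lip_half {n : ℕ} (hn : 1 ≤ n) {μ : Measure (Pt n)} [IsFiniteMeasure μ] (hg : PGrowth μ) (x : Spc n) (t s : ℝ) :
    |mconvW μ (x, s) - mconvW μ (x, t)| ≤ cL n * √|s - t| := by
  have hc := cF_pos n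
  have hc' := cM_pos n
  have hpc := pnorm_cont (n := n)
  rcases eq_or_ne s t with rfl | hst
  · simp
  set δ := √|s - t| with hδ
  have hδ0 : 0 < δ := Real.sqrt_pos.2 (abs_pos.2 (sub_ne_zero.2 hst))
  have hδ2 : δ ^ 2 = |s - t| := Real.sq_sqrt (abs_nonneg _)
  set p : Pt n := (x, t) with hp
  have hms : MeasurableSet {y : Pt n | pnorm (p - y) < 2 * δ} := measurableSet_lt (by fun_prop) measurable_const
  have hsub : {y : Pt n | pnorm (p - y) < 2 * δ} ⊆ {y | pnorm (((x, s) : Pt n) - y) < 3 * δ} := by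
    intro y hy
    have h1 : pnorm (p - y) < 2 * δ := hy
    have h2 := pnorm_add_le (p - y) ((0, s - t) : Pt n)
    have h3 : pnorm ((0, s - t) : Pt n) = δ := by unfold pnorm; simp [hδ]
    have e : (p - y) + ((0, s - t) : Pt n) = (x, s) - y := by
      ext1
      · simp [hp]
      · simp [hp]
    rw [e] at h2
    change pnorm _ < _
    linarith
  have key : ∫⁻ y, ‖heatW (((x, s) : Pt n) - y) - heatW (p - y)‖ₑ ∂μ ≤ ENNReal.ofReal (cL n * δ) := by
    rw [← lintegral_add_compl _ hms]
    calc _ ≤ (ENNReal.ofReal (cM n * (4 ^ (n + 2) * (3 * δ))) + ENNReal.ofReal (cM n * (4 ^ (n + 2) * (2 * δ)))) +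
          ENNReal.ofReal (cF n * |s - t| * (4 ^ (n + 2) / (2 * δ))) := by
          refine add_le_add ?_ (heatW_far_lint hg p s (by positivity) le_rfl)
          calc _ ≤ ∫⁻ y in {y : Pt n | pnorm (p - y) < 2 * δ}, (ENNReal.ofReal (heatW (((x, s) : Pt n) - y)) + ENNReal.ofReal (heatW (p - y))) ∂μ := by
                refine lintegral_mono fun y => ?_
                refine (enorm_sub_le).trans ?_
                rw [Real.enorm_eq_ofReal (heatW_nonneg _), Real.enorm_eq_ofReal (heatW_nonneg _)]
            _ = (∫⁻ y in {y : Pt n | pnorm (p - y) < 2 * δ}, ENNReal.ofReal (heatW (((x, s) : Pt n) - y)) ∂μ) +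
                ∫⁻ y in {y : Pt n | pnorm (p - y) < 2 * δ}, ENNReal.ofReal (heatW (p - y)) ∂μ := by
                refine lintegral_add_right _ ?_
                have := heatW_measurable (n := n)
                fun_prop
            _ ≤ _ := by
                refine add_le_add ((lintegral_mono_set hsub).trans (heatW_near_lint hn hg _ (by positivity))) (heatW_near_lint hn hg _ (by positivity))
      _ = ENNReal.ofReal (cM n * (4 ^ (n + 2) * (3 * δ)) + cM n * (4 ^ (n + 2) * (2 * δ)) + cF n * |s - t| * (4 ^ (n + 2) / (2 * δ))) := by
          rw [ENNReal.ofReal_add (by positivity) (by positivity), ENNReal.ofReal_add (by positivity) (by positivity)]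
      _ ≤ _ := by
          refine ENNReal.ofReal_le_ofReal ?_
          have e : cF n * |s - t| * (4 ^ (n + 2) / (2 * δ)) = cF n * 4 ^ (n + 2) * δ / 2 := by
            rw [← hδ2]; field_simp
          rw [e]; unfold cL
          have : 0 < cF n * 4 ^ (n + 2) * δ := by positivity
          nlinarith
  unfold mconvW
  rw [← integral_sub (heatW_int_all hn hg _) (heatW_int_all hn hg _), ← Real.norm_eq_abs]
  have h1 := (enorm_integral_le_lintegral_enorm (μ := μ) (fun y => heatW (((x, s) : Pt n) - y) - heatW (p - y))).trans key
  rw [← ofReal_norm] at h1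
  exact (ENNReal.ofReal_le_ofReal_iff (by have := cL_pos n; positivity)).1 h1

lemma gradW_line_cont {n : ℕ} (x v : Spc n) {t : ℝ} (ht : 0 < t) :
    Continuous fun θ : ℝ => inner ℝ (gradW ((x + θ • v, t) : Pt n)) v := by
  unfold gradW
  simp only [ht, if_true]
  fun_prop

lemma heatW_ftc {n : ℕ} (x v : Spc n) (t : ℝ) :
    heatW ((x + v, t) : Pt n) - heatW ((x, t) : Pt n) = ∫ θ in Icc (0 : ℝ) 1, inner ℝ (gradW ((x + θ • v, t) : Pt n)) v := by
  rcases le_or_gt t 0 with ht | ht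
  · rw [heatW_of_nonpos (p := (x + v, t)) ht, heatW_of_nonpos (p := (x, t)) ht]
    have : ∀ θ : ℝ, inner ℝ (gradW ((x + θ • v, t) : Pt n)) v = 0 := by
      intro θ; rw [gradW_of_nonpos (p := (x + θ • v, t)) ht, inner_zero_left]
    simp [this]
  · have hd : ∀ θ : ℝ, HasDerivAt (fun θ : ℝ => heatW ((x + θ • v, t) : Pt n)) (inner ℝ (gradW ((x + θ • v, t) : Pt n)) v) θ := by
      intro θ
      unfold heatW gradW
      simp only [ht, if_true]
      have h1 : HasDerivAt (fun θ : ℝ => x + θ • v) v θ := by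
        simpa using ((hasDerivAt_id θ).smul_const v).const_add x
      have h2 := ((((h1.norm_sq).neg).div_const (4 * t)).exp).const_mul ((4 * π * t) ^ (-(n : ℝ) / 2))
      refine h2.congr_deriv ?_
      rw [real_inner_smul_left, Pi.neg_apply]
      field_simp
      ring
    rw [integral_Icc_eq_integral_Ioc, ← intervalIntegral.integral_of_le zero_le_one,
      intervalIntegral.integral_eq_sub_of_hasDerivAt (fun θ _ => hd θ) ((gradW_line_cont x v ht).intervalIntegrable _ _)]
    simp

lemma ae_gradW_line {n : ℕ} (μ : Measure (Pt n)) [IsFiniteMeasure μ] (v : Spc n) :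
    ∀ᵐ q : Pt n, Integrable (fun z : ℝ × Pt n => gradW (((q.1 + z.1 • v, q.2) : Pt n) - z.2)) ((volume.restrict (Icc (0 : ℝ) 1)).prod μ) := by
  have hm := gradW_measurable (n := n)
  set ν := (volume.restrict (Icc (0 : ℝ) 1)).prod μ with hν
  have h : ∀ k : ℕ, ∀ᵐ q : Pt n, (Icc (-(k : ℝ)) k).indicator (fun _ => (1 : ENNReal)) q.2 *
      ∫⁻ z, ‖gradW (((q.1 + z.1 • v, q.2) : Pt n) - z.2)‖ₑ ∂ν < ⊤ := by
    intro k
    have hi : Measurable ((Icc (-(k : ℝ)) k).indicator (fun _ => (1 : ENNReal))) := measurable_const.indicator measurableSet_Icc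
    have hj : Measurable fun w : Pt n × (ℝ × Pt n) => ‖gradW (((w.1.1 + w.2.1 • v, w.1.2) : Pt n) - w.2.2)‖ₑ := by fun_prop
    have hj2 : Measurable fun q : Pt n => ∫⁻ z, ‖gradW (((q.1 + z.1 • v, q.2) : Pt n) - z.2)‖ₑ ∂ν := hj.lintegral_prod_right'
    refine ae_lt_top (by fun_prop) ?_
    have e : ∫⁻ q : Pt n, (Icc (-(k : ℝ)) k).indicator (fun _ => (1 : ENNReal)) q.2 * ∫⁻ z, ‖gradW (((q.1 + z.1 • v, q.2) : Pt n) - z.2)‖ₑ ∂ν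
        = ∫⁻ z, (∫⁻ q : Pt n, (Icc (-(k : ℝ)) k).indicator (fun _ => (1 : ENNReal)) q.2 * ‖gradW (q - (z.2 - ((z.1 • v, 0) : Pt n)))‖ₑ) ∂ν := by
      rw [lintegral_lintegral_swap (Measurable.aemeasurable (by fun_prop))]
      refine lintegral_congr fun q => ?_
      rw [← lintegral_const_mul _ (by fun_prop)]
      refine lintegral_congr fun z => ?_
      have : ((q.1 + z.1 • v, q.2) : Pt n) - z.2 = q - (z.2 - ((z.1 • v, 0) : Pt n)) := by
        ext1
        · simp; abel
        · simp
      rw [this]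
    rw [e]
    refine ne_of_lt (lt_of_le_of_lt (lintegral_mono fun y => lint_gradW_slab _ measurableSet_Icc _) ?_)
    rw [lintegral_const, Real.volume_Icc]
    exact Ne.lt_top (by finiteness)
  filter_upwards [ae_all_iff.2 h] with q hq
  obtain ⟨k, hk⟩ := exists_nat_ge |q.2|
  have := hq k
  rw [indicator_of_mem (by rw [mem_Icc]; exact abs_le.1 hk), one_mul] at this
  exact ⟨Measurable.aestronglyMeasurable (by fun_prop), this⟩

lemma xlip_v {n : ℕ} (hn : 1 ≤ n) {μ : Measure (Pt n)} [IsFiniteMeasure μ] (hg : PGrowth μ)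
    (hgrad : ∀ p, ‖mconvGradW μ p‖ ≤ 1) (v : Spc n) :
    ∀ᵐ q : Pt n, |mconvW μ (q.1 + v, q.2) - mconvW μ q| ≤ ‖v‖ := by
  filter_upwards [ae_gradW_line μ v] with q hq
  have hq2 : Integrable (fun z : ℝ × Pt n => inner ℝ (gradW (((q.1 + z.1 • v, q.2) : Pt n) - z.2)) v) ((volume.restrict (Icc (0 : ℝ) 1)).prod μ) :=
    hq.inner_const v
  have e1 : mconvW μ (q.1 + v, q.2) - mconvW μ q = ∫ y, (∫ θ in Icc (0 : ℝ) 1, inner ℝ (gradW (((q.1 + θ • v, q.2) : Pt n) - y)) v) ∂μ := by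
    unfold mconvW
    rw [← integral_sub (heatW_int_all hn hg _) (heatW_int_all hn hg _)]
    refine integral_congr_ae (.of_forall fun y => ?_)
    have := heatW_ftc (q.1 - y.1) v (q.2 - y.2)
    have a1 : ((q.1 + v, q.2) : Pt n) - y = (q.1 - y.1 + v, q.2 - y.2) := by
      ext1
      · simp; abel
      · simp
    have a2 : ∀ θ : ℝ, ((q.1 + θ • v, q.2) : Pt n) - y = (q.1 - y.1 + θ • v, q.2 - y.2) := by
      intro θ
      ext1
      · simp; abel
      · simp
    simp only [a1, a2]
    exact this
  rw [e1, ← integral_integral_swap (f := fun (θ : ℝ) (y : Pt n) => inner ℝ (gradW (((q.1 + θ • v, q.2) : Pt n) - y)) v) hq2]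
  have hb : ∀ᵐ θ ∂(volume.restrict (Icc (0 : ℝ) 1)), ‖∫ y, inner ℝ (gradW (((q.1 + θ • v, q.2) : Pt n) - y)) v ∂μ‖ ≤ ‖v‖ := by
    filter_upwards [hq.prod_right_ae] with θ hθ
    have hθ' : Integrable (fun y => gradW (((q.1 + θ • v, q.2) : Pt n) - y)) μ := hθ
    have e2 : ∫ y, inner ℝ (gradW (((q.1 + θ • v, q.2) : Pt n) - y)) v ∂μ = inner ℝ v (mconvGradW μ (q.1 + θ • v, q.2)) := by
      rw [mconvGradW, ← integral_inner hθ']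
      simp only [real_inner_comm]
    rw [e2]
    refine (norm_inner_le_norm _ _).trans ?_
    exact mul_le_of_le_one_right (norm_nonneg _) (hgrad _)
  have := norm_integral_le_of_norm_le_const hb
  rw [Real.norm_eq_abs] at this
  simpa using this

lemma xlip_ae {n : ℕ} (hn : 1 ≤ n) {μ : Measure (Pt n)} [IsFiniteMeasure μ] (hg : PGrowth μ)
    (hgrad : ∀ p, ‖mconvGradW μ p‖ ≤ 1) :
    ∀ᵐ x' : Spc n, ∀ᵐ x : Spc n, ∀ᵐ t : ℝ, |mconvW μ (x, t) - mconvW μ (x', t)| ≤ ‖x - x'‖ := by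
  have hf : Measurable (mconvW μ) := (mconvW_measurable μ).measurable
  have hA : MeasurableSet {w : Spc n × Pt n | |mconvW μ (w.2.1 + w.1, w.2.2) - mconvW μ w.2| ≤ ‖w.1‖} :=
    measurableSet_le (by fun_prop) (by fun_prop)
  have h1 : ∀ᵐ w : Spc n × Pt n ∂(volume.prod volume), |mconvW μ (w.2.1 + w.1, w.2.2) - mconvW μ w.2| ≤ ‖w.1‖ := by
    rw [Measure.ae_prod_iff_ae_ae hA]
    exact .of_forall fun v => xlip_v hn hg hgrad v
  have h2 : ∀ᵐ w : (Spc n × Spc n) × ℝ ∂((volume.prod volume).prod volume),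
      |mconvW μ (w.1.2 + w.1.1, w.2) - mconvW μ (w.1.2, w.2)| ≤ ‖w.1.1‖ := by
    have := (measurePreserving_prodAssoc (volume : Measure (Spc n)) (volume : Measure (Spc n)) (volume : Measure ℝ)).quasiMeasurePreserving.ae h1
    exact this
  have h3 := Measure.ae_ae_of_ae_prod h2
  have h4 : ∀ᵐ w : Spc n × Spc n ∂(volume.prod volume), ∀ᵐ t : ℝ, |mconvW μ (w.1 + w.2, t) - mconvW μ (w.1, t)| ≤ ‖w.2‖ :=
    (Measure.measurePreserving_swap (μ := (volume : Measure (Spc n))) (ν := (volume : Measure (Spc n)))).quasiMeasurePreserving.ae h3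
  filter_upwards [Measure.ae_ae_of_ae_prod h4] with x' hx'
  have := (measurePreserving_sub_right (volume : Measure (Spc n)) x').quasiMeasurePreserving.ae hx'
  filter_upwards [this] with x hx
  simpa using hx

/-- The integrand of the half derivative, centred. -/
def phi {n : ℕ} (μ : Measure (Pt n)) (p : Pt n) (h : ℝ) : ℝ :=
  (mconvW μ (p.1, p.2 + h) - mconvW μ p) / |h| ^ (3 / 2 : ℝ)

lemma halfT_eq_phi {n : ℕ} (μ : Measure (Pt n)) (p : Pt n) : halfT (mconvW μ) p = ∫ h, phi μ p h := by
  unfold halfT phi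
  rw [← integral_add_left_eq_self _ p.2]
  simp only [add_sub_cancel_left]

lemma phi_meas {n : ℕ} (μ : Measure (Pt n)) [IsFiniteMeasure μ] (p : Pt n) : Measurable (phi μ p) := by
  have hf : Measurable (mconvW μ) := (mconvW_measurable μ).measurable
  unfold phi
  fun_prop

lemma phi_enorm {n : ℕ} (hn : 1 ≤ n) {μ : Measure (Pt n)} [IsFiniteMeasure μ] (hg : PGrowth μ) (p : Pt n) (h : ℝ) :
    ‖phi μ p h‖ₑ ≤ (∫⁻ y, ‖heatW (((p.1, p.2 + h) : Pt n) - y) - heatW (p - y)‖ₑ ∂μ) * ENNReal.ofReal ((|h| ^ (3 / 2 : ℝ))⁻¹) := by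
  unfold phi mconvW
  rw [div_eq_mul_inv, enorm_mul, Real.enorm_of_nonneg (by positivity : (0 : ℝ) ≤ (|h| ^ (3 / 2 : ℝ))⁻¹),
    ← integral_sub (heatW_int_all hn hg _) (heatW_int_all hn hg _)]
  gcongr
  exact enorm_integral_le_lintegral_enorm _

lemma AK_swap {n : ℕ} (ν : Measure (Pt n)) [SFinite ν] (p : Pt n) :
    ∫⁻ h : ℝ, (∫⁻ y, ‖heatW (((p.1, p.2 + h) : Pt n) - y) - heatW (p - y)‖ₑ ∂ν) * ENNReal.ofReal ((|h| ^ (3 / 2 : ℝ))⁻¹)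
      = ∫⁻ y, AK (p - y) ∂ν := by
  have hm := heatW_measurable (n := n)
  have e : ∀ h : ℝ, (∫⁻ y, ‖heatW (((p.1, p.2 + h) : Pt n) - y) - heatW (p - y)‖ₑ ∂ν) * ENNReal.ofReal ((|h| ^ (3 / 2 : ℝ))⁻¹)
      = ∫⁻ y, ‖heatW (((p.1, p.2 + h) : Pt n) - y) - heatW (p - y)‖ₑ * ENNReal.ofReal ((|h| ^ (3 / 2 : ℝ))⁻¹) ∂ν := by
    intro h
    rw [lintegral_mul_const _ (by fun_prop)]
  simp only [e]
  rw [lintegral_lintegral_swap (Measurable.aemeasurable (by simp only [Function.uncurry_def]; fun_prop))]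
  refine lintegral_congr fun y => ?_
  rw [AK_shift, ← lintegral_add_left_eq_self (fun s : ℝ => ‖heatW (((p.1, s) : Pt n) - y) - heatW (p - y)‖ₑ * ENNReal.ofReal ((|s - p.2| ^ (3 / 2 : ℝ))⁻¹)) p.2]
  simp only [add_sub_cancel_left]

lemma phi_int_ae {n : ℕ} (hn : 1 ≤ n) {μ : Measure (Pt n)} [IsFiniteMeasure μ] (hg : PGrowth μ) :
    ∀ᵐ p : Pt n, Integrable (phi μ p) := by
  filter_upwards [ae_AK_lt_top μ] with p hp
  refine ⟨(phi_meas μ p).aestronglyMeasurable, ?_⟩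
  refine lt_of_le_of_lt (lintegral_mono fun h => phi_enorm hn hg p h) ?_
  rw [AK_swap]; exact hp

/-- near part -/
lemma phi_near {n : ℕ} (hn : 1 ≤ n) {μ : Measure (Pt n)} [IsFiniteMeasure μ] (hg : PGrowth μ) (p : Pt n) {l : ℝ} (hl : 0 < l)
    (B : Set (Pt n)) (hBm : MeasurableSet B) (hB : Bᶜ ⊆ {y | pnorm (p - y) < 2 * l}ᶜ) :
    ∫⁻ h : ℝ, (if |h| ≤ l ^ 2 then ‖phi μ p h‖ₑ else 0) ≤
      (∫⁻ y in B, AK (p - y) ∂μ) + ENNReal.ofReal (2 * cF n * 4 ^ (n + 2)) := by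
  have hm := heatW_measurable (n := n)
  have hc := cF_pos n
  set K := cF n * 4 ^ (n + 2) / (2 * l) with hK
  have hK0 : 0 < K := by positivity
  have hmeas : Measurable fun h : ℝ => if |h| ≤ l ^ 2 then ENNReal.ofReal ((√|h|)⁻¹) else 0 :=
    Measurable.ite (measurableSet_le (by fun_prop) measurable_const) (by fun_prop) measurable_const
  calc _ ≤ ∫⁻ h : ℝ, ((∫⁻ y in B, ‖heatW (((p.1, p.2 + h) : Pt n) - y) - heatW (p - y)‖ₑ ∂μ) * ENNReal.ofReal ((|h| ^ (3 / 2 : ℝ))⁻¹) +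
          ENNReal.ofReal K * (if |h| ≤ l ^ 2 then ENNReal.ofReal ((√|h|)⁻¹) else 0)) := by
        refine lintegral_mono fun h => ?_
        simp only
        split_ifs with hh
        · refine (phi_enorm hn hg p h).trans ?_
          rw [← lintegral_add_compl _ hBm, add_mul]
          refine add_le_add le_rfl ?_
          have h1 : 2 * √|p.2 + h - p.2| ≤ 2 * l := by
            rw [add_sub_cancel_left]
            have : √|h| ≤ l := by rw [Real.sqrt_le_left hl.le]; exact hh
            linarith
          have h2 := (lintegral_mono_set hB).trans (heatW_far_lint hg p (p.2 + h) (by positivity) h1)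
          rw [add_sub_cancel_left] at h2
          refine (mul_le_mul_left h2 _).trans ?_
          rw [← ENNReal.ofReal_mul (by positivity), ← ENNReal.ofReal_mul (by positivity)]
          refine ENNReal.ofReal_le_ofReal (le_of_eq ?_)
          rw [rpow_three_half, hK]
          rcases eq_or_ne h 0 with rfl | h0
          · simp
          · have : 0 < |h| := abs_pos.2 h0
            field_simp
        · exact zero_le
    _ = (∫⁻ y in B, AK (p - y) ∂μ) + ENNReal.ofReal K * ∫⁻ h : ℝ, (if |h| ≤ l ^ 2 then ENNReal.ofReal ((√|h|)⁻¹) else 0) := by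
        rw [lintegral_add_right _ (hmeas.const_mul _), AK_swap, lintegral_const_mul _ hmeas]
    _ ≤ (∫⁻ y in B, AK (p - y) ∂μ) + ENNReal.ofReal K * ENNReal.ofReal (4 * √(l ^ 2)) := by
        gcongr
        exact lint_half_near (by positivity)
    _ = _ := by
        rw [Real.sqrt_sq hl.le, ← ENNReal.ofReal_mul hK0.le, hK]
        congr 2
        field_simp
        norm_num

/-- far part -/
lemma phi_far {n : ℕ} {μ : Measure (Pt n)} [IsFiniteMeasure μ] (p p' : Pt n) {l D : ℝ} (hl : 0 < l) (hD : 0 ≤ D)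
    (h0 : |mconvW μ p - mconvW μ p'| ≤ D * l)
    (hh : ∀ᵐ h : ℝ, |mconvW μ (p.1, p.2 + h) - mconvW μ (p'.1, p'.2 + h)| ≤ D * l) :
    ∫⁻ h : ℝ, (if l ^ 2 < |h| then ‖phi μ p h - phi μ p' h‖ₑ else 0) ≤ ENNReal.ofReal (8 * D) := by
  have hmeas : Measurable fun h : ℝ => if l ^ 2 < |h| then ENNReal.ofReal ((|h| ^ (3 / 2 : ℝ))⁻¹) else 0 :=
    Measurable.ite (measurableSet_lt measurable_const (by fun_prop)) (by fun_prop) measurable_const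
  calc _ ≤ ∫⁻ h : ℝ, ENNReal.ofReal (2 * D * l) * (if l ^ 2 < |h| then ENNReal.ofReal ((|h| ^ (3 / 2 : ℝ))⁻¹) else 0) := by
        refine lintegral_mono_ae ?_
        filter_upwards [hh] with h hh
        split_ifs with hc
        · rw [← ENNReal.ofReal_mul (by positivity), ← ofReal_norm]
          refine ENNReal.ofReal_le_ofReal ?_
          unfold phi
          rw [← sub_div, div_eq_mul_inv, norm_mul, Real.norm_of_nonneg (by positivity : (0 : ℝ) ≤ (|h| ^ (3 / 2 : ℝ))⁻¹), Real.norm_eq_abs]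
          refine mul_le_mul_of_nonneg_right ?_ (by positivity)
          rw [abs_le] at *
          constructor <;> linarith [h0.1, h0.2, hh.1, hh.2]
        · simp
    _ = ENNReal.ofReal (2 * D * l) * ∫⁻ h : ℝ, (if l ^ 2 < |h| then ENNReal.ofReal ((|h| ^ (3 / 2 : ℝ))⁻¹) else 0) := by
        rw [lintegral_const_mul _ hmeas]
    _ ≤ ENNReal.ofReal (2 * D * l) * ENNReal.ofReal (4 / √(l ^ 2)) := by
        gcongr
        exact lint_threehalf_far (by positivity)
    _ = _ := by
        rw [Real.sqrt_sq hl.le, ← ENNReal.ofReal_mul (by positivity)]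
        congr 1
        field_simp
        ring

lemma cube_norm {n : ℕ} (x y : Spc n) {l : ℝ} (hl : 0 < l) (h : ∀ i, |x i - y i| ≤ l) : ‖x - y‖ ≤ n * l := by
  rw [EuclideanSpace.norm_eq, Real.sqrt_le_left (by positivity)]
  calc ∑ i, ‖(x - y) i‖ ^ 2 ≤ ∑ _i : Fin n, l ^ 2 := by
        refine Finset.sum_le_sum fun i _ => ?_
        have := h i
        rw [PiLp.sub_apply, Real.norm_eq_abs]
        gcongr
    _ = n * l ^ 2 := by simp
    _ ≤ (n * l) ^ 2 := by
        rw [mul_pow]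
        gcongr
        exact_mod_cast Nat.le_self_pow two_ne_zero n

/-- enlarged ball of a cube -/
def cubeBall {n : ℕ} (Q : PCube n) : Set (Pt n) := pball (WithLp.toLp 2 Q.corner, Q.time) ((n + 4) * Q.len)

lemma cubeBall_far {n : ℕ} (Q : PCube n) {p : Pt n} (hp : p ∈ Q.toSet) :
    (cubeBall Q)ᶜ ⊆ {y | pnorm (p - y) < 2 * Q.len}ᶜ := by
  have hl := Q.len_pos
  intro y hy hy2
  apply hy
  have hy3 : pnorm (p - y) < 2 * Q.len := hy2
  change pnorm _ < _
  set c : Pt n := (WithLp.toLp 2 Q.corner, Q.time) with hc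
  have h1 : pnorm (p - c) ≤ (n + 1) * Q.len := by
    refine max_le ?_ ?_
    · have := cube_norm p.1 c.1 hl (fun i => by
        have := hp.1 i
        rw [mem_Icc] at this
        simp only [hc]
        rw [abs_le]; constructor <;> linarith [this.1, this.2])
      simp only [Prod.fst_sub]; linarith
    · have := hp.2
      rw [mem_Icc] at this
      rw [Real.sqrt_le_left (by positivity)]
      simp only [Prod.snd_sub, hc]
      rw [abs_of_nonneg (by linarith)]
      have h2 : 0 ≤ (n : ℝ) := by positivity
      have h3 : Q.len ^ 2 ≤ ((n + 1) * Q.len) ^ 2 := by gcongr; nlinarith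
      linarith
  have h2 := pnorm_add_le (y - p) (p - c)
  rw [sub_add_sub_cancel, pnorm_sub_comm y p] at h2
  linarith

/-- Oscillation constant. -/
def cO (n : ℕ) : ℝ := 2 * cF n * 4 ^ (n + 2) + 8 * (n + cL n)
lemma cO_pos (n : ℕ) : 0 < cO n := by unfold cO; have := cF_pos n; have := cL_pos n; positivity

lemma bmo_point {n : ℕ} (hn : 1 ≤ n) {μ : Measure (Pt n)} [IsFiniteMeasure μ] (hg : PGrowth μ)
    (hgrad : ∀ p, ‖mconvGradW μ p‖ ≤ 1) (Q : PCube n) :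
    ∃ c : ℝ, ∀ᵐ p ∂(volume.restrict Q.toSet), ‖halfT (mconvW μ) p - c‖ₑ ≤
      (∫⁻ y in cubeBall Q, AK (p - y) ∂μ) + ENNReal.ofReal (cO n) := by
  have hl := Q.len_pos
  have hcL := cL_pos n
  have hcF := cF_pos n
  have hf : Measurable (mconvW μ) := (mconvW_measurable μ).measurable
  have hne : (ae (volume.restrict Q.toSet)).NeBot := by
    rw [ae_restrict_neBot, cube_vol]; simp; positivity
  have hx := xlip_ae hn hg hgrad
  have hx1 : ∀ᵐ p : Pt n, ∀ᵐ x : Spc n, ∀ᵐ t : ℝ, |mconvW μ (x, t) - mconvW μ (p.1, t)| ≤ ‖x - p.1‖ := by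
    rw [Measure.volume_eq_prod]
    exact Measure.quasiMeasurePreserving_fst.ae hx
  obtain ⟨p', ⟨hp'1, hp'2⟩, hp'Q⟩ := (((ae_restrict_of_ae (s := Q.toSet) (hx1.and (phi_int_ae hn hg))).and (ae_restrict_mem (cube_meas Q))).exists)
  have hp1 : ∀ᵐ p : Pt n, ∀ᵐ t : ℝ, |mconvW μ (p.1, t) - mconvW μ (p'.1, t)| ≤ ‖p.1 - p'.1‖ := by
    rw [Measure.volume_eq_prod]
    exact Measure.quasiMeasurePreserving_fst.ae hp'1
  have hp2 : ∀ᵐ p : Pt n, |mconvW μ p - mconvW μ (p'.1, p.2)| ≤ ‖p.1 - p'.1‖ := by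
    have hA : MeasurableSet {p : Pt n | |mconvW μ p - mconvW μ (p'.1, p.2)| ≤ ‖p.1 - p'.1‖} :=
      measurableSet_le (by fun_prop) (by fun_prop)
    rw [Measure.volume_eq_prod, Measure.ae_prod_iff_ae_ae hA]
    exact hp'1
  have hSm : MeasurableSet {h : ℝ | Q.len ^ 2 < |h|} := measurableSet_lt measurable_const (by fun_prop)
  refine ⟨∫ h, {h : ℝ | Q.len ^ 2 < |h|}.indicator (phi μ p') h, ?_⟩
  filter_upwards [ae_restrict_of_ae hp1, ae_restrict_of_ae hp2, ae_restrict_of_ae (phi_int_ae hn hg), ae_restrict_mem (cube_meas Q)] with p h1 h2 h3 hpQ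
  have hxx : ‖p.1 - p'.1‖ ≤ n * Q.len := cube_norm _ _ hl fun i => by
    have a := hpQ.1 i
    have b := hp'Q.1 i
    rw [mem_Icc] at a b
    rw [abs_le]; constructor <;> linarith [a.1, a.2, b.1, b.2]
  have htt : √|p.2 - p'.2| ≤ Q.len := by
    have a := hpQ.2
    have b := hp'Q.2
    rw [mem_Icc] at a b
    rw [Real.sqrt_le_left hl.le, abs_le]; constructor <;> linarith [a.1, a.2, b.1, b.2]
  have hcomb : ∀ h : ℝ, |mconvW μ (p.1, p.2 + h) - mconvW μ (p'.1, p.2 + h)| ≤ ‖p.1 - p'.1‖ →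
      |mconvW μ (p.1, p.2 + h) - mconvW μ (p'.1, p'.2 + h)| ≤ (n + cL n) * Q.len := by
    intro h hh
    have := lip_half hn hg p'.1 (p'.2 + h) (p.2 + h)
    rw [add_sub_add_right_eq_sub] at this
    have h5 : cL n * √|p.2 - p'.2| ≤ cL n * Q.len := by gcongr
    have h6 := abs_sub_le (mconvW μ (p.1, p.2 + h)) (mconvW μ (p'.1, p.2 + h)) (mconvW μ (p'.1, p'.2 + h))
    linarith
  have hfar := phi_far (μ := μ) p p' hl (by positivity : 0 ≤ (n : ℝ) + cL n)
    (by have := hcomb 0 (by simpa using h2); simpa using this)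
    (by
      have := (measurePreserving_add_left (volume : Measure ℝ) p.2).quasiMeasurePreserving.ae h1
      filter_upwards [this] with h hh
      exact hcomb h hh)
  have hnear := phi_near hn hg p hl (cubeBall Q) (pball_meas _ _) (cubeBall_far Q hpQ)
  rw [halfT_eq_phi, ← integral_sub h3 (hp'2.indicator hSm)]
  refine (enorm_integral_le_lintegral_enorm _).trans ?_
  have hm1 := phi_meas μ p
  have hm2 := phi_meas μ p'
  calc _ ≤ ∫⁻ h : ℝ, ((if |h| ≤ Q.len ^ 2 then ‖phi μ p h‖ₑ else 0) + (if Q.len ^ 2 < |h| then ‖phi μ p h - phi μ p' h‖ₑ else 0)) := by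
        refine lintegral_mono fun h => ?_
        by_cases hc : Q.len ^ 2 < |h|
        · simp [hc, not_le.2 hc]
        · simp [hc, not_lt.1 hc]
    _ = (∫⁻ h : ℝ, (if |h| ≤ Q.len ^ 2 then ‖phi μ p h‖ₑ else 0)) + ∫⁻ h : ℝ, (if Q.len ^ 2 < |h| then ‖phi μ p h - phi μ p' h‖ₑ else 0) := by
        refine lintegral_add_right _ ?_
        exact Measurable.ite hSm (by fun_prop) measurable_const
    _ ≤ ((∫⁻ y in cubeBall Q, AK (p - y) ∂μ) + ENNReal.ofReal (2 * cF n * 4 ^ (n + 2))) + ENNReal.ofReal (8 * (n + cL n)) := add_le_add hnear hfar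
    _ = _ := by
        rw [add_assoc, ← ENNReal.ofReal_add (by positivity) (by positivity)]; rfl

/-- BMO constant. -/
def cBB (n : ℕ) : ℝ := 5 * cK n * (n + 4) ^ (n + 1) + cO n
lemma cBB_pos (n : ℕ) : 0 < cBB n := by unfold cBB; have := cK_pos n; have := cO_pos n; positivity

lemma bmo_near_int {n : ℕ} {μ : Measure (Pt n)} [IsFiniteMeasure μ] (hg : PGrowth μ) (Q : PCube n) :
    ∫⁻ p in Q.toSet, ∫⁻ y in cubeBall Q, AK (p - y) ∂μ ≤ ENNReal.ofReal (5 * cK n * (n + 4) ^ (n + 1) * Q.len ^ (n + 2)) := by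
  have hl := Q.len_pos
  have hcK := cK_pos n
  have hT : 0 < Q.len ^ 2 := by positivity
  have h := lint_time_AK_conv (μ.restrict (cubeBall Q)) ((Icc Q.time (Q.time + Q.len ^ 2)).indicator fun _ => 1)
    (measurable_const.indicator measurableSet_Icc) 1 (fun t => by
      by_cases ht : t ∈ Icc Q.time (Q.time + Q.len ^ 2) <;> simp [ht]) hT
  have h2 : ∫⁻ p in Q.toSet, ∫⁻ y in cubeBall Q, AK (p - y) ∂μ ≤
      ∫⁻ p : Pt n, (Icc Q.time (Q.time + Q.len ^ 2)).indicator (fun _ => (1 : ENNReal)) p.2 * ∫⁻ y in cubeBall Q, AK (p - y) ∂μ := by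
    rw [← lintegral_indicator (cube_meas Q)]
    refine lintegral_mono fun p => ?_
    by_cases hp : p ∈ Q.toSet
    · rw [indicator_of_mem hp, indicator_of_mem hp.2, one_mul]
    · rw [indicator_of_notMem hp]; exact zero_le
  refine h2.trans (h.trans ?_)
  rw [lintegral_indicator measurableSet_Icc, setLIntegral_const, Real.volume_Icc, Real.sqrt_sq hl.le, Measure.restrict_apply_univ,
    add_sub_cancel_left, one_mul, one_mul, ← ENNReal.ofReal_mul (by positivity), ← ENNReal.ofReal_add (by positivity) (by positivity),
    ← ENNReal.ofReal_mul hcK.le]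
  have h3 : μ (cubeBall Q) ≤ _ := hg _ ((n + 4) * Q.len) (by positivity)
  refine (mul_le_mul_right h3 _).trans ?_
  rw [← ENNReal.ofReal_mul (by positivity)]
  refine ENNReal.ofReal_le_ofReal (le_of_eq ?_)
  rw [mul_pow]
  field_simp
  ring

lemma bmo_main {n : ℕ} (hn : 1 ≤ n) {μ : Measure (Pt n)} [IsFiniteMeasure μ] (hg : PGrowth μ)
    (hgrad : ∀ p, ‖mconvGradW μ p‖ ≤ 1) : ParabBMOLe (halfT (mconvW μ)) (2 * cBB n) := by
  intro Q
  have hl := Q.len_pos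
  have hcK := cK_pos n
  have hcO := cO_pos n
  have hBB := cBB_pos n
  set b := halfT (mconvW μ) with hb
  have hbi : ∀ Q : PCube n, IntegrableOn b Q.toSet := halfT_cube_int μ
  obtain ⟨c, hc⟩ := bmo_point hn hg hgrad Q
  have h1 : ∫⁻ p in Q.toSet, ‖b p - c‖ₑ ≤ ENNReal.ofReal (cBB n * Q.len ^ (n + 2)) := by
    calc _ ≤ ∫⁻ p in Q.toSet, ((∫⁻ y in cubeBall Q, AK (p - y) ∂μ) + ENNReal.ofReal (cO n)) := lintegral_mono_ae hc
      _ = (∫⁻ p in Q.toSet, ∫⁻ y in cubeBall Q, AK (p - y) ∂μ) + ENNReal.ofReal (cO n) * ENNReal.ofReal (Q.len ^ (n + 2)) := by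
          rw [lintegral_add_right _ measurable_const, setLIntegral_const, cube_vol]
      _ ≤ ENNReal.ofReal (5 * cK n * (n + 4) ^ (n + 1) * Q.len ^ (n + 2)) + ENNReal.ofReal (cO n) * ENNReal.ofReal (Q.len ^ (n + 2)) := by
          gcongr; exact bmo_near_int hg Q
      _ = _ := by
          rw [← ENNReal.ofReal_mul hcO.le, ← ENNReal.ofReal_add (by positivity) (by positivity)]
          unfold cBB; congr 1; ring
  have h2 : ∫ p in Q.toSet, |b p - c| ≤ cBB n * Q.len ^ (n + 2) := by
    have h3 : ∫ p in Q.toSet, |b p - c| = (∫⁻ p in Q.toSet, ‖b p - c‖ₑ).toReal := by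
      simp only [← Real.norm_eq_abs]
      exact integral_norm_eq_lintegral_enorm (((hbi Q).sub (cube_int_const Q c)).aestronglyMeasurable)
    rw [h3]
    exact ENNReal.toReal_le_of_le_ofReal (by positivity) h1
  have hv : 0 < Q.len ^ (n + 2) := by positivity
  have h4 : |(⨍ q in Q.toSet, b q) - c| ≤ cBB n := by
    refine (avg_sub_le hbi Q c).trans ?_
    rw [inv_mul_le_iff₀ hv]; linarith
  rw [setAverage_eq, cube_volr, smul_eq_mul, inv_mul_le_iff₀ hv]
  calc ∫ p in Q.toSet, |b p - ⨍ q in Q.toSet, b q| ≤ ∫ p in Q.toSet, (|b p - c| + cBB n) := by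
        refine setIntegral_mono (cube_int_abs hbi Q _) ((cube_int_abs hbi Q c).add (cube_int_const Q _)) fun p => ?_
        have := abs_sub_le (b p) c (⨍ q in Q.toSet, b q)
        rw [abs_sub_comm c] at this
        simp only
        linarith
    _ = (∫ p in Q.toSet, |b p - c|) + cBB n * Q.len ^ (n + 2) := by
        rw [integral_add (cube_int_abs hbi Q c) (cube_int_const Q _), setIntegral_const, cube_volr, smul_eq_mul, mul_comm (Q.len ^ _)]
    _ ≤ _ := by linarith

lemma mconvW_smul {n : ℕ} (μ : Measure (Pt n)) {a : ℝ} (ha : 0 ≤ a) (p : Pt n) :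
    mconvW (ENNReal.ofReal a • μ) p = a * mconvW μ p := by
  unfold mconvW
  rw [integral_smul_measure, ENNReal.toReal_ofReal ha, smul_eq_mul]

lemma mconvGradW_smul {n : ℕ} (μ : Measure (Pt n)) {a : ℝ} (ha : 0 ≤ a) (p : Pt n) :
    mconvGradW (ENNReal.ofReal a • μ) p = a • mconvGradW μ p := by
  unfold mconvGradW
  rw [integral_smul_measure, ENNReal.toReal_ofReal ha]

lemma halfT_smul {n : ℕ} (μ : Measure (Pt n)) {a : ℝ} (ha : 0 ≤ a) (p : Pt n) :
    halfT (mconvW (ENNReal.ofReal a • μ)) p = a * halfT (mconvW μ) p := by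
  unfold halfT
  rw [← integral_const_mul]
  refine integral_congr_ae (.of_forall fun s => ?_)
  simp only [mconvW_smul μ ha]
  ring

lemma bmo_smul {n : ℕ} (μ : Measure (Pt n)) {a C : ℝ} (ha : 0 ≤ a) (h : ParabBMOLe (halfT (mconvW μ)) C) :
    ParabBMOLe (halfT (mconvW (ENNReal.ofReal a • μ))) (a * C) := by
  intro Q
  have e : ∀ p, |halfT (mconvW (ENNReal.ofReal a • μ)) p - ⨍ q in Q.toSet, halfT (mconvW (ENNReal.ofReal a • μ)) q| =
      a * |halfT (mconvW μ) p - ⨍ q in Q.toSet, halfT (mconvW μ) q| := by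
    intro p
    simp only [halfT_smul μ ha, setAverage_eq, integral_const_mul, smul_eq_mul]
    rw [← abs_of_nonneg ha, ← abs_mul, abs_of_nonneg ha]
    congr 1; ring
  have h1 := h Q
  simp only [e]
  rw [setAverage_eq] at h1 ⊢
  rw [integral_const_mul, smul_eq_mul]
  rw [smul_eq_mul] at h1
  calc _ = a * ((volume.real Q.toSet)⁻¹ * ∫ p in Q.toSet, |halfT (mconvW μ) p - ⨍ q in Q.toSet, halfT (mconvW μ) q|) := by ring
    _ ≤ _ := by gcongr

lemma compact_ball {n : ℕ} {E : Set (Pt n)} (hE : IsCompact E) : ∃ R : ℝ, 0 < R ∧ E ⊆ pball 0 R := by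
  obtain ⟨C, hC⟩ := hE.exists_bound_of_continuousOn (pnorm_cont (n := n)).continuousOn
  refine ⟨max C 0 + 1, by positivity, fun p hp => ?_⟩
  change pnorm (p - 0) < _
  rw [sub_zero]
  have := (le_abs_self _).trans (hC p hp)
  linarith [le_max_left C 0]

lemma fin_of {n : ℕ} {μ : Measure (Pt n)} {E : Set (Pt n)} (h : μ Eᶜ = 0) (h2 : μ E ≠ ⊤) : IsFiniteMeasure μ := by
  constructor
  rw [← union_compl_self E]
  refine lt_of_le_of_lt (measure_union_le _ _) ?_
  rw [h, add_zero]; exact h2.lt_top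

lemma final {n : ℕ} (hn : 1 ≤ n) :
    ∃ c₁ c₂ : ℝ, 0 < c₁ ∧ 0 < c₂ ∧ ∀ E : Set (Pt n), IsCompact E →
      c₁ * S1cap n E ≤ gammaThetaPlus n E ∧ gammaThetaPlus n E ≤ c₂ * S1cap n E := by
  set C := max 1 (2 * cBB n) with hC
  have hC1 : 1 ≤ C := le_max_left _ _
  have hC2 : 2 * cBB n ≤ C := le_max_right _ _
  have hC0 : 0 < C := by linarith
  have hG1 := one_le_cGr n
  have hG0 : 0 < cGr n := by linarith
  refine ⟨C⁻¹, cGr n, by positivity, hG0, fun E hE => ?_⟩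
  obtain ⟨R, hR, hER⟩ := compact_ball hE
  have hgrad0 : ∀ p : Pt n, ‖mconvGradW (0 : Measure (Pt n)) p‖ ≤ 1 := by
    intro p; unfold mconvGradW; simp
  have hsm : ∀ (μ : Measure (Pt n)) (a : ℝ), 0 ≤ a → a ≤ 1 → (∀ p, ‖mconvGradW μ p‖ ≤ 1) →
      ∀ p, ‖mconvGradW (ENNReal.ofReal a • μ) p‖ ≤ 1 := by
    intro μ a ha ha1 h p
    rw [mconvGradW_smul μ ha, norm_smul, Real.norm_of_nonneg ha]
    exact mul_le_one₀ ha1 (norm_nonneg _) (h p)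
  have hcE : ∀ (μ : Measure (Pt n)) (a : ℝ), μ Eᶜ = 0 → (ENNReal.ofReal a • μ) Eᶜ = 0 := by
    intro μ a h; rw [Measure.smul_apply, h]; simp
  have htR : ∀ (μ : Measure (Pt n)) (a : ℝ), 0 ≤ a → ((ENNReal.ofReal a • μ) E).toReal = a * (μ E).toReal := by
    intro μ a h; rw [Measure.smul_apply, smul_eq_mul, ENNReal.toReal_mul, ENNReal.toReal_ofReal h]
  have hSfin : ∀ μ : Measure (Pt n), PGrowth μ → μ E ≤ ENNReal.ofReal (R ^ (n + 1)) :=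
    fun μ h => (measure_mono hER).trans (h 0 R hR)
  have hSb : BddAbove {r : ℝ | ∃ μ : Measure (Pt n), μ Eᶜ = 0 ∧ PGrowth μ ∧
    (∀ p, ‖mconvGradW μ p‖ ≤ 1) ∧ r = (μ E).toReal} := by
    refine ⟨R ^ (n + 1), ?_⟩
    rintro r ⟨μ, h1, h2, h3, rfl⟩
    exact ENNReal.toReal_le_of_le_ofReal (by positivity) (hSfin μ h2)
  have hGb : BddAbove {r : ℝ | ∃ μ : Measure (Pt n), μ Eᶜ = 0 ∧
    (∀ p, ‖mconvGradW μ p‖ ≤ 1) ∧ ParabBMOLe (halfT (mconvW μ)) 1 ∧ r = (μ E).toReal} := by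
    refine ⟨cGr n * R ^ (n + 1), ?_⟩
    rintro r ⟨μ, h1, h2, h3, rfl⟩
    by_cases hf : μ E = ⊤
    · rw [hf]; simp; positivity
    · have := fin_of h1 hf
      exact ENNReal.toReal_le_of_le_ofReal (by positivity) ((measure_mono hER).trans (growth hn μ h2 h3 0 R hR))
  have hSn : (0 : ℝ) ∈ {r : ℝ | ∃ μ : Measure (Pt n), μ Eᶜ = 0 ∧ PGrowth μ ∧
    (∀ p, ‖mconvGradW μ p‖ ≤ 1) ∧ r = (μ E).toReal} := by
    refine ⟨0, by simp, fun c r hr => by simp, hgrad0, by simp⟩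
  have hS1 : ∀ μ : Measure (Pt n), μ Eᶜ = 0 → PGrowth μ → (∀ p, ‖mconvGradW μ p‖ ≤ 1) → C⁻¹ * (μ E).toReal ≤ gammaThetaPlus n E := by
    intro μ h1 h2 h3
    have := fin_of h1 (ne_top_of_le_ne_top ENNReal.ofReal_ne_top (hSfin μ h2))
    have ha : 0 ≤ C⁻¹ := by positivity
    have hB := bmo_smul μ ha (bmo_main hn h2 h3)
    refine le_csSup hGb ⟨ENNReal.ofReal C⁻¹ • μ, hcE μ _ h1, hsm μ _ ha (inv_le_one_of_one_le₀ hC1) h3, ?_, (htR μ _ ha).symm⟩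
    intro Q
    refine (hB Q).trans ?_
    rw [inv_mul_le_iff₀ hC0]; linarith
  have hG0' : 0 ≤ gammaThetaPlus n E := by
    have := hS1 0 (by simp) (fun c r hr => by simp) hgrad0
    simpa using this
  constructor
  · rw [inv_mul_le_iff₀ hC0]
    refine csSup_le ⟨0, hSn⟩ ?_
    rintro r ⟨μ, h1, h2, h3, rfl⟩
    rw [← inv_mul_le_iff₀ hC0]
    exact hS1 μ h1 h2 h3
  · have hS0 : 0 ≤ S1cap n E := le_csSup hSb hSn
    refine Real.sSup_le ?_ (by positivity)
    rintro r ⟨μ, h1, h2, h3, rfl⟩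
    by_cases hf : μ E = ⊤
    · rw [hf]; simp; positivity
    · have := fin_of h1 hf
      have ha : 0 ≤ (cGr n)⁻¹ := by positivity
      rw [← inv_mul_le_iff₀ hG0]
      refine le_csSup hSb ⟨ENNReal.ofReal (cGr n)⁻¹ • μ, hcE μ _ h1, ?_, hsm μ _ ha (inv_le_one_of_one_le₀ hG1) h2, (htR μ _ ha).symm⟩
      intro c r hr
      rw [Measure.smul_apply, smul_eq_mul]
      refine (mul_le_mul_right (growth hn μ h2 h3 c r hr) _).trans ?_
      rw [← ENNReal.ofReal_mul ha]
      refine ENNReal.ofReal_le_ofReal (le_of_eq ?_)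
      field_simp

/-- `γ_{Θ,+}(E) ≈ S₁(E)` for compact sets `E`. -/
theorem gammaThetaPlus_comparable_S1 (n : ℕ) (hn : 1 ≤ n) :
    ∃ c₁ c₂ : ℝ, 0 < c₁ ∧ 0 < c₂ ∧ ∀ E : Set (Pt n), IsCompact E →
      c₁ * S1cap n E ≤ gammaThetaPlus n E ∧ gammaThetaPlus n E ≤ c₂ * S1cap n E := by
  exact final hn
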